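/- Let G = ℤ^{t_1} ∗ ℤ^{t_2} ∗ ⋯ ∗ ℤ^{t_n} be a free product of n free abelian groups, where each t_i ≥ 1. Then for every endomorphism φ of G, the fixed subgroup Fix(φ) is finitely generated and rk(Fix(φ)) ≤ n·(rk(G) − n + 1), where rk(G) = t_1 + ⋯ + t_n. In particular, if t_1 = t_2 = ⋯ = t_n, then rk(Fix(φ)) ≤ rk(G). -/

import Mathlib

/-- The fixed subgroup of an endomorphism. -/
def fixedSubgroup {G : Type*} [Group G] (φ : G →* G) : Subgroup G where
  carrier := {g | φ g = g}
  one_mem' := by simp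
  mul_mem' := by
    intro a b ha hb
    simp only [Set.mem_setOf_eq, map_mul] at *
    rw [ha, hb]
  inv_mem' := by
    intro a ha
    simp only [Set.mem_setOf_eq, map_inv] at *
    rw [ha]

namespace FreeProductFix

section Faithful

open Polynomial Monoid

/-- The linear form `z ↦ j z₀ - z₁`. -/
def slopeForm {R : Type*} [CommRing R] (j : ℕ) (z : Fin 2 → R) : R := j * z 0 - z 1

/-- The square-zero matrix whose kernel and image are both spanned by `(1, i)`. -/
def slopeMatrix (R : Type*) [CommRing R] (i : ℕ) : Matrix (Fin 2) (Fin 2) R :=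
  !![(i : R), -1; (i : R) * i, -i]

lemma slopeMatrix_mul_self (R : Type*) [CommRing R] (i : ℕ) :
    slopeMatrix R i * slopeMatrix R i = 0 := by
  ext a b
  fin_cases a <;> fin_cases b <;> (simp [slopeMatrix, Matrix.mul_apply, Fin.sum_univ_two]; try ring)

/-- The one-parameter group of transvections with axis `(1, i)`. -/
noncomputable def transvection {A K : Type*} [CommGroup A] [CommRing K] (i : ℕ)
    (θ : A →* Multiplicative K) : A →* Matrix (Fin 2) (Fin 2) K[X] where
  toFun a := 1 + (C (θ a).toAdd * X : K[X]) • slopeMatrix K[X] i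
  map_one' := by simp
  map_mul' a b := by
    simp only [map_mul, toAdd_mul, C_add, add_mul, add_smul, mul_add, mul_one, one_mul,
      Matrix.smul_mul, Matrix.mul_smul, slopeMatrix_mul_self, smul_zero]
    abel

lemma slopeForm_transvection {A K : Type*} [CommGroup A] [CommRing K] (i j : ℕ)
    (θ : A →* Multiplicative K) (a : A) (z : Fin 2 → K[X]) :
    slopeForm j ((transvection i θ a).mulVec z) =
      slopeForm j z + C (θ a).toAdd * X * slopeForm i z * ((j : K[X]) - (i : K[X])) := by
  simp [slopeForm, transvection, slopeMatrix, Matrix.mulVec, dotProduct, Fin.sum_univ_two]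
  ring

variable {n : ℕ} {M : Fin n → Type*} [∀ i, CommGroup (M i)] {K : Type*} [CommRing K]

/-- A representation of a free product of abelian groups by matrices over a polynomial ring. -/
noncomputable def polyRep (θ : ∀ i, M i →* Multiplicative K) :
    CoprodI M →* Matrix (Fin 2) (Fin 2) K[X] :=
  CoprodI.lift fun i => transvection (i : ℕ) (θ i)

lemma degree_slopeForm_polyRep [IsDomain K] [CharZero K] (θ : ∀ i, M i →* Multiplicative K)
    (hθ : ∀ i, Function.Injective (θ i)) (w : CoprodI.Word M) :
    ∀ j : ℕ, ((∀ i : Fin n, w.fstIdx = some i → (i : ℕ) ≠ j) →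
      (slopeForm j ((polyRep θ w.prod).mulVec ![0, 1])).degree = w.toList.length) ∧
      (slopeForm j ((polyRep θ w.prod).mulVec ![0, 1])).degree ≤ w.toList.length := by
  induction w using CoprodI.Word.consRecOn with
  | empty =>
    intro j
    rw [CoprodI.Word.prod_empty, map_one, Matrix.one_mulVec]
    simp [slopeForm]
  | cons i m w h1 h2 ih =>
    intro j
    have hθm : (θ i m).toAdd ≠ 0 := by
      intro h
      apply h2
      apply hθ i
      rw [map_one]
      exact h
    have key : slopeForm j ((polyRep θ (CoprodI.Word.cons m w h1 h2).prod).mulVec ![0, 1]) =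
        slopeForm j ((polyRep θ w.prod).mulVec ![0, 1]) + C (θ i m).toAdd * X *
          slopeForm i ((polyRep θ w.prod).mulVec ![0, 1]) * ((j : K[X]) - ((i : ℕ) : K[X])) := by
      rw [CoprodI.Word.prod_cons, map_mul, ← Matrix.mulVec_mulVec, ← slopeForm_transvection]
      simp [polyRep]
    have hi := (ih i).1 (fun i' hi' h => h1 (by rw [hi', Fin.ext h]))
    have hj := (ih j).2
    have hlen : ((CoprodI.Word.cons m w h1 h2).toList.length : WithBot ℕ)
        = (w.toList.length : WithBot ℕ) + 1 := by
      simp [CoprodI.Word.cons]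
    rw [key, hlen]
    by_cases hij : (i : ℕ) = j
    · subst hij
      constructor
      · intro h
        exact absurd rfl (h i (by simp))
      · simp only [sub_self, mul_zero, add_zero]
        rw [hi]
        exact_mod_cast Nat.le_succ _
    · have hdeg : (C (θ i m).toAdd * X *
          slopeForm i ((polyRep θ w.prod).mulVec ![0, 1]) * ((j : K[X]) - ((i : ℕ) : K[X]))).degree
          = (w.toList.length : WithBot ℕ) + 1 := by
        have : ((j : K[X]) - ((i : ℕ) : K[X])) = C ((j : K) - ((i : ℕ) : K)) := by simp
        have h3 : (j : K) - ((i : ℕ) : K) ≠ 0 := by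
          rw [sub_ne_zero]
          exact_mod_cast fun (h : j = (i : ℕ)) => hij h.symm
        rw [this, degree_mul, degree_mul, degree_mul, degree_C h3, degree_C hθm, hi, degree_X]
        simp [add_comm]
      have hlt : (slopeForm j ((polyRep θ w.prod).mulVec ![0, 1])).degree <
          (w.toList.length : WithBot ℕ) + 1 :=
        lt_of_le_of_lt hj (by exact_mod_cast Nat.lt_succ_self _)
      have : (slopeForm j ((polyRep θ w.prod).mulVec ![0, 1]) + C (θ i m).toAdd * X *
          slopeForm i ((polyRep θ w.prod).mulVec ![0, 1]) * ((j : K[X]) - ((i : ℕ) : K[X]))).degree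
          = (w.toList.length : WithBot ℕ) + 1 := by
        rw [degree_add_eq_right_of_degree_lt (by rw [hdeg]; exact hlt), hdeg]
      exact ⟨fun _ => this, this.le⟩

lemma polyRep_injective [IsDomain K] [CharZero K] (θ : ∀ i, M i →* Multiplicative K)
    (hθ : ∀ i, Function.Injective (θ i)) (g : CoprodI M) (hg : polyRep θ g = 1) : g = 1 := by
  classical
  obtain ⟨w, rfl⟩ := CoprodI.Word.equiv.symm.surjective g
  change polyRep θ w.prod = 1 at hg
  change w.prod = 1
  have h := (degree_slopeForm_polyRep θ hθ w n).1 (fun i _ => i.2.ne)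
  rw [hg, Matrix.one_mulVec] at h
  have h0 : slopeForm n (![0, 1] : Fin 2 → K[X]) = -1 := by simp [slopeForm]
  rw [h0, degree_neg, degree_one] at h
  have h1 : w.toList = [] := List.length_eq_zero_iff.mp (by exact_mod_cast h.symm)
  simp [CoprodI.Word.prod, h1]

lemma polyRep_congr_one (θ : ∀ i, M i →* Multiplicative K) (g : CoprodI M) :
    (polyRep θ g).map (evalRingHom 0) = 1 := by
  have : ((RingHom.mapMatrix (evalRingHom (0 : K))).toMonoidHom.comp (polyRep θ)) = 1 := by
    apply CoprodI.ext_hom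
    intro i
    ext a : 1
    simp [polyRep, transvection]
    ext a b
    simp [slopeMatrix]
    fin_cases a <;> fin_cases b <;> simp
  exact DFunLike.congr_fun this g

lemma coprodI_torsionFree [IsDomain K] [CharZero K] (θ : ∀ i, M i →* Multiplicative K)
    (hθ : ∀ i, Function.Injective (θ i)) (g : CoprodI M) {m : ℕ} (hm : m ≠ 0) (hg : g ^ m = 1) :
    g = 1 := by
  apply polyRep_injective θ hθ
  set A := polyRep θ g with hA
  have h1 : A ^ m = 1 := by rw [hA, ← map_pow, hg, map_one]
  have h2 : (A - 1) * (∑ i ∈ Finset.range m, A ^ i) = 0 := by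
    rw [mul_geom_sum, h1, sub_self]
  have h3 : (∑ i ∈ Finset.range m, A ^ i).det ≠ 0 := by
    intro h
    have h4 := congrArg (evalRingHom (0 : K)) h
    rw [RingHom.map_det, map_sum, map_zero] at h4
    have h5 : (evalRingHom (0 : K)).mapMatrix A = 1 := polyRep_congr_one θ g
    simp only [map_pow, h5, one_pow, Finset.sum_const, Finset.card_range] at h4
    rw [← Matrix.diagonal_one, ← Matrix.diagonal_smul, Matrix.det_diagonal] at h4
    simp [hm] at h4
  have h6 := congrArg (· * (∑ i ∈ Finset.range m, A ^ i).adjugate) h2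
  simp only [mul_assoc, Matrix.mul_adjugate, zero_mul] at h6
  rw [mul_smul_comm, mul_one] at h6
  have h7 : A - 1 = 0 := by
    refine Matrix.ext fun i j => ?_
    have := congrFun (congrFun h6 i) j
    simp only [Matrix.smul_apply, smul_eq_mul, Matrix.zero_apply, mul_eq_zero, h3, false_or] at this
    simpa using this
  exact sub_eq_zero.mp h7

end Faithful

section Iterate

variable {G : Type*} [Group G]

/-- The iterates of an endomorphism, as endomorphisms. -/
def iterHom (φ : G →* G) : ℕ → G →* G
  | 0 => MonoidHom.id G
  | k + 1 => (iterHom φ k).comp φ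

@[simp]
lemma iterHom_apply (φ : G →* G) (k : ℕ) (g : G) : iterHom φ k g = φ^[k] g := by
  induction k generalizing g with
  | zero => rfl
  | succ k ih => simp [iterHom, ih]

end Iterate

section Noetherian

open MvPolynomial (X eval₂Hom)

/-- A finitely generated linear group over a commutative ring satisfies: the kernels of the iterates
of an endomorphism stabilise. -/
lemma exists_ker_iterate_stable {G R ι : Type*} [Group G] [Group.FG G] [CommRing R] [Fintype ι]
    [DecidableEq ι] (ρ : G →* Matrix ι ι R) (hρ : Function.Injective ρ) (φ : G →* G) :
    ∃ K : ℕ, ∀ g, φ^[K + 1] g = 1 → φ^[K] g = 1 := by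
  classical
  obtain ⟨S, hS⟩ := (Monoid.fg_def (M := G)).mp (Group.fg_iff_monoid_fg.mp inferInstance)
  let f : FreeMonoid S →* G := FreeMonoid.lift fun s => (s : G)
  have hf : Function.Surjective f := by
    rw [← MonoidHom.mrange_eq_top, FreeMonoid.mrange_lift]
    simpa using hS
  let P := MvPolynomial (S × ι × ι) ℤ
  let Ψ : FreeMonoid S →* Matrix ι ι P := FreeMonoid.lift fun s => Matrix.of fun a b => X (s, a, b)
  let I : ℕ → Ideal P := fun k => Ideal.span
    {p | ∃ u v : FreeMonoid S, φ^[k] (f u) = φ^[k] (f v) ∧ ∃ a b, p = Ψ u a b - Ψ v a b}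
  have hI : Monotone I := by
    apply monotone_nat_of_le_succ
    intro k
    apply Ideal.span_mono
    rintro p ⟨u, v, h, a, b, rfl⟩
    exact ⟨u, v, by rw [Function.iterate_succ_apply', Function.iterate_succ_apply', h], a, b, rfl⟩
  obtain ⟨K, hK⟩ := monotone_stabilizes_iff_noetherian.mpr (inferInstance : IsNoetherian P P)
    ⟨I, hI⟩
  refine ⟨K, fun g hg => ?_⟩
  let e : P →+* R := eval₂Hom (Int.castRingHom R) fun x => ρ (φ^[K] (x.1 : G)) x.2.1 x.2.2
  have he : ∀ u, e.mapMatrix (Ψ u) = ρ (φ^[K] (f u)) := by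
    suffices h : (((e.mapMatrix : Matrix ι ι P →+* Matrix ι ι R) : Matrix ι ι P →* Matrix ι ι R).comp Ψ) =
        (ρ.comp (iterHom φ K)).comp f from fun u => by simpa using DFunLike.congr_fun h u
    apply FreeMonoid.hom_eq
    intro s
    ext a b
    simp [Ψ, f, e]
    exact MvPolynomial.eval₂_X _ _ _
  obtain ⟨u, rfl⟩ := hf g
  apply hρ
  rw [← he, map_one]
  have h1 : ∀ a b, e (Ψ u a b - Ψ 1 a b) = 0 := by
    intro a b
    have hmem : Ψ u a b - Ψ 1 a b ∈ I K := by
      have : I K = I (K + 1) := hK (K + 1) (Nat.le_succ K)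
      rw [this]
      exact Ideal.subset_span ⟨u, 1, by rw [hg]; simp [iterate_map_one], a, b, rfl⟩
    have : I K ≤ RingHom.ker e := by
      apply Ideal.span_le.mpr
      rintro p ⟨u, v, h, a, b, rfl⟩
      have hh : ∀ u, e (Ψ u a b) = ρ (φ^[K] (f u)) a b := fun u => by rw [← he]; rfl
      simp [RingHom.mem_ker, hh, h]
    exact this hmem
  ext a b
  have := h1 a b
  rw [map_sub, sub_eq_zero] at this
  simpa [Matrix.one_apply, apply_ite] using this

end Noetherian

end FreeProductFix

namespace FreeProductFix

section L2

open scoped RealInnerProductSpace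

/-- The real Hilbert space of square-summable functions. -/
abbrev L2 (I : Type*) := lp (fun _ : I => ℝ) 2

variable {I K : Type*}

/-- The standard Hilbert basis. -/
noncomputable def stdBasis (I : Type*) : HilbertBasis I ℝ (L2 I) :=
  HilbertBasis.ofRepr (LinearIsometryEquiv.refl ℝ _)

/-- The indicator function of a point. -/
noncomputable def dirac (i : I) : L2 I := stdBasis I i

@[simp]
lemma inner_dirac (i : I) (v : L2 I) : ⟪dirac i, v⟫ = v i :=
  ((stdBasis I).repr_apply_apply v i).symm

@[simp]
lemma inner_dirac' (i : I) (v : L2 I) : ⟪v, dirac i⟫ = v i := by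
  rw [real_inner_comm, inner_dirac]

lemma orthonormal_dirac : Orthonormal ℝ (dirac : I → L2 I) := (stdBasis I).orthonormal

@[simp]
lemma norm_dirac (i : I) : ‖dirac i‖ = 1 := orthonormal_dirac.1 i

lemma dirac_apply [DecidableEq I] (i j : I) : (dirac i : L2 I) j = if i = j then 1 else 0 := by
  rw [← inner_dirac, orthonormal_iff_ite.mp orthonormal_dirac]
  simp [eq_comm]

lemma dense_span_dirac : Dense (Submodule.span ℝ (Set.range (dirac : I → L2 I)) : Set (L2 I)) := by
  rw [← Submodule.dense_iff_topologicalClosure_eq_top.symm]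
  exact (stdBasis I).dense_span

lemma clm_ext {E : Type*} [NormedAddCommGroup E] [NormedSpace ℝ E] {A B : L2 I →L[ℝ] E}
    (h : ∀ i, A (dirac i) = B (dirac i)) : A = B :=
  ContinuousLinearMap.ext_on dense_span_dirac (by rintro _ ⟨i, rfl⟩; exact h i)

lemma hasSum_mul_inner (v w : L2 I) : HasSum (fun i => v i * w i) ⟪v, w⟫ := by
  have h : (fun i => v i * w i) = fun i => ⟪v, stdBasis I i⟫ * ⟪stdBasis I i, w⟫ := by
    funext i
    change _ = ⟪v, dirac i⟫ * ⟪dirac i, w⟫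
    simp
  rw [h]
  exact (stdBasis I).hasSum_inner_mul_inner v w

/-- The isometry induced by an injective map of index sets. -/
noncomputable def push (f : I → K) (hf : Function.Injective f) : L2 I →ₗᵢ[ℝ] L2 K :=
  (orthonormal_dirac.comp f hf).orthogonalFamily.linearIsometry

@[simp]
lemma push_dirac (f : I → K) (hf : Function.Injective f) (i : I) :
    push f hf (dirac i) = dirac (f i) := by
  classical
  have h : (dirac i : L2 I) = lp.single 2 i (1 : ℝ) := by
    ext j
    rw [dirac_apply, lp.single_apply, Pi.single_apply]
    simp [eq_comm]
  rw [h, push, OrthogonalFamily.linearIsometry_apply_single]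
  simp

@[simp]
lemma push_apply (f : I → K) (hf : Function.Injective f) (v : L2 I) (i : I) :
    push f hf v (f i) = v i := by
  rw [← inner_dirac, ← push_dirac f hf, LinearIsometry.inner_map_map, inner_dirac]

end L2

section Trace

open scoped RealInnerProductSpace InnerProduct

variable {Q : Type*} [Group Q] {α β : Type*}

lemma translate_injective (α : Type*) (x : Q) :
    Function.Injective (fun p : Q × α => (x * p.1, p.2)) := by
  rintro ⟨a, b⟩ ⟨c, d⟩ h
  simpa using h

/-- Left translation on `ℓ²(Q × α)`. -/
noncomputable def leftTranslate (α : Type*) (x : Q) : L2 (Q × α) →L[ℝ] L2 (Q × α) :=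
  (push _ (translate_injective α x)).toContinuousLinearMap

@[simp]
lemma leftTranslate_dirac (x g : Q) (j : α) :
    leftTranslate α x (dirac (g, j)) = dirac (x * g, j) := by
  exact push_dirac _ (translate_injective α x) _

/-- Operators that commute with left translations. -/
def IsEquivariant (A : L2 (Q × α) →L[ℝ] L2 (Q × β)) : Prop :=
  ∀ x : Q, A ∘L leftTranslate α x = leftTranslate β x ∘L A

lemma leftTranslate_apply (x g : Q) (j : α) (v : L2 (Q × α)) :
    leftTranslate α x v (x * g, j) = v (g, j) :=
  push_apply _ (translate_injective α x) v (g, j)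

lemma adjoint_leftTranslate (x : Q) :
    ContinuousLinearMap.adjoint (leftTranslate α x) = leftTranslate α x⁻¹ := by
  apply clm_ext
  rintro ⟨g, j⟩
  ext ⟨h, k⟩
  rw [← inner_dirac, ContinuousLinearMap.adjoint_inner_right, leftTranslate_dirac, inner_dirac',
    leftTranslate_dirac]
  classical
  simp only [dirac_apply, Prod.mk.injEq, inv_mul_eq_iff_eq_mul]
  simp only [eq_comm]

lemma IsEquivariant.adjoint {A : L2 (Q × α) →L[ℝ] L2 (Q × β)} (hA : IsEquivariant A) :
    IsEquivariant (ContinuousLinearMap.adjoint A) := by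
  intro x
  have := congrArg ContinuousLinearMap.adjoint (hA x⁻¹)
  rw [ContinuousLinearMap.adjoint_comp, ContinuousLinearMap.adjoint_comp, adjoint_leftTranslate,
    adjoint_leftTranslate, inv_inv] at this
  exact this.symm

lemma IsEquivariant.comp {γ : Type*} {A : L2 (Q × β) →L[ℝ] L2 (Q × γ)}
    {B : L2 (Q × α) →L[ℝ] L2 (Q × β)} (hA : IsEquivariant A) (hB : IsEquivariant B) :
    IsEquivariant (A ∘L B) := by
  intro x
  rw [ContinuousLinearMap.comp_assoc, hB x, ← ContinuousLinearMap.comp_assoc, hA x,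
    ContinuousLinearMap.comp_assoc]

lemma IsEquivariant.apply_translate {A : L2 (Q × α) →L[ℝ] L2 (Q × β)} (hA : IsEquivariant A)
    (x g h : Q) (i : α) (j : β) :
    A (dirac (x * h, i)) (x * g, j) = A (dirac (h, i)) (g, j) := by
  have := congrArg (fun T : L2 (Q × α) →L[ℝ] L2 (Q × β) => T (dirac (h, i))) (hA x)
  simp only [ContinuousLinearMap.comp_apply, leftTranslate_dirac] at this
  rw [this, leftTranslate_apply]

/-- The von Neumann trace of an operator on `ℓ²(Q × α)`. -/
noncomputable def vnTrace [Fintype α] (A : L2 (Q × α) →L[ℝ] L2 (Q × α)) : ℝ :=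
  ∑ i, A (dirac (1, i)) (1, i)

lemma hasSum_comp_apply (A : L2 (Q × β) →L[ℝ] L2 (Q × α)) (B : L2 (Q × α) →L[ℝ] L2 (Q × β))
    (hA : IsEquivariant A) (i : α) :
    HasSum (fun p : Q × β => A (dirac (1, p.2)) (p.1⁻¹, i) * B (dirac (1, i)) p)
      ((A ∘L B) (dirac (1, i)) (1, i)) := by
  have h : (A ∘L B) (dirac (1, i)) (1, i) =
      ⟪ContinuousLinearMap.adjoint A (dirac (1, i)), B (dirac (1, i))⟫ := by
    rw [ContinuousLinearMap.adjoint_inner_left, inner_dirac]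
    rfl
  rw [h]
  convert hasSum_mul_inner _ _ using 3 with p
  rcases p with ⟨g, j⟩
  rw [← inner_dirac (g, j), ContinuousLinearMap.adjoint_inner_right, inner_dirac']
  have := hA.apply_translate g g⁻¹ 1 j i
  simpa using this.symm

lemma hasSum_prod_fintype {I : Type*} [Fintype β] {f : I × β → ℝ} {a : ℝ} (hf : HasSum f a) :
    a = ∑ j : β, ∑' g : I, f (g, j) := by
  have h := (Equiv.prodComm β I).hasSum_iff.mpr hf
  rw [← h.tsum_eq, h.summable.tsum_prod, tsum_fintype]
  rfl

lemma vnTrace_comp_comm [Fintype α] [Fintype β] (A : L2 (Q × β) →L[ℝ] L2 (Q × α))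
    (B : L2 (Q × α) →L[ℝ] L2 (Q × β)) (hA : IsEquivariant A) (hB : IsEquivariant B) :
    vnTrace (A ∘L B) = vnTrace (B ∘L A) := by
  have key : ∀ (i : α) (j : β), ∑' g : Q, A (dirac (1, j)) (g⁻¹, i) * B (dirac (1, i)) (g, j) =
      ∑' g : Q, B (dirac (1, i)) (g⁻¹, j) * A (dirac (1, j)) (g, i) := by
    intro i j
    rw [← (Equiv.inv Q).tsum_eq]
    simp [mul_comm]
  have h1 : vnTrace (A ∘L B) = ∑ i : α, ∑ j : β,
      ∑' g : Q, A (dirac (1, j)) (g⁻¹, i) * B (dirac (1, i)) (g, j) := by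
    refine Finset.sum_congr rfl fun i _ => ?_
    exact hasSum_prod_fintype (hasSum_comp_apply A B hA i)
  have h2 : vnTrace (B ∘L A) = ∑ j : β, ∑ i : α,
      ∑' g : Q, B (dirac (1, i)) (g⁻¹, j) * A (dirac (1, j)) (g, i) := by
    refine Finset.sum_congr rfl fun j _ => ?_
    exact hasSum_prod_fintype (hasSum_comp_apply B A hB j)
  rw [h1, h2, Finset.sum_comm]
  simp only [key]

end Trace

section Rank

open scoped RealInnerProductSpace

/-- The operator `A⋆A + ε` is invertible, with the expected estimates. -/
lemma exists_resolvent {V W : Type*} [NormedAddCommGroup V] [InnerProductSpace ℝ V]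
    [CompleteSpace V] [NormedAddCommGroup W] [InnerProductSpace ℝ W] [CompleteSpace W]
    (A : V →L[ℝ] W) {ε : ℝ} (hε : 0 < ε) :
    ∃ C : V ≃L[ℝ] V, ∀ v, C.symm v = (ContinuousLinearMap.adjoint A) (A v) + ε • v := by
  let T : V →L[ℝ] V := (ContinuousLinearMap.adjoint A) ∘L A + ε • ContinuousLinearMap.id ℝ V
  let B : V →L[ℝ] V →L[ℝ] ℝ := (innerSL ℝ) ∘L T
  have hB : IsCoercive B := by
    refine ⟨ε, hε, fun u => ?_⟩
    have : B u u = ‖A u‖ ^ 2 + ε * ‖u‖ ^ 2 := by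
      change ⟪T u, u⟫ = _
      simp only [T, add_apply, ContinuousLinearMap.comp_apply, inner_add_left,
        ContinuousLinearMap.adjoint_inner_left, smul_apply, inner_smul_left]
      simp
    rw [this]
    nlinarith [sq_nonneg ‖A u‖]
  refine ⟨hB.continuousLinearEquivOfBilin.symm, fun v => ?_⟩
  refine ext_inner_right ℝ fun w => ?_
  have := hB.continuousLinearEquivOfBilin_apply v w
  rw [ContinuousLinearEquiv.symm_symm, this]
  rfl

variable {Q : Type*} [Group Q] {α β : Type*}

set_option maxHeartbeats 1000000 in
/-- Monotonicity of von Neumann dimension for free modules. -/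
theorem card_le_of_injective_equivariant [Fintype α] [Fintype β]
    (A : L2 (Q × α) →L[ℝ] L2 (Q × β)) (hA : IsEquivariant A) (hinj : ∀ v, A v = 0 → v = 0) :
    Fintype.card α ≤ Fintype.card β := by
  set A' := ContinuousLinearMap.adjoint A with hA'
  have hdense : Dense ((A' ∘L A).range : Set (L2 (Q × α))) := by
    rw [Submodule.dense_iff_topologicalClosure_eq_top, Submodule.topologicalClosure_eq_top_iff,
      ContinuousLinearMap.orthogonal_range, hA', ContinuousLinearMap.adjoint_comp,
      ContinuousLinearMap.adjoint_adjoint, ContinuousLinearMap.ker_adjoint_comp_self]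
    rw [Submodule.eq_bot_iff]
    exact fun v hv => hinj v hv
  have main : ∀ η : ℝ, 0 < η → (Fintype.card α : ℝ) * (1 - 2 * η) ≤ Fintype.card β := by
    intro η hη
    have happ : ∀ j : α, ∃ v : L2 (Q × α), ‖dirac (1, j) - A' (A v)‖ < η := by
      intro j
      obtain ⟨_, hv, ⟨v, rfl⟩⟩ := Metric.dense_iff.mp hdense (dirac (1, j)) η hη
      exact ⟨v, by simpa [dist_eq_norm, norm_sub_rev] using hv⟩
    choose v hv using happ
    let ε : ℝ := η / (1 + 2 * ∑ j, ‖v j‖)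
    have hsum : 0 ≤ ∑ j, ‖v j‖ := Finset.sum_nonneg fun _ _ => norm_nonneg _
    have hε : 0 < ε := by positivity
    have hεv : ∀ j, 2 * ε * ‖v j‖ ≤ η := by
      intro j
      have h1 : ‖v j‖ ≤ ∑ j, ‖v j‖ :=
        Finset.single_le_sum (f := fun j => ‖v j‖) (fun _ _ => norm_nonneg _) (Finset.mem_univ j)
      have h2 : ε * (1 + 2 * ∑ j, ‖v j‖) = η := div_mul_cancel₀ _ (by positivity)
      nlinarith
    obtain ⟨C, hC⟩ := exists_resolvent A hε
    have hC' : ∀ w, A' (A (C w)) + ε • C w = w := fun w => by rw [← hC]; simp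
    have hCeq : IsEquivariant (C : L2 (Q × α) →L[ℝ] L2 (Q × α)) := by
      intro x
      ext1 w
      apply C.symm.injective
      simp only [ContinuousLinearMap.comp_apply, ContinuousLinearEquiv.coe_coe,
        hC]
      have h1 := congrArg (fun T : L2 (Q × α) →L[ℝ] L2 (Q × α) => T (C w)) (hA.adjoint.comp hA x)
      simp only [ContinuousLinearMap.comp_apply] at h1
      rw [← hA', ← hA', hC'] at *
      rw [h1, ← map_smul (leftTranslate α x), ← map_add, hC']
    have hεC : ∀ w, ε * ‖C w‖ ≤ ‖w‖ := by
      intro w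
      have h1 : ε * ‖C w‖ ^ 2 ≤ ‖w‖ * ‖C w‖ := by
        calc ε * ‖C w‖ ^ 2 ≤ ⟪A' (A (C w)) + ε • C w, C w⟫ := by
              rw [inner_add_left, hA', ContinuousLinearMap.adjoint_inner_left, inner_smul_left]
              simp
          _ = ⟪w, C w⟫ := by rw [hC']
          _ ≤ _ := real_inner_le_norm _ _
      rcases (norm_nonneg (C w)).eq_or_lt with h | h
      · rw [← h]; simp
      · nlinarith
    have hcomm : ∀ w, C (A' (A w)) = w - ε • C w := by
      intro w
      have : A' (A w) = C.symm w - ε • w := by rw [hC]; simp [hA']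
      rw [this]; simp
    have hup : vnTrace (A ∘L ((C : L2 (Q × α) →L[ℝ] L2 (Q × α)) ∘L A')) ≤ Fintype.card β := by
      calc _ ≤ ∑ j : β, (1 : ℝ) := by
            refine Finset.sum_le_sum fun i _ => ?_
            set u : L2 (Q × β) := dirac (1, i)
            have h1 : ‖A (C (A' u))‖ ^ 2 ≤ ‖u‖ * ‖A (C (A' u))‖ := by
              calc ‖A (C (A' u))‖ ^ 2
                  ≤ ⟪A' (A (C (A' u))) + ε • C (A' u), C (A' u)⟫ := by
                    rw [inner_add_left, hA', ContinuousLinearMap.adjoint_inner_left,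
                      inner_smul_left]
                    simp only [real_inner_self_eq_norm_sq]
                    simp
                    positivity
                _ = ⟪u, A (C (A' u))⟫ := by
                  rw [hC', hA', ContinuousLinearMap.adjoint_inner_left]
                _ ≤ _ := real_inner_le_norm _ _
            have hu : ‖u‖ = 1 := norm_dirac _
            have h2 : ‖A (C (A' u))‖ ≤ 1 := by
              rw [hu] at h1
              nlinarith [norm_nonneg (A (C (A' u)))]
            change (A (C (A' u))) (1, i) ≤ 1
            rw [← inner_dirac]
            calc _ ≤ ‖u‖ * ‖A (C (A' u))‖ := real_inner_le_norm _ _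
              _ ≤ 1 := by rw [hu, one_mul]; exact h2
        _ = _ := by simp
    have hlow : (Fintype.card α : ℝ) * (1 - 2 * η) ≤
        vnTrace (((C : L2 (Q × α) →L[ℝ] L2 (Q × α)) ∘L A') ∘L A) := by
      calc _ = ∑ j : α, (1 - 2 * η) := by simp [mul_sub]
        _ ≤ _ := by
          refine Finset.sum_le_sum fun j _ => ?_
          set u : L2 (Q × α) := dirac (1, j) with hu
          change _ ≤ (C (A' (A u))) (1, j)
          have h1 : ε * ‖C u‖ ≤ 2 * η := by
            have e1 : C u = C (u - A' (A (v j))) + (v j - ε • C (v j)) := by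
              rw [← hcomm, ← map_add]; simp
            have e2 : ‖C u‖ ≤ ‖C (u - A' (A (v j)))‖ + (‖v j‖ + ε * ‖C (v j)‖) := by
              rw [e1]
              refine (norm_add_le _ _).trans ?_
              gcongr
              refine (norm_sub_le _ _).trans ?_
              rw [norm_smul, Real.norm_of_nonneg hε.le]
            have e3 := hεC (u - A' (A (v j)))
            have e4 := hεC (v j)
            have e5 := hεv j
            have e6 := hv j
            nlinarith
          have h2 : u (1, j) = 1 := by
            rw [← inner_dirac, ← hu, real_inner_self_eq_norm_sq, hu]; simp
          rw [hcomm]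
          have h3 : (C u) (1, j) ≤ ‖C u‖ := by
            rw [← inner_dirac]
            refine (real_inner_le_norm _ _).trans ?_
            simp
          simp only [lp.coeFn_sub, lp.coeFn_smul, Pi.sub_apply, Pi.smul_apply, smul_eq_mul, h2]
          nlinarith
    rw [← vnTrace_comp_comm A _ hA (hCeq.comp hA.adjoint)] at hlow
    exact hlow.trans hup
  by_contra hlt
  push Not at hlt
  have h1 : (Fintype.card β : ℝ) + 1 ≤ Fintype.card α := by exact_mod_cast hlt
  have h2 : (0 : ℝ) < Fintype.card α := by
    have : (0 : ℝ) ≤ Fintype.card β := by positivity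
    linarith
  have h3 := main (1 / (4 * Fintype.card α)) (by positivity)
  have h4 : (Fintype.card α : ℝ) * (1 - 2 * (1 / (4 * Fintype.card α))) =
      Fintype.card α - 1 / 2 := by
    field_simp
    ring
  linarith

end Rank

end FreeProductFix

namespace FreeProductFix

section AbstractCocycle

open scoped RealInnerProductSpace

lemma L2.eq_zero_of_constant_on_seq {I : Type*} (v : I → ℝ) (hv : Summable fun i => v i ^ 2)
    (s : ℕ → I) (hs : Function.Injective s) (h : ∀ k, v (s (k + 1)) = v (s k)) : v (s 0) = 0 := by
  have h1 : ∀ k, v (s k) = v (s 0) := by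
    intro k
    induction k with
    | zero => rfl
    | succ k ih => rw [h, ih]
  have h2 := hv.comp_injective hs
  have h3 : (fun i => v i ^ 2) ∘ s = fun _ => v (s 0) ^ 2 := by
    funext k
    simp [h1]
  rw [h3, summable_const_iff] at h2
  simpa using h2

lemma L2.summable_sq {I : Type*} (v : L2 I) : Summable fun i => v i ^ 2 := by
  simpa [sq] using (hasSum_mul_inner v v).summable

/-- A square-summable function on a torsion-free group that is invariant under right
multiplication by a non-trivial element vanishes. -/
lemma eq_zero_of_mul_right_invariant {Q : Type*} [Group Q]
    (htf : ∀ g : Q, ∀ k : ℕ, k ≠ 0 → g ^ k = 1 → g = 1)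
    (v : Q → ℝ) (hv : Summable fun i => v i ^ 2) {a : Q} (ha : a ≠ 1)
    (h : ∀ g, v (g * a) = v g) (g : Q) : v g = 0 := by
  have := L2.eq_zero_of_constant_on_seq v hv (fun k => g * a ^ k) ?_ ?_
  · simpa using this
  · have hinj : Function.Injective (fun k : ℕ => a ^ k) := by
      rw [injective_pow_iff_not_isOfFinOrder, isOfFinOrder_iff_pow_eq_one]
      rintro ⟨k, hk, hk1⟩
      exact ha (htf a k hk.ne' hk1)
    exact (mul_right_injective g).comp hinj
  · intro k
    simp only [pow_succ, ← mul_assoc]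
    exact h _

variable {Q : Type*} [Group Q]

/-- The restriction of a function on `Q × α` to `Q × {j}`. -/
noncomputable def slice {α : Type*} (j : α) : L2 (Q × α) →L[ℝ] L2 Q :=
  ContinuousLinearMap.adjoint
    (push (fun g : Q => (g, j)) (Prod.mk_left_injective j)).toContinuousLinearMap

omit [Group Q] in
lemma slice_apply {α : Type*} (j : α) (v : L2 (Q × α)) (g : Q) : slice j v g = v (g, j) := by
  rw [← inner_dirac, slice, ContinuousLinearMap.adjoint_inner_right]
  change ⟪push (fun g : Q => (g, j)) (Prod.mk_left_injective j) (dirac g), v⟫ = _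
  rw [push_dirac, inner_dirac]

omit [Group Q] in
lemma slice_dirac {α : Type*} [DecidableEq α] (i j : α) (g : Q) :
    slice j (dirac (g, i)) = if i = j then dirac g else 0 := by
  classical
  ext h
  rw [slice_apply, dirac_apply]
  split_ifs with h1 h2 h2
  · simp_all [dirac_apply]
  · simp_all
  · simp_all [dirac_apply]
  · simp

variable {H : Type*} [NormedAddCommGroup H] [InnerProductSpace ℝ H]

/-- The operator assembled from the values of a cocycle of operators at finitely many points. -/
noncomputable def assemble {α : Type*} [Fintype α] (R : Q → L2 Q →L[ℝ] H) (b : α → Q) :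
    L2 (Q × α) →L[ℝ] H := ∑ j, R (b j) ∘L slice j

omit [Group Q] in
lemma assemble_apply {α : Type*} [Fintype α] (R : Q → L2 Q →L[ℝ] H) (b : α → Q)
    (v : L2 (Q × α)) : assemble R b v = ∑ j, R (b j) (slice j v) := by
  simp [assemble]

omit [Group Q] in
lemma assemble_dirac {α : Type*} [Fintype α] (R : Q → L2 Q →L[ℝ] H) (b : α → Q) (g : Q)
    (i : α) : assemble R b (dirac (g, i)) = R (b i) (dirac g) := by
  classical
  rw [assemble_apply, Finset.sum_eq_single i]
  · simp [slice_dirac]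
  · intro j _ hj
    simp [slice_dirac, hj.symm]
  · simp

/-- A cocycle of operators on a torsion-free group generated by `m` commutative subgroups: more
than `m` values of it are linearly dependent over `ℓ²`. -/
theorem exists_assemble_eq_zero [CompleteSpace H]
    (htf : ∀ g : Q, ∀ k : ℕ, k ≠ 0 → g ^ k = 1 → g = 1)
    (R : Q → L2 Q →L[ℝ] H)
    (hR : ∀ q q' g, R (q * q') (dirac g) = R q (dirac g) + R q' (dirac (g * q)))
    (hinv : ∀ q q' x g h, ⟪R q (dirac (x * g)), R q' (dirac (x * h))⟫ =
      ⟪R q (dirac g), R q' (dirac h)⟫)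
    {m r : ℕ} (D : Fin m → Subgroup Q) (hcomm : ∀ i, ∀ a ∈ D i, ∀ b ∈ D i, a * b = b * a)
    (hD : ⨆ i, D i = ⊤) (b : Fin r → Q) (hr : m < r) :
    ∃ v : L2 (Q × Fin r), v ≠ 0 ∧ assemble R b v = 0 := by
  by_contra hcon
  push Not at hcon
  have hd : ∀ i, ∃ d ∈ D i, d = 1 → D i = ⊥ := by
    intro i
    by_cases h : D i = ⊥
    · exact ⟨1, one_mem _, fun _ => h⟩
    · obtain ⟨d, hd, hd1⟩ := (D i).bot_or_exists_ne_one.resolve_left h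
      exact ⟨d, hd, fun h => absurd h hd1⟩
  choose d hdD hd1 using hd
  set A := ContinuousLinearMap.adjoint (assemble R d) ∘L assemble R b with hA
  have hAapp : ∀ g h i j, A (dirac (h, i)) (g, j) = ⟪R (d j) (dirac g), R (b i) (dirac h)⟫ := by
    intro g h i j
    rw [← inner_dirac, hA, ContinuousLinearMap.comp_apply,
      ContinuousLinearMap.adjoint_inner_right, assemble_dirac, assemble_dirac]
  have hAeq : IsEquivariant A := by
    intro x
    apply clm_ext
    rintro ⟨h, i⟩
    ext ⟨g, j⟩
    obtain ⟨g, rfl⟩ : ∃ g', g = x * g' := ⟨x⁻¹ * g, by simp⟩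
    simp only [ContinuousLinearMap.comp_apply, leftTranslate_dirac]
    rw [leftTranslate_apply, hAapp, hAapp, hinv]
  have hcard := card_le_of_injective_equivariant A hAeq ?_
  · simp only [Fintype.card_fin] at hcard
    omega
  intro v hv
  set u := assemble R b v with hu
  let f : Q → L2 Q := fun q => ContinuousLinearMap.adjoint (R q) u
  have hf : ∀ q g, f q g = ⟪R q (dirac g), u⟫ := by
    intro q g
    rw [← inner_dirac, ContinuousLinearMap.adjoint_inner_right]
  have hfmul : ∀ q q' g, f (q * q') g = f q g + f q' (g * q) := by
    intro q q' g
    simp only [hf, hR, inner_add_left]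
  have hfone : f 1 = 0 := by
    ext g
    have := hfmul 1 1 g
    simp only [mul_one] at this
    simpa using this
  have hfd : ∀ i, f (d i) = 0 := by
    intro i
    ext g
    rw [hf, ← assemble_dirac, ← ContinuousLinearMap.adjoint_inner_right, inner_dirac]
    change A v (g, i) = _
    rw [hv]
    rfl
  let Z : Subgroup Q :=
    { carrier := {q | f q = 0}
      one_mem' := hfone
      mul_mem' := by
        intro a b ha hb
        simp only [Set.mem_ofPred_eq] at *
        ext g
        rw [hfmul, ha, hb]
        simp
      inv_mem' := by
        intro a ha
        simp only [Set.mem_ofPred_eq] at *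
        ext g
        have := hfmul a a⁻¹ (g * a⁻¹)
        rw [mul_inv_cancel, hfone, ha] at this
        simpa using this.symm }
  have hZ : Z = ⊤ := by
    rw [eq_top_iff, ← hD]
    refine iSup_le fun i x hx => ?_
    change f x = 0
    by_cases hi : d i = 1
    · have := hd1 i hi
      rw [this, Subgroup.mem_bot] at hx
      rw [hx, hfone]
    · ext g
      refine eq_zero_of_mul_right_invariant htf _ (L2.summable_sq (f x)) hi (fun g => ?_) g
      have h1 := hfmul x (d i) g
      have h2 := hfmul (d i) x g
      rw [hcomm i x hx _ (hdD i), h2, hfd] at h1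
      simpa using h1
  have hu0 : u = 0 := by
    rw [← inner_self_eq_zero (𝕜 := ℝ)]
    nth_rewrite 2 [hu]
    rw [assemble_apply, inner_sum]
    refine Finset.sum_eq_zero fun j _ => ?_
    rw [← ContinuousLinearMap.adjoint_inner_left]
    have : f (b j) = 0 := by
      have : b j ∈ Z := hZ ▸ Subgroup.mem_top _
      exact this
    change ⟪f (b j), _⟫ = _
    rw [this, inner_zero_left]
  by_contra hv0
  exact hcon v hv0 hu0

end AbstractCocycle

end FreeProductFix

namespace FreeProductFix

section Convolution

open scoped RealInnerProductSpace

variable {Q Z : Type*} [Group Q] [MulAction Q Z]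

lemma smul_injective_of_free (hfree : ∀ (g : Q) (z : Z), g • z = z → g = 1) (z : Z) :
    Function.Injective fun g : Q => g • z := by
  intro g h hgh
  have : (h⁻¹ * g) • z = z := by
    rw [mul_smul, inv_smul_eq_iff]
    exact hgh
  exact (inv_mul_eq_one.mp (hfree _ _ this)).symm

/-- Convolution with an absolutely summable function on a free `Q`-set. -/
noncomputable def convOp (hfree : ∀ (g : Q) (z : Z), g • z = z → g = 1) (c : Z → ℝ) :
    L2 Q →L[ℝ] L2 Z :=
  ∑' z, c z • (push (fun g : Q => g • z) (smul_injective_of_free hfree z)).toContinuousLinearMap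

lemma convOp_dirac (hfree : ∀ (g : Q) (z : Z), g • z = z → g = 1) (c : Z → ℝ)
    (hc : Summable fun z => |c z|) (g : Q) (z : Z) :
    convOp hfree c (dirac g) z = c (g⁻¹ • z) := by
  classical
  have hs : Summable fun z => c z •
      (push (fun g : Q => g • z) (smul_injective_of_free hfree z)).toContinuousLinearMap := by
    refine Summable.of_norm_bounded hc fun z => ?_
    rw [norm_smul, Real.norm_eq_abs]
    exact mul_le_of_le_one_right (abs_nonneg _) (LinearIsometry.norm_toContinuousLinearMap_le _)
  rw [convOp, ← inner_dirac]
  change ((innerSL ℝ (dirac z)).comp (ContinuousLinearMap.apply ℝ (L2 Z) (dirac g : L2 Q)))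
    (∑' z, _) = _
  rw [ContinuousLinearMap.map_tsum _ hs]
  have h : ∀ w, ((innerSL ℝ (dirac z)).comp (ContinuousLinearMap.apply ℝ (L2 Z) (dirac g : L2 Q)))
      (c w • (push (fun g : Q => g • w)
        (smul_injective_of_free hfree w)).toContinuousLinearMap) =
      if w = g⁻¹ • z then c w else 0 := by
    intro w
    rw [map_smul]
    have h2 : ((innerSL ℝ (dirac z)).comp
        (ContinuousLinearMap.apply ℝ (L2 Z) (dirac g : L2 Q)))
        (push (fun g : Q => g • w) (smul_injective_of_free hfree w)).toContinuousLinearMap =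
        ⟪dirac z, push (fun g : Q => g • w) (smul_injective_of_free hfree w) (dirac g)⟫ := rfl
    rw [h2, push_dirac, inner_dirac, dirac_apply]
    simp [eq_inv_smul_iff]
  simp_rw [h]
  rw [tsum_ite_eq]

lemma convOp_apply (hfree : ∀ (g : Q) (z : Z), g • z = z → g = 1) (c : Z → ℝ)
    (hc : Summable fun z => |c z|) (v : L2 Q) (z : Z) :
    convOp hfree c v z = ∑' g, v g * c (g⁻¹ • z) := by
  rw [← inner_dirac', ← ContinuousLinearMap.adjoint_inner_right, ← (hasSum_mul_inner _ _).tsum_eq]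
  congr 1
  funext g
  have h : ContinuousLinearMap.adjoint (convOp hfree c) (dirac z) g = c (g⁻¹ • z) := by
    rw [← inner_dirac, ContinuousLinearMap.adjoint_inner_right, inner_dirac', convOp_dirac _ _ hc]
  rw [h]

lemma exists_pos_summable_mul (S : ℕ → ℕ → ℝ) (hS : ∀ k j, 0 ≤ S k j) :
    ∃ ε : ℕ → ℝ, (∀ k, 0 < ε k) ∧ ∀ j, Summable fun k => ε k * S k j := by
  have hpos : ∀ k, 0 < 1 + ∑ j ∈ Finset.range (k + 1), S k j := fun k =>
    add_pos_of_pos_of_nonneg one_pos (Finset.sum_nonneg fun j _ => hS k j)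
  refine ⟨fun k => (1 / 2) ^ k / (1 + ∑ j ∈ Finset.range (k + 1), S k j), fun k => ?_, fun j => ?_⟩
  · exact div_pos (by positivity) (hpos k)
  · refine Summable.of_norm_bounded_eventually_nat summable_geometric_two ?_
    filter_upwards [Filter.eventually_ge_atTop j] with k hk
    have h1 : S k j ≤ 1 + ∑ j ∈ Finset.range (k + 1), S k j := by
      have := Finset.single_le_sum (f := S k) (fun j _ => hS k j)
        (Finset.mem_range.mpr (Nat.lt_succ_of_le hk))
      linarith
    rw [Real.norm_of_nonneg (mul_nonneg (div_pos (by positivity) (hpos k)).le (hS k j)),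
      div_mul_eq_mul_div, div_le_iff₀ (hpos k)]
    gcongr

end Convolution

section Tower

open scoped RealInnerProductSpace

/-- The disjoint union of the twists of a `Q`-set by the iterates of an endomorphism. -/
def Tower {Q : Type*} [Group Q] (_ : Q →* Q) (Y : Type*) := ℕ × Y

/-- The point `y` of the `k`-th twist. -/
def Tower.mk {Q : Type*} [Group Q] (φ : Q →* Q) {Y : Type*} (k : ℕ) (y : Y) : Tower φ Y := (k, y)

variable {Q Y : Type*} [Group Q] [MulAction Q Y]

instance (φ : Q →* Q) : MulAction Q (Tower φ Y) where
  smul g z := (z.1, iterHom φ z.1 g • z.2)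
  one_smul z := by
    change ((z.1, iterHom φ z.1 1 • z.2) : ℕ × Y) = z
    rw [map_one, one_smul]
    rfl
  mul_smul g h z := by
    change ((z.1, iterHom φ z.1 (g * h) • z.2) : ℕ × Y) =
      (z.1, iterHom φ z.1 g • iterHom φ z.1 h • z.2)
    rw [map_mul, mul_smul]

lemma iterHom_injective {φ : Q →* Q} (hφ : Function.Injective φ) (k : ℕ) :
    Function.Injective (iterHom φ k) := by
  intro a b h
  rw [iterHom_apply, iterHom_apply] at h
  exact hφ.iterate k h

/-- A real-valued finitely supported cocycle on a countable torsion-free group generated by `m`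
commutative subgroups: more than `m` of its values at fixed points of an injective endomorphism
satisfy a square-summable relation supported on periodic points. -/
theorem exists_periodic_relation [Countable Q]
    (htf : ∀ g : Q, ∀ k : ℕ, k ≠ 0 → g ^ k = 1 → g = 1)
    (φ : Q →* Q) (hφ : Function.Injective φ)
    {m : ℕ} (D : Fin m → Subgroup Q) (hcomm : ∀ i, ∀ a ∈ D i, ∀ b ∈ D i, a * b = b * a)
    (hD : ⨆ i, D i = ⊤)
    (hfree : ∀ (g : Q) (y : Y), g • y = y → g = 1)
    (c : Q → Y → ℝ) (hc : ∀ g h y, c (g * h) y = c g y + c h (g⁻¹ • y))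
    (hfin : ∀ g, (Function.support (c g)).Finite)
    {r : ℕ} (hr : m < r) (b : Fin r → Q) (hb : ∀ j, φ (b j) = b j) :
    ∃ v : Fin r → Q → ℝ, (∀ j, Summable fun g => v j g ^ 2) ∧ (∃ j g, v j g ≠ 0) ∧
      (∀ j g, v j g ≠ 0 → ∃ p, p ≠ 0 ∧ φ^[p] g = g) ∧
      ∀ y, ∑ j, ∑ᶠ g, v j g * c (b j) (g⁻¹ • y) = 0 := by
  obtain ⟨enum, henum⟩ := exists_surjective_nat Q
  obtain ⟨ε, hε, hεs⟩ := exists_pos_summable_mul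
    (fun k j => ∑ᶠ y, |c (iterHom φ k (enum j)) y|)
    (fun k j => finsum_nonneg fun y => abs_nonneg _)
  let cc : Q → Tower φ Y → ℝ := fun q z => ε z.1 * c (iterHom φ z.1 q) z.2
  have hfreeT : ∀ (g : Q) (z : Tower φ Y), g • z = z → g = 1 := by
    rintro g ⟨k, y⟩ h
    have h2 : iterHom φ k g • y = y := congrArg Prod.snd h
    exact iterHom_injective hφ k ((hfree _ _ h2).trans (map_one _).symm)
  have hccs : ∀ q, Summable fun z => |cc q z| := by
    intro q
    obtain ⟨j, rfl⟩ := henum q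
    have hsum : ∀ k, HasSum (fun y => |cc (enum j) (Tower.mk φ k y)|)
        (ε k * ∑ᶠ y, |c (iterHom φ k (enum j)) y|) := by
      intro k
      have h1 : ∀ y, |cc (enum j) (Tower.mk φ k y)| = ε k * |c (iterHom φ k (enum j)) y| := by
        intro y
        change |ε k * c (iterHom φ k (enum j)) y| = _
        rw [abs_mul, abs_of_pos (hε k)]
      simp_rw [h1]
      apply HasSum.mul_left
      have hf : (Function.support fun y => |c (iterHom φ k (enum j)) y|).Finite :=
        (hfin (iterHom φ k (enum j))).subset (by intro y; simp)
      rw [← tsum_eq_finsum (L := SummationFilter.unconditional Y) hf]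
      exact (summable_of_hasFiniteSupport hf).hasSum
    refine (summable_prod_of_nonneg (f := fun z : ℕ × Y => |cc (enum j) (Tower.mk φ z.1 z.2)|)
      (fun z => abs_nonneg _)).mpr ⟨fun k => (hsum k).summable, ?_⟩
    simp_rw [fun k => (hsum k).tsum_eq]
    exact hεs j
  have hccmul : ∀ g h z, cc (g * h) z = cc g z + cc h (g⁻¹ • z) := by
    rintro g h ⟨k, y⟩
    change ε k * c (iterHom φ k (g * h)) y = ε k * c (iterHom φ k g) y +
      ε k * c (iterHom φ k h) (iterHom φ k g⁻¹ • y)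
    rw [map_mul, hc, map_inv, mul_add]
  let R : Q → L2 Q →L[ℝ] L2 (Tower φ Y) := fun q => convOp hfreeT (cc q)
  have hRd : ∀ q g z, R q (dirac g) z = cc q (g⁻¹ • z) := fun q g z =>
    convOp_dirac hfreeT (cc q) (hccs q) g z
  have hRtr : ∀ q x g, R q (dirac (x * g)) =
      push (fun z : Tower φ Y => x • z) (MulAction.injective x) (R q (dirac g)) := by
    intro q x g
    ext z
    obtain ⟨z, rfl⟩ : ∃ w, z = x • w := ⟨x⁻¹ • z, by simp⟩
    rw [push_apply (fun z : Tower φ Y => x • z), hRd, hRd, mul_inv_rev, mul_smul, inv_smul_smul]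
  obtain ⟨v, hv0, hv⟩ := exists_assemble_eq_zero htf R
    (by
      intro q q' g
      ext z
      rw [lp.coeFn_add, Pi.add_apply, hRd, hRd, hRd, hccmul, mul_inv_rev, mul_smul])
    (by
      intro q q' x g h
      rw [hRtr, hRtr, LinearIsometry.inner_map_map])
    D hcomm hD b hr
  set A := assemble R b with hA
  let N : Submodule ℝ (L2 (Q × Fin r)) := LinearMap.ker A.toLinearMap
  have hNclosed : IsClosed (N : Set (L2 (Q × Fin r))) := A.isClosed_ker
  have : CompleteSpace N := hNclosed.completeSpace_coe
  have hmemN : ∀ w, w ∈ N ↔ A w = 0 := fun w => Iff.rfl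
  have hinjU : Function.Injective (fun p : Q × Fin r => (φ p.1, p.2)) := by
    rintro ⟨a, i⟩ ⟨a', i'⟩ h
    simp only [Prod.mk.injEq] at h
    rw [hφ h.1, h.2]
  let U := push _ hinjU
  have hUd : ∀ g j, U (dirac (g, j)) = dirac (φ g, j) := fun g j => push_dirac _ hinjU (g, j)
  have hUN : ∀ w ∈ N, U w ∈ N := by
    intro w hw
    rw [hmemN] at hw ⊢
    ext z
    obtain ⟨k, y, rfl⟩ : ∃ k y, z = Tower.mk φ k y := ⟨z.1, z.2, rfl⟩
    have key : (innerSL ℝ (dirac (Tower.mk φ k y))).comp (A.comp U.toContinuousLinearMap) =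
        (ε k / ε (k + 1)) • (innerSL ℝ (dirac (Tower.mk φ (k + 1) y))).comp A := by
      apply clm_ext
      rintro ⟨g, j⟩
      change ⟪dirac (Tower.mk φ k y), A (U (dirac (g, j)))⟫ =
        (ε k / ε (k + 1)) * ⟪dirac (Tower.mk φ (k + 1) y), A (dirac (g, j))⟫
      rw [hUd, inner_dirac, inner_dirac, hA, assemble_dirac, assemble_dirac, hRd, hRd]
      change ε k * c (iterHom φ k (b j)) (iterHom φ k (φ g)⁻¹ • y) = (ε k / ε (k + 1)) *
        (ε (k + 1) * c (iterHom φ (k + 1) (b j)) (iterHom φ (k + 1) g⁻¹ • y))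
      rw [← mul_assoc, div_mul_cancel₀ _ (hε (k + 1)).ne']
      simp only [iterHom_apply, Function.iterate_succ_apply, hb, map_inv]
    have := congrArg (fun T => T w) key
    change ⟪dirac (Tower.mk φ k y), A (U w)⟫ =
        (ε k / ε (k + 1)) * ⟪dirac (Tower.mk φ (k + 1) y), A w⟫ at this
    rw [hw, inner_zero_right, mul_zero, inner_dirac] at this
    rw [this]
    rfl
  obtain ⟨⟨g₀, i⟩, hi⟩ : ∃ p, v p ≠ 0 := by
    by_contra! h
    exact hv0 (by ext p; exact h p)
  set w := leftTranslate (Fin r) g₀⁻¹ v with hw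
  have hw1 : w (1, i) = v (g₀, i) := by
    rw [hw, ← leftTranslate_apply (α := Fin r) g₀⁻¹ g₀ i v, inv_mul_cancel]
  have hwN : w ∈ N := by
    have key : A.comp (leftTranslate (Fin r) g₀⁻¹) =
        (push (fun z : Tower φ Y => g₀⁻¹ • z)
          (MulAction.injective g₀⁻¹)).toContinuousLinearMap.comp A := by
      apply clm_ext
      rintro ⟨g, j⟩
      change A (leftTranslate (Fin r) g₀⁻¹ (dirac (g, j))) = push (fun z : Tower φ Y => g₀⁻¹ • z)
          (MulAction.injective g₀⁻¹) (A (dirac (g, j)))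
      rw [leftTranslate_dirac, hA, assemble_dirac, assemble_dirac, hRtr]
    have := congrArg (fun T => T v) key
    change A w = push (fun z : Tower φ Y => g₀⁻¹ • z) (MulAction.injective g₀⁻¹) (A v) at this
    rw [hmemN, this, hv, map_zero]
  set u : L2 (Q × Fin r) := N.starProjection (dirac (1, i)) with hu
  have huN : u ∈ N := N.starProjection_apply_mem _
  have huinner : ∀ x ∈ N, ⟪u, x⟫ = ⟪dirac (1, i), x⟫ := by
    intro x hx
    have := N.starProjection_inner_eq_zero (dirac (1, i)) x hx
    rw [inner_sub_left, sub_eq_zero] at this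
    exact this.symm
  have hu0 : u ≠ 0 := by
    intro h
    have := huinner w hwN
    rw [h, inner_zero_left, inner_dirac, hw1] at this
    exact hi this.symm
  have hUu : U u = u := by
    have h1 : ⟪u, U u⟫ = ⟪u, u⟫ := by
      rw [huinner _ (hUN _ huN), huinner _ huN]
      conv_lhs => rw [← map_one φ, ← hUd, LinearIsometry.inner_map_map]
    rw [← sub_eq_zero, ← inner_self_eq_zero (𝕜 := ℝ), inner_sub_left, inner_sub_right,
      inner_sub_right, LinearIsometry.inner_map_map, real_inner_comm u (U u), h1]
    ring
  have hUapp : ∀ g j, u (φ g, j) = u (g, j) := by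
    intro g j
    have := push_apply _ hinjU u (g, j)
    change U u (φ g, j) = _ at this
    rwa [hUu] at this
  refine ⟨fun j g => u (g, j), fun j => ?_, ?_, ?_, ?_⟩
  · exact (L2.summable_sq u).comp_injective (Prod.mk_left_injective j)
  · by_contra! h
    exact hu0 (by ext ⟨g, j⟩; exact h j g)
  · intro j g hne
    by_contra! hper
    apply hne
    refine L2.eq_zero_of_constant_on_seq u (L2.summable_sq u) (fun k => (φ^[k] g, j)) ?_ ?_
    · have hlt : ∀ a d, φ^[a] g = φ^[a + (d + 1)] g → False := by
        intro a d h
        rw [Function.iterate_add_apply] at h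
        exact hper (d + 1) (by omega) (hφ.iterate a h).symm
      intro a a' h
      have h : φ^[a] g = φ^[a'] g := congrArg Prod.fst h
      rcases lt_trichotomy a a' with hl | hl | hl
      · obtain ⟨d, rfl⟩ := Nat.exists_eq_add_of_lt hl
        exact (hlt a d h).elim
      · exact hl
      · obtain ⟨d, rfl⟩ := Nat.exists_eq_add_of_lt hl
        exact (hlt a' d h.symm).elim
    · intro k
      simp only [Function.iterate_succ_apply']
      exact hUapp _ _
  · intro y
    have h0 : A u (Tower.mk φ 0 y) = 0 := by
      rw [(hmemN u).mp huN]
      rfl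
    have h1 : A u (Tower.mk φ 0 y) = ∑ j, R (b j) (slice j u) (Tower.mk φ 0 y) := by
      rw [hA, assemble_apply, lp.coeFn_sum, Finset.sum_apply]
    rw [h1] at h0
    have h2 : ∀ j, R (b j) (slice j u) (Tower.mk φ 0 y) =
        ε 0 * ∑ᶠ g, u (g, j) * c (b j) (g⁻¹ • y) := by
      intro j
      rw [convOp_apply hfreeT _ (hccs _), ← tsum_eq_finsum (L := SummationFilter.unconditional Q), ← tsum_mul_left]
      · congr 1
        funext g
        rw [slice_apply]
        change u (g, j) * (ε 0 * c (iterHom φ 0 (b j)) (iterHom φ 0 g⁻¹ • y)) = _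
        simp only [iterHom_apply, Function.iterate_zero, id_eq]
        ring
      · have hinj : Function.Injective fun g : Q => g⁻¹ • y :=
          (smul_injective_of_free hfree y).comp inv_injective
        refine ((hfin (b j)).preimage hinj.injOn).subset fun g hg => ?_
        exact right_ne_zero_of_mul hg
    simp_rw [h2, ← Finset.mul_sum] at h0
    exact (mul_eq_zero.mp h0).resolve_left (hε 0).ne'

end Tower

end FreeProductFix

namespace FreeProductFix

section TreeAction

/-- An action of a group on a directed graph, together with functions on the vertices whose
coboundaries are the indicator functions of the edges. If the graph is connected, it is a tree. -/
structure TreeAction (Q V E : Type*) [Group Q] [MulAction Q V] [MulAction Q E] where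
  src : E → V
  tgt : E → V
  side : E → V → ℤ
  src_smul : ∀ (g : Q) (e : E), src (g • e) = g • src e
  tgt_smul : ∀ (g : Q) (e : E), tgt (g • e) = g • tgt e
  side_smul : ∀ (g : Q) (e : E) (x : V), side (g • e) (g • x) = side e x
  side_self : ∀ e : E, side e (tgt e) = side e (src e) + 1
  side_ne : ∀ e f, e ≠ f → side e (tgt f) = side e (src f)
  free : ∀ (g : Q) (e : E), g • e = e → g = 1

namespace TreeAction

variable {Q V E : Type*} [Group Q] [MulAction Q V] [MulAction Q E] (T : TreeAction Q V E)

/-- Adjacency through an edge from a given set. -/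
def Adj (F : Set E) (x y : V) : Prop :=
  ∃ e ∈ F, (T.src e = x ∧ T.tgt e = y) ∨ (T.src e = y ∧ T.tgt e = x)

/-- Reachability through edges from a given set. -/
def Reach (F : Set E) : V → V → Prop := Relation.ReflTransGen (T.Adj F)

variable {T}

lemma Adj.symm {F : Set E} {x y : V} (h : T.Adj F x y) : T.Adj F y x := by
  obtain ⟨e, he, h | h⟩ := h
  exacts [⟨e, he, Or.inr h⟩, ⟨e, he, Or.inl h⟩]

lemma Reach.symm {F : Set E} {x y : V} (h : T.Reach F x y) : T.Reach F y x := by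
  induction h with
  | refl => exact .refl
  | tail _ h2 ih => exact .head h2.symm ih

lemma Adj.mono {F F' : Set E} (hF : F ⊆ F') {x y : V} (h : T.Adj F x y) : T.Adj F' x y := by
  obtain ⟨e, he, h⟩ := h
  exact ⟨e, hF he, h⟩

lemma Reach.mono {F F' : Set E} (hF : F ⊆ F') {x y : V} (h : T.Reach F x y) : T.Reach F' x y :=
  Relation.ReflTransGen.mono (fun _ _ h => Adj.mono hF h) _ _ h

lemma Adj.smul {F : Set E} {g : Q} (hF : ∀ e ∈ F, g • e ∈ F) {x y : V} (h : T.Adj F x y) :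
    T.Adj F (g • x) (g • y) := by
  obtain ⟨e, he, h⟩ := h
  refine ⟨g • e, hF e he, ?_⟩
  rw [T.src_smul, T.tgt_smul]
  rcases h with ⟨rfl, rfl⟩ | ⟨rfl, rfl⟩
  exacts [Or.inl ⟨rfl, rfl⟩, Or.inr ⟨rfl, rfl⟩]

lemma Reach.smul {F : Set E} {g : Q} (hF : ∀ e ∈ F, g • e ∈ F) {x y : V} (h : T.Reach F x y) :
    T.Reach F (g • x) (g • y) := by
  induction h with
  | refl => exact .refl
  | tail _ h2 ih => exact .tail ih (h2.smul hF)

lemma Reach.side_eq {F : Set E} {x y : V} (h : T.Reach F x y) {e : E} (he : e ∉ F) :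
    T.side e x = T.side e y := by
  induction h with
  | refl => rfl
  | tail _ h2 ih =>
    obtain ⟨f, hf, h⟩ := h2
    have := T.side_ne e f (fun h => he (h ▸ hf))
    rcases h with ⟨rfl, rfl⟩ | ⟨rfl, rfl⟩
    · rw [ih, this]
    · rw [ih, this]

lemma Reach.finite_side_ne {F : Set E} {x y : V} (h : T.Reach F x y) :
    {e | T.side e x ≠ T.side e y}.Finite := by
  induction h with
  | refl => simp
  | @tail y z _ h2 ih =>
    obtain ⟨f, hf, h⟩ := h2
    refine (ih.insert f).subset fun e he => ?_
    by_cases hef : e = f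
    · exact Or.inl hef
    · right
      have := T.side_ne e f hef
      rcases h with ⟨rfl, rfl⟩ | ⟨rfl, rfl⟩ <;> simp_all

lemma side_smul_left (g : Q) (e : E) (x : V) : T.side (g • e) x = T.side e (g⁻¹ • x) := by
  rw [← T.side_smul g e, smul_inv_smul]

lemma eq_of_src_eq_of_tgt_eq {e f : E} (hs : T.src e = T.src f) (ht : T.tgt e = T.tgt f) :
    e = f := by
  by_contra h
  have h1 := T.side_self e
  have h2 := T.side_ne e f h
  rw [hs, ht] at h1
  omega

lemma finsum_side_sub_mul {F : Set E} {x y : V} (h : T.Reach F x y) (u : V → ℝ) :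
    ∑ᶠ e, ((T.side e y : ℝ) - T.side e x) * (u (T.tgt e) - u (T.src e)) = u y - u x := by
  classical
  induction h with
  | refl => simp
  | @tail y z h1 h2 ih =>
    have hfin : (Function.support fun e =>
        ((T.side e y : ℝ) - T.side e x) * (u (T.tgt e) - u (T.src e))).Finite := by
      refine (Reach.finite_side_ne h1).subset fun e he => ?_
      have := left_ne_zero_of_mul he
      exact fun h => this (by rw [h, sub_self])
    obtain ⟨f, hf, h⟩ := h2
    obtain ⟨σ, hσ1, hσ2⟩ : ∃ σ : ℝ, (∀ e, (T.side e z : ℝ) - T.side e y =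
        if e = f then σ else 0) ∧ σ * (u (T.tgt f) - u (T.src f)) = u z - u y := by
      rcases h with ⟨rfl, rfl⟩ | ⟨rfl, rfl⟩
      · refine ⟨1, fun e => ?_, by ring⟩
        split_ifs with h
        · subst h
          rw [T.side_self]
          push_cast
          ring
        · rw [T.side_ne e f h, sub_self]
      · refine ⟨-1, fun e => ?_, by ring⟩
        split_ifs with h
        · subst h
          rw [T.side_self]
          push_cast
          ring
        · rw [T.side_ne e f h, sub_self]
    have hfin2 : (Function.support fun e =>
        ((T.side e z : ℝ) - T.side e y) * (u (T.tgt e) - u (T.src e))).Finite := by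
      refine (Set.finite_singleton f).subset fun e he => ?_
      have := left_ne_zero_of_mul he
      rw [hσ1] at this
      by_contra h
      exact this (if_neg h)
    have hsplit : ∀ e, ((T.side e z : ℝ) - T.side e x) * (u (T.tgt e) - u (T.src e)) =
        ((T.side e y : ℝ) - T.side e x) * (u (T.tgt e) - u (T.src e)) +
        ((T.side e z : ℝ) - T.side e y) * (u (T.tgt e) - u (T.src e)) := fun e => by ring
    simp_rw [hsplit]
    rw [finsum_add_distrib hfin hfin2, ih, finsum_eq_single _ f, hσ1, if_pos rfl, hσ2]
    · ring
    · intro e he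
      rw [hσ1, if_neg he, zero_mul]

variable (T)

open Classical in
/-- The cocycle of a tree action with base point `x₀`. -/
noncomputable def cocycle (x₀ : V) (h : Q) : E ⊕ Q → ℝ
  | .inl e => T.side e (h • x₀) - T.side e x₀
  | .inr q => (if q = h then 1 else 0) - if q = 1 then 1 else 0

lemma cocycle_mul (x₀ : V) (g h : Q) (y : E ⊕ Q) :
    T.cocycle x₀ (g * h) y = T.cocycle x₀ g y + T.cocycle x₀ h (g⁻¹ • y) := by
  classical
  rcases y with e | q
  · simp only [cocycle, Sum.smul_inl, side_smul_left, inv_inv, mul_smul]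
    ring
  · simp only [cocycle, Sum.smul_inr, smul_eq_mul]
    have h1 : g⁻¹ * q = h ↔ q = g * h := inv_mul_eq_iff_eq_mul
    have h2 : g⁻¹ * q = 1 ↔ q = g := by rw [inv_mul_eq_iff_eq_mul, mul_one]
    rw [if_congr h1 rfl rfl, if_congr h2 rfl rfl]
    ring

lemma finite_support_cocycle (x₀ : V) (h : Q)
    (hfin : {e | T.side e (h • x₀) ≠ T.side e x₀}.Finite) :
    (Function.support (T.cocycle x₀ h)).Finite := by
  refine ((hfin.image Sum.inl).union
    (((Set.toFinite {h, 1})).image Sum.inr)).subset ?_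
  rintro (e | q) he
  · left
    refine ⟨e, fun h => he ?_, rfl⟩
    simp [cocycle, h]
  · right
    refine ⟨q, ?_, rfl⟩
    by_contra hq
    simp only [Set.mem_insert_iff, Set.mem_singleton_iff, not_or] at hq
    exact he (by simp [cocycle, hq.1, hq.2])

include T in
lemma free_sum (g : Q) (y : E ⊕ Q) (h : g • y = y) : g = 1 := by
  rcases y with e | q
  · exact T.free g e (Sum.inl_injective h)
  · have : g * q = q := Sum.inr_injective h
    simpa using this

end TreeAction

end TreeAction

end FreeProductFix

namespace FreeProductFix

open Classical in
lemma finsum_ite_sub_ite {α : Type*} (f : α → ℝ) (a a' : α) (A B : ℝ)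
    (h : ∀ x, f x = (if x = a then A else 0) - if x = a' then B else 0) :
    ∑ᶠ x, f x = A - B := by
  simp_rw [h]
  have hs : ∀ (a : α) (A : ℝ), (Function.support fun x => if x = a then A else 0).Finite :=
    fun a A => (Set.finite_singleton a).subset fun x hx => by
      by_contra hxa
      exact hx (if_neg hxa)
  have h1 : ∀ (a : α) (A : ℝ), ∑ᶠ x, (if x = a then A else 0) = A := by
    intro a A
    rw [finsum_eq_single _ a fun x hx => if_neg hx, if_pos rfl]
  rw [finsum_sub_distrib (hs _ _) (hs _ _), h1, h1]

namespace TreeAction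

variable {Q V E : Type*} [Group Q] [MulAction Q V] [MulAction Q E] (T : TreeAction Q V E)

/-- Edges from a given set with both endpoints in a given set of vertices. -/
def internalEdges (F : Set E) (S : Set V) : Set E := {e ∈ F | T.src e ∈ S ∧ T.tgt e ∈ S}

set_option maxHeartbeats 1000000 in
/-- The values of the cocycle of a tree action at generators of stabilizers of distinct orbits of
vertices and at elements belonging to distinct orbits of edges outside a transversal subtree
satisfy no square-summable relation. -/
theorem cocycle_independent (x₀ : V) (htf : ∀ g : Q, ∀ k : ℕ, k ≠ 0 → g ^ k = 1 → g = 1)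
    {H L : Subgroup Q} (hHL : H ≤ L) {EH : Set E}
    (hL : ∀ e ∈ EH, ∀ g ∈ L, g • e ∈ EH → g ∈ H)
    {S : Set V} (hSconn : ∀ w ∈ S, T.Reach (T.internalEdges EH S) x₀ w)
    (hSorb : ∀ w ∈ S, ∀ h ∈ H, h • w ∈ S → h • w = w)
    {F : Set E} (hFE : F ⊆ EH) (hFsrc : ∀ f ∈ F, T.src f ∈ S)
    (hFI : ∀ f ∈ F, ∀ h ∈ H, h • f ∉ T.internalEdges EH S)
    (hForb : ∀ f ∈ F, ∀ h ∈ H, h • f ∈ F → h • f = f)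
    {J : Type*} [Fintype J] (κ : J → V ⊕ E) (hκ : Function.Injective κ) (b : J → Q)
    (hb : ∀ j, b j ∈ H)
    (hbV : ∀ j w, κ j = .inl w → w ∈ S ∧ b j • w = w ∧ b j ≠ 1)
    (hbE : ∀ j f, κ j = .inr f → f ∈ F ∧ ∃ w ∈ S, T.tgt f = b j • w)
    (v : J → Q → ℝ) (hv : ∀ j, Summable fun g => v j g ^ 2) (hvL : ∀ j g, v j g ≠ 0 → g ∈ L)
    (hrel : ∀ y : E ⊕ Q, ∑ j, ∑ᶠ g, v j g * T.cocycle x₀ (b j) (g⁻¹ • y) = 0) :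
    ∀ j g, v j g = 0 := by
  classical
  set I := T.internalEdges EH S with hI
  let q : V → E → ℝ := fun w e => T.side e w - T.side e x₀
  have hq : ∀ w ∈ S, ∀ e, q w e ≠ 0 → e ∈ I := by
    intro w hw e he
    by_contra heI
    exact he (by simp [q, (hSconn w hw).side_eq heI])
  have hb0 : ∀ (b : Q) w e, (T.side e (b • x₀) : ℝ) = T.side e (b • w) - q w (b⁻¹ • e) := by
    intro b w e
    simp [q, side_smul_left]
  have hcV : ∀ (b : Q) w e, b • w = w → T.cocycle x₀ b (.inl e) = q w e - q w (b⁻¹ • e) := by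
    intro b w e h
    change (T.side e (b • x₀) : ℝ) - T.side e x₀ = _
    rw [hb0 b w, h]
    ring
  have hcE : ∀ (b : Q) f w e, T.tgt f = b • w → T.cocycle x₀ b (.inl e) =
      q (T.src f) e + (if e = f then 1 else 0) - q w (b⁻¹ • e) := by
    intro b f w e h
    change (T.side e (b • x₀) : ℝ) - T.side e x₀ = _
    rw [hb0 b w, ← h]
    split_ifs with hef
    · subst hef
      simp only [q, T.side_self]
      push_cast
      ring
    · simp only [q, T.side_ne e f hef]
      ring
  have hI1 : ∀ e ∈ I, ∀ h ∈ H, h • e ∈ I → h = 1 := by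
    rintro e ⟨he, hs, ht⟩ h hh ⟨-, hs', ht'⟩
    rw [T.src_smul] at hs'
    rw [T.tgt_smul] at ht'
    refine T.free h e (T.eq_of_src_eq_of_tgt_eq ?_ ?_)
    · rw [T.src_smul, hSorb _ hs h hh hs']
    · rw [T.tgt_smul, hSorb _ ht h hh ht']
  have hedge : ∀ j f, κ j = .inr f → ∀ x, v j x = 0 := by
    intro j₀ f₀ hj₀ x
    by_contra hx
    have hxL := hvL _ _ hx
    have hf₀ := (hbE j₀ f₀ hj₀).1
    have hzero : ∀ w ∈ S, ∀ h ∈ H, ∀ g ∈ L, q w (h • g⁻¹ • x • f₀) = 0 := by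
      intro w hw h hh g hg
      by_contra hne
      have h1 := hq w hw _ hne
      rw [← mul_smul, ← mul_smul, mul_assoc] at h1
      exact hFI f₀ hf₀ _ (hL f₀ (hFE hf₀) _
        (mul_mem (hHL hh) (mul_mem (inv_mem hg) hxL)) h1.1) h1
    have hterm : ∀ j g, v j g * T.cocycle x₀ (b j) (g⁻¹ • (.inl (x • f₀) : E ⊕ Q)) =
        if j = j₀ ∧ g = x then v j₀ x else 0 := by
      intro j g
      by_cases hg0 : v j g = 0
      · rw [hg0, zero_mul]
        split_ifs with h
        · exact absurd (h.1 ▸ h.2 ▸ hg0) hx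
        · rfl
      have hg := hvL j g hg0
      have hz1 : ∀ w ∈ S, q w (g⁻¹ • x • f₀) = 0 := fun w hw => by
        simpa using hzero w hw 1 (one_mem _) g hg
      rw [Sum.smul_inl]
      rcases hj : κ j with w | f
      · obtain ⟨hw, hbw, -⟩ := hbV j w hj
        rw [hcV (b j) w _ hbw, hz1 w hw, hzero w hw _ (inv_mem (hb j)) g hg, if_neg]
        · simp
        · rintro ⟨rfl, -⟩
          rw [hj₀] at hj
          cases hj
      · obtain ⟨hf, w, hw, hwt⟩ := hbE j f hj
        rw [hcE (b j) f w _ hwt, hz1 _ (hFsrc f hf), hzero w hw _ (inv_mem (hb j)) g hg]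
        have hiff : g⁻¹ • x • f₀ = f ↔ j = j₀ ∧ g = x := by
          constructor
          · intro h
            rw [← mul_smul] at h
            have h1 := hL f₀ (hFE hf₀) (g⁻¹ * x) (mul_mem (inv_mem hg) hxL) (h ▸ hFE hf)
            have h2 := hForb f₀ hf₀ _ h1 (h ▸ hf)
            have h3 := T.free _ _ h2
            rw [h2] at h
            subst h
            exact ⟨hκ (hj.trans hj₀.symm), inv_mul_eq_one.mp h3⟩
          · rintro ⟨rfl, rfl⟩
            rw [hj₀] at hj
            simpa using Sum.inr_injective hj
        simp only [hiff]
        split_ifs with h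
        · rw [← h.1, ← h.2]
          ring
        · ring
    have h0 := hrel (.inl (x • f₀))
    simp_rw [hterm] at h0
    rw [Finset.sum_eq_single j₀, finsum_eq_single _ x] at h0
    · simp at h0
      exact hx h0
    · intro g hg
      simp [hg]
    · intro j _ hj
      simp [hj]
    · simp
  let y : J → Q → ℝ := fun j x => v j x - v j (x * (b j)⁻¹)
  have hyL : ∀ x ∉ L, ∀ j, y j x = 0 := by
    intro x hx j
    have h1 : v j x = 0 := by
      by_contra h
      exact hx (hvL _ _ h)
    have h2 : v j (x * (b j)⁻¹) = 0 := by
      by_contra h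
      exact hx ((Subgroup.mul_mem_cancel_right _ (inv_mem (hHL (hb j)))).mp (hvL _ _ h))
    simp [y, h1, h2]
  have hyE : ∀ j f, κ j = .inr f → ∀ x, y j x = 0 := by
    intro j f hj x
    simp [y, hedge j f hj]
  have hysum : ∀ x, ∑ j, y j x = 0 := by
    intro x
    have h0 := hrel (.inr x)
    rw [← neg_eq_zero, ← Finset.sum_neg_distrib, ← h0]
    refine Finset.sum_congr rfl fun j _ => ?_
    rw [finsum_ite_sub_ite _ (x * (b j)⁻¹) x (v j (x * (b j)⁻¹)) (v j x)]
    · ring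
    · intro g
      change v j g * ((if g⁻¹ * x = b j then 1 else 0) - if g⁻¹ * x = 1 then 1 else 0) = _
      have h1 : g⁻¹ * x = b j ↔ g = x * (b j)⁻¹ := by
        rw [inv_mul_eq_iff_eq_mul, eq_mul_inv_iff_mul_eq, eq_comm]
      have h2 : g⁻¹ * x = 1 ↔ g = x := inv_mul_eq_one
      rw [if_congr h1 rfl rfl, if_congr h2 rfl rfl]
      split_ifs with h3 h4 h4
      · rw [← h3, ← h4]
        ring
      · rw [← h3]
        ring
      · rw [← h4]
        ring
      · ring
  have hyq : ∀ x ∈ L, ∀ e, ∑ j, y j x * (κ j).elim (fun w => q w e) 0 = 0 := by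
    intro x hx e
    by_cases he : e ∈ I
    · rw [← hrel (.inl (x • e))]
      refine Finset.sum_congr rfl fun j _ => ?_
      rcases hj : κ j with w | f
      · obtain ⟨hw, hbw, -⟩ := hbV j w hj
        simp only [Sum.elim_inl]
        rw [finsum_ite_sub_ite _ x (x * (b j)⁻¹) (v j x * q w e) (v j (x * (b j)⁻¹) * q w e)]
        · simp only [y]
          ring
        · intro g
          rw [Sum.smul_inl, hcV (b j) w _ hbw, mul_sub]
          by_cases hg0 : v j g = 0
          · rw [ite_eq_right_iff.mpr, ite_eq_right_iff.mpr, hg0]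
            · ring
            · rintro rfl
              rw [hg0, zero_mul]
            · rintro rfl
              rw [hg0, zero_mul]
          have hg := hvL j g hg0
          have key : ∀ h ∈ H, q w (h • g⁻¹ • x • e) = if h * (g⁻¹ * x) = 1 then q w e else 0 := by
            intro h hh
            split_ifs with h1
            · rw [← mul_smul, ← mul_smul, mul_assoc, h1, one_smul]
            · by_contra hne
              have h2 := hq w hw _ hne
              rw [← mul_smul, ← mul_smul, mul_assoc] at h2
              exact h1 (hI1 e he _ (hL e he.1 _
                (mul_mem (hHL hh) (mul_mem (inv_mem hg) hx)) h2.1) h2)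
          have k1 := key 1 (one_mem _)
          rw [one_smul, one_mul] at k1
          rw [k1, key _ (inv_mem (hb j))]
          have h1 : (b j)⁻¹ * (g⁻¹ * x) = 1 ↔ g = x * (b j)⁻¹ := by
            rw [inv_mul_eq_one, eq_comm, inv_mul_eq_iff_eq_mul, eq_mul_inv_iff_mul_eq, eq_comm]
          have h2 : g⁻¹ * x = 1 ↔ g = x := inv_mul_eq_one
          rw [if_congr h1 rfl rfl, if_congr h2 rfl rfl]
          congr 1
          · split_ifs with h
            · rw [h]
            · simp
          · split_ifs with h
            · rw [h]
            · simp
      · rw [hyE j f hj, zero_mul]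
        simp [hedge j f hj]
    · refine Finset.sum_eq_zero fun j _ => ?_
      rcases hj : κ j with w | f
      · have : q w e = 0 := by
          by_contra h
          exact he (hq w (hbV j w hj).1 e h)
        simp [this]
      · simp
  have hy1 : ∀ x ∈ L, ∀ j w, κ j = .inl w → w ≠ x₀ → y j x = 0 := by
    intro x hx j₀ w₀ hj₀ hw₀
    let u : V → ℝ := fun w => if w = w₀ then 1 else 0
    have h1 : ∀ j, ∑ᶠ e, y j x * (κ j).elim (fun w => q w e) 0 * (u (T.tgt e) - u (T.src e)) =
        if j = j₀ then y j₀ x else 0 := by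
      intro j
      rcases hj : κ j with w | f
      · simp only [Sum.elim_inl]
        simp_rw [mul_assoc]
        rw [← mul_finsum, T.finsum_side_sub_mul (hSconn w (hbV j w hj).1)]
        · have h2 : w = w₀ ↔ j = j₀ := by
            constructor
            · rintro rfl
              exact hκ (hj.trans hj₀.symm)
            · rintro rfl
              rw [hj₀] at hj
              exact (Sum.inl_injective hj).symm
          simp only [u, if_neg (Ne.symm hw₀), h2]
          split_ifs with h
          · rw [h]
            ring
          · ring
      · rw [if_neg]
        · simp
        · rintro rfl
          rw [hj₀] at hj
          cases hj
    have h2 : ∑ j, ∑ᶠ e, y j x * (κ j).elim (fun w => q w e) 0 *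
        (u (T.tgt e) - u (T.src e)) = 0 := by
      rw [← finsum_sum_comm]
      · simp_rw [← Finset.sum_mul, hyq x hx]
        simp
      · intro j _
        rcases hj : κ j with w | f
        · refine ((hSconn w (hbV j w hj).1).finite_side_ne).subset fun e he => ?_
          have h3 : q w e ≠ 0 := right_ne_zero_of_mul (left_ne_zero_of_mul he)
          intro h4
          exact h3 (by simp [q, h4])
        · simp [Function.HasFiniteSupport]
    simp_rw [h1] at h2
    simpa using h2
  have hy : ∀ j x, y j x = 0 := by
    intro j x
    by_cases hx : x ∈ L
    · rcases hj : κ j with w | f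
      · by_cases hw : w = x₀
        · rw [← hysum x, Finset.sum_eq_single j]
          · intro j' _ hne
            rcases hj' : κ j' with w' | f'
            · refine hy1 x hx j' w' hj' ?_
              rintro rfl
              exact hne (hκ (by rw [hj', hj, hw]))
            · exact hyE j' f' hj' x
          · simp
        · exact hy1 x hx j w hj hw
      · exact hyE j f hj x
    · exact hyL x hx j
  intro j g
  rcases hj : κ j with w | f
  · refine eq_zero_of_mul_right_invariant htf (v j) (hv j) (hbV j w hj).2.2 (fun g => ?_) g
    have := hy j (g * b j)
    simp only [y, mul_inv_cancel_right] at this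
    linarith
  · exact hedge j f hj g

end TreeAction

end FreeProductFix

namespace FreeProductFix

namespace TreeAction

variable {Q V E : Type*} [Group Q] [MulAction Q V] [MulAction Q E] (T : TreeAction Q V E)

lemma internalEdges_mono (F : Set E) {S S' : Set V} (h : S ⊆ S') :
    T.internalEdges F S ⊆ T.internalEdges F S' :=
  fun _ he => ⟨he.1, h he.2.1, h he.2.2⟩

lemma adj_internalEdges {F : Set E} {S : Set V} {x y : V} (h : T.Adj F x y) (hx : x ∈ S)
    (hy : y ∈ S) : T.Adj (T.internalEdges F S) x y := by
  obtain ⟨e, he, ⟨rfl, rfl⟩ | ⟨rfl, rfl⟩⟩ := h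
  exacts [⟨e, ⟨he, hx, hy⟩, Or.inl ⟨rfl, rfl⟩⟩, ⟨e, ⟨he, hy, hx⟩, Or.inr ⟨rfl, rfl⟩⟩]

/-- There is a subtree meeting every orbit of reachable vertices exactly once. -/
lemma exists_transversal (x₀ : V) {H : Subgroup Q} {EH : Set E}
    (hEH : ∀ h ∈ H, ∀ e ∈ EH, h • e ∈ EH) :
    ∃ S : Set V, x₀ ∈ S ∧ (∀ w ∈ S, T.Reach (T.internalEdges EH S) x₀ w) ∧
      (∀ w ∈ S, ∀ h ∈ H, h • w ∈ S → h • w = w) ∧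
      ∀ x, T.Reach EH x₀ x → ∃ h ∈ H, h • x ∈ S := by
  let 𝒮 : Set (Set V) := {S | x₀ ∈ S ∧ (∀ w ∈ S, T.Reach (T.internalEdges EH S) x₀ w) ∧
      (∀ w ∈ S, ∀ h ∈ H, h • w ∈ S → h • w = w)}
  have h𝒮 : {x₀} ∈ 𝒮 := by
    refine ⟨rfl, ?_, ?_⟩
    · rintro w rfl
      exact .refl
    · rintro w rfl h _ hw
      exact hw
  obtain ⟨S, -, hS⟩ := zorn_subset_nonempty 𝒮 (by
    intro c hc hchain hne
    refine ⟨⋃₀ c, ⟨?_, ?_, ?_⟩, fun s hs => Set.subset_sUnion_of_mem hs⟩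
    · obtain ⟨s, hs⟩ := hne
      exact ⟨s, hs, (hc hs).1⟩
    · rintro w ⟨s, hs, hw⟩
      exact ((hc hs).2.1 w hw).mono (T.internalEdges_mono EH (Set.subset_sUnion_of_mem hs))
    · rintro w ⟨s, hs, hw⟩ h hh ⟨s', hs', hw'⟩
      rcases hchain.total hs hs' with hss | hss
      · exact (hc hs').2.2 w (hss hw) h hh hw'
      · exact (hc hs).2.2 w hw h hh (hss hw')) {x₀} h𝒮
  obtain ⟨h0, hconn, horb⟩ := hS.prop
  refine ⟨S, h0, hconn, horb, ?_⟩
  intro x hx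
  induction hx with
  | refl => exact ⟨1, one_mem _, by simpa using h0⟩
  | @tail x y hx hxy ih =>
    obtain ⟨h, hh, hhx⟩ := ih
    by_contra! hcon
    have hadj : T.Adj EH (h • x) (h • y) := hxy.smul (hEH h hh)
    have hmem : insert (h • y) S ∈ 𝒮 := by
      have hmono := T.internalEdges_mono EH (Set.subset_insert (h • y) S)
      refine ⟨Or.inr h0, ?_, ?_⟩
      · rintro w (rfl | hw)
        · exact ((hconn _ hhx).mono hmono).tail
            (T.adj_internalEdges hadj (Or.inr hhx) (Or.inl rfl))
        · exact (hconn w hw).mono hmono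
      · rintro w (rfl | hw) h' hh' (h1 | h1)
        · exact h1
        · rw [← mul_smul] at h1
          exact (hcon _ (mul_mem hh' hh) h1).elim
        · have : (h⁻¹ * h') • w = y := by rw [mul_smul, h1, inv_smul_smul]
          refine (hcon (h'⁻¹ * h) (mul_mem (inv_mem hh') hh) ?_).elim
          rw [← this, ← mul_smul]
          simpa [mul_assoc] using hw
        · exact horb w hw h' hh' h1
    have := hS.le_of_ge hmem (Set.subset_insert _ _) (Or.inl rfl)
    exact hcon h hh this

open Classical in
/-- A group acting on a tree is generated by vertex stabilizers and cyclic subgroups; if it cannot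
be generated by `n` of them, then the cocycle has `n + 1` values satisfying no square-summable
relation. -/
theorem kurosh_or_independent (x₀ : V) (htf : ∀ g : Q, ∀ k : ℕ, k ≠ 0 → g ^ k = 1 → g = 1)
    {H L : Subgroup Q} (hHL : H ≤ L) {EH : Set E} (hEH : ∀ h ∈ H, ∀ e ∈ EH, h • e ∈ EH)
    (hL : ∀ e ∈ EH, ∀ g ∈ L, g • e ∈ EH → g ∈ H)
    (hreach : ∀ h ∈ H, T.Reach EH x₀ (h • x₀)) (n : ℕ) :
    (∃ D : Fin n → Subgroup Q, H = ⨆ i, D i ∧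
      ∀ i, (∃ w, T.Reach EH x₀ w ∧ D i = H ⊓ MulAction.stabilizer Q w) ∨
        ∃ g ∈ H, D i = Subgroup.zpowers g) ∨
    ∃ b : Fin (n + 1) → Q, (∀ j, b j ∈ H) ∧ ∀ v : Fin (n + 1) → Q → ℝ,
      (∀ j, Summable fun g => v j g ^ 2) → (∀ j g, v j g ≠ 0 → g ∈ L) →
      (∀ y : E ⊕ Q, ∑ j, ∑ᶠ g, v j g * T.cocycle x₀ (b j) (g⁻¹ • y) = 0) →
      ∀ j g, v j g = 0 := by
  obtain ⟨S, h0, hconn, horb, hmeet⟩ := T.exists_transversal x₀ hEH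
  set I := T.internalEdges EH S with hI
  have hreachS : ∀ w ∈ S, T.Reach EH x₀ w := fun w hw =>
    (hconn w hw).mono fun e he => he.1
  let P : E → E → Prop := fun e f => (f ∈ EH ∧ T.src f ∈ S) ∧ ∃ h ∈ H, f = h • e
  let rep : E → E := fun e => if hP : ∃ f, P e f then hP.choose else e
  have hrep : ∀ e ∈ EH, T.src e ∈ S → P e (rep e) := by
    intro e he hs
    have hP : ∃ f, P e f := ⟨e, ⟨he, hs⟩, 1, one_mem _, by simp⟩
    simp only [rep, dif_pos hP]
    exact hP.choose_spec
  have hrepinv : ∀ e ∈ EH, T.src e ∈ S → ∀ h ∈ H, rep (h • e) = rep e := by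
    intro e he hs h hh
    have hPe : P (h • e) = P e := by
      funext f
      simp only [P, eq_iff_iff, and_congr_right_iff]
      intro _
      constructor
      · rintro ⟨h', hh', rfl⟩
        exact ⟨h' * h, mul_mem hh' hh, by rw [mul_smul]⟩
      · rintro ⟨h', hh', rfl⟩
        exact ⟨h' * h⁻¹, mul_mem hh' (inv_mem hh), by rw [mul_smul, inv_smul_smul]⟩
    have hP : ∃ f, P e f := ⟨e, ⟨he, hs⟩, 1, one_mem _, by simp⟩
    simp only [rep, hPe, dif_pos hP]
  let F : Set E := {f | f ∈ EH ∧ T.src f ∈ S ∧ (∀ h ∈ H, h • f ∉ I) ∧ rep f = f}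
  have hrepF : ∀ e ∈ EH, T.src e ∈ S → (∀ h ∈ H, h • e ∉ I) → rep e ∈ F := by
    intro e he hs hn
    obtain ⟨⟨h1, h2⟩, h, hh, h3⟩ := hrep e he hs
    refine ⟨h1, h2, fun h' hh' hmem => ?_, ?_⟩
    · rw [h3, ← mul_smul] at hmem
      exact hn _ (mul_mem hh' hh) hmem
    · conv_lhs => rw [h3]
      exact hrepinv e he hs h hh
  have hForb : ∀ f ∈ F, ∀ h ∈ H, h • f ∈ F → h • f = f := by
    intro f hf h hh hhf
    rw [← hhf.2.2.2, hrepinv f hf.1 hf.2.1 h hh, hf.2.2.2]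
  have hs : ∀ f, ∃ s : Q, s ∈ H ∧ (f ∈ F → ∃ w ∈ S, T.tgt f = s • w) := by
    intro f
    by_cases hf : f ∈ F
    · obtain ⟨h, hh, hmem⟩ := hmeet (T.tgt f)
        ((hreachS _ hf.2.1).tail ⟨f, hf.1, Or.inl ⟨rfl, rfl⟩⟩)
      exact ⟨h⁻¹, inv_mem hh, fun _ => ⟨_, hmem, by simp⟩⟩
    · exact ⟨1, one_mem _, fun h => absurd h hf⟩
  choose s hsH hsF using hs
  let sub : V ⊕ E → Subgroup Q :=
    Sum.elim (fun w => H ⊓ MulAction.stabilizer Q w) fun f => Subgroup.zpowers (s f)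
  let P : Set (V ⊕ E) := {p | Sum.elim (fun w => w ∈ S ∧ H ⊓ MulAction.stabilizer Q w ≠ ⊥)
    (fun f => f ∈ F) p}
  have hsubH : ∀ p, sub p ≤ H := by
    rintro (w | f)
    · exact inf_le_left
    · exact (Subgroup.zpowers_le).mpr (hsH f)
  set L₀ : Subgroup Q := ⨆ p : P, sub p with hL₀
  have hL₀H : L₀ ≤ H := iSup_le fun p => hsubH _
  have hstab : ∀ w ∈ S, ∀ h ∈ H, h • w = w → h ∈ L₀ := by
    intro w hw h hh hhw
    by_cases hbot : H ⊓ MulAction.stabilizer Q w = ⊥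
    · have : h ∈ H ⊓ MulAction.stabilizer Q w := ⟨hh, hhw⟩
      rw [hbot, Subgroup.mem_bot] at this
      rw [this]
      exact one_mem _
    · exact Subgroup.mem_iSup_of_mem (⟨.inl w, hw, hbot⟩ : P) ⟨hh, hhw⟩
  have hsL : ∀ f ∈ F, s f ∈ L₀ := fun f hf =>
    Subgroup.mem_iSup_of_mem (⟨.inr f, hf⟩ : P) (Subgroup.mem_zpowers _)
  have hout : ∀ e ∈ EH, T.src e ∈ S → ∃ l ∈ L₀, l • T.tgt e ∈ S := by
    intro e he hes
    by_cases hex : ∃ h ∈ H, h • e ∈ I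
    · obtain ⟨h, hh, hhe⟩ := hex
      have h1 := hhe.2.1
      have h2 := hhe.2.2
      rw [T.src_smul] at h1
      rw [T.tgt_smul] at h2
      exact ⟨h, hstab _ hes h hh (horb _ hes h hh h1), h2⟩
    · push Not at hex
      have hF := hrepF e he hes hex
      obtain ⟨⟨-, h2⟩, h, hh, h3⟩ := hrep e he hes
      obtain ⟨w, hw, hwt⟩ := hsF _ hF
      have h4 := hstab _ hes h hh (horb _ hes h hh (by rwa [← T.src_smul, ← h3]))
      refine ⟨(s (rep e))⁻¹ * h, mul_mem (inv_mem (hsL _ hF)) h4, ?_⟩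
      rw [mul_smul, ← T.tgt_smul, ← h3, hwt, inv_smul_smul]
      exact hw
  have hin : ∀ e ∈ EH, T.tgt e ∈ S → ∃ l ∈ L₀, l • T.src e ∈ S := by
    intro e he het
    obtain ⟨h, hh, hmem⟩ := hmeet (T.src e)
      ((hreachS _ het).tail ⟨e, he, Or.inr ⟨rfl, rfl⟩⟩)
    obtain ⟨l, hl, hlm⟩ := hout (h • e) (hEH h hh e he) (by rwa [T.src_smul])
    rw [T.tgt_smul, ← mul_smul] at hlm
    have h1 := hstab _ het (l * h) (mul_mem (hL₀H hl) hh)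
      (horb _ het _ (mul_mem (hL₀H hl) hh) hlm)
    exact ⟨h, by simpa using mul_mem (inv_mem hl) h1, hmem⟩
  have hcover : ∀ x, T.Reach EH x₀ x → ∃ l ∈ L₀, l • x ∈ S := by
    intro x hx
    induction hx with
    | refl => exact ⟨1, one_mem _, by simpa using h0⟩
    | @tail x y hx hxy ih =>
      obtain ⟨l, hl, hlx⟩ := ih
      have hadj := hxy.smul (hEH l (hL₀H hl))
      obtain ⟨e, he, ⟨h1, h2⟩ | ⟨h1, h2⟩⟩ := hadj
      · obtain ⟨l', hl', h3⟩ := hout e he (h1 ▸ hlx)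
        exact ⟨l' * l, mul_mem hl' hl, by rwa [mul_smul, ← h2]⟩
      · obtain ⟨l', hl', h3⟩ := hin e he (h2 ▸ hlx)
        exact ⟨l' * l, mul_mem hl' hl, by rwa [mul_smul, ← h1]⟩
  have hHL₀ : H = L₀ := by
    refine le_antisymm (fun h hh => ?_) hL₀H
    obtain ⟨l, hl, hlm⟩ := hcover _ (hreach h hh)
    rw [← mul_smul] at hlm
    have hlH := mul_mem (hL₀H hl) hh
    have := hstab _ h0 _ hlH (horb _ h0 _ hlH hlm)
    simpa using mul_mem (inv_mem hl) this
  by_cases hcard : P.encard ≤ n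
  · left
    have hfin : P.Finite := Set.finite_of_encard_le_coe hcard
    obtain ⟨k, hk⟩ : ∃ k, P.ncard = k := ⟨_, rfl⟩
    have hkn : k ≤ n := by
      rw [← hk]
      rw [← hfin.cast_ncard_eq] at hcard
      exact_mod_cast hcard
    have := hfin.to_subtype
    let eqv : P ≃ Fin k := Finite.equivFinOfCardEq (by rw [← hk]; rfl)
    refine ⟨fun i => if h : i.1 < k then sub (eqv.symm ⟨i, h⟩) else Subgroup.zpowers 1, ?_, ?_⟩
    · rw [hHL₀, hL₀]
      apply le_antisymm
      · refine iSup_le fun p => ?_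
        refine le_iSup_of_le ⟨eqv p, (eqv p).2.trans_le hkn⟩ ?_
        simp
      · refine iSup_le fun i => ?_
        dsimp only
        split_ifs with h
        · exact le_iSup (fun p : P => sub p) _
        · simp
    · intro i
      dsimp only
      split_ifs with h
      · obtain ⟨w | f, hp⟩ := eqv.symm ⟨i, h⟩
        · exact Or.inl ⟨w, hreachS w hp.1, rfl⟩
        · exact Or.inr ⟨s f, hsH f, rfl⟩
      · exact Or.inr ⟨1, one_mem _, rfl⟩
  · right
    obtain ⟨t, htP, htc⟩ := Set.exists_subset_encard_eq (s := P) (k := (n + 1 : ℕ))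
      (by
        push_cast
        exact Order.add_one_le_of_lt (not_le.mp hcard))
    have htfin : t.Finite := Set.finite_of_encard_eq_coe htc
    have := htfin.to_subtype
    have htn : Nat.card t = n + 1 := by
      rw [← htfin.cast_ncard_eq] at htc
      exact_mod_cast htc
    let eqv : t ≃ Fin (n + 1) := Finite.equivFinOfCardEq htn
    let κ : Fin (n + 1) → V ⊕ E := fun j => eqv.symm j
    have hκ : Function.Injective κ := Subtype.val_injective.comp eqv.symm.injective
    have hκP : ∀ j, κ j ∈ P := fun j => htP (eqv.symm j).2
    have hb : ∀ j, ∃ b ∈ H, (∀ w, κ j = .inl w → w ∈ S ∧ b • w = w ∧ b ≠ 1) ∧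
        ∀ f, κ j = .inr f → f ∈ F ∧ ∃ w ∈ S, T.tgt f = b • w := by
      intro j
      have hp := hκP j
      rcases hj : κ j with w | f
      · rw [hj] at hp
        obtain ⟨b, hb, hb1⟩ :=
          (H ⊓ MulAction.stabilizer Q w).bot_or_exists_ne_one.resolve_left hp.2
        refine ⟨b, hb.1, ?_, fun f hf => by cases hf⟩
        rintro w' hw'
        cases hw'
        exact ⟨hp.1, hb.2, hb1⟩
      · rw [hj] at hp
        refine ⟨s f, hsH f, fun w hw => (by cases hw), ?_⟩
        rintro f' hf'
        cases hf'
        exact ⟨hp, hsF f hp⟩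
    choose b hbH hbV hbE using hb
    exact ⟨b, hbH, fun v hv hvL hrel => T.cocycle_independent x₀ htf hHL hL hconn horb
      (fun f hf => hf.1) (fun f hf => hf.2.1) (fun f hf => hf.2.2.1) hForb κ hκ b hbH hbV hbE
      v hv hvL hrel⟩

end TreeAction

end FreeProductFix

namespace FreeProductFix

namespace TreeAction

variable {Q V E : Type*} [Group Q] [MulAction Q V] [MulAction Q E] (T : TreeAction Q V E)

/-- A subgroup of periodic points of an injective endomorphism is generated by few vertex
stabilizers and cyclic subgroups. -/
theorem exists_generating_pieces [Countable Q] (x₀ : V)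
    (htf : ∀ g : Q, ∀ k : ℕ, k ≠ 0 → g ^ k = 1 → g = 1)
    (φ : Q →* Q) (hφ : Function.Injective φ)
    {n : ℕ} (D : Fin n → Subgroup Q) (hcomm : ∀ i, ∀ a ∈ D i, ∀ b ∈ D i, a * b = b * a)
    (hD : ⨆ i, D i = ⊤)
    (hfin : ∀ g : Q, {e | T.side e (g • x₀) ≠ T.side e x₀}.Finite)
    {H L : Subgroup Q} (hHL : H ≤ L) {EH : Set E} (hEH : ∀ h ∈ H, ∀ e ∈ EH, h • e ∈ EH)
    (hL : ∀ e ∈ EH, ∀ g ∈ L, g • e ∈ EH → g ∈ H)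
    (hreach : ∀ h ∈ H, T.Reach EH x₀ (h • x₀))
    (hH : ∀ h ∈ H, ∃ p, p ≠ 0 ∧ φ^[p] h = h) (hLper : ∀ g p, p ≠ 0 → φ^[p] g = g → g ∈ L) :
    ∃ D : Fin n → Subgroup Q, H = ⨆ i, D i ∧
      ∀ i, (∃ w, T.Reach EH x₀ w ∧ D i = H ⊓ MulAction.stabilizer Q w) ∨
        ∃ g ∈ H, D i = Subgroup.zpowers g := by
  obtain h | ⟨b, hb, hind⟩ := T.kurosh_or_independent x₀ htf hHL hEH hL hreach n
  · exact h
  exfalso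
  choose p hp0 hp using fun j => hH (b j) (hb j)
  have hfix : ∀ j, iterHom φ (∏ j, p j) (b j) = b j := by
    intro j
    rw [iterHom_apply]
    have h1 : Function.IsPeriodicPt φ (p j) (b j) := hp j
    exact h1.trans_dvd (Finset.dvd_prod_of_mem p (Finset.mem_univ j))
  obtain ⟨v, hv2, ⟨j, g, hjg⟩, hper, hrel⟩ := exists_periodic_relation htf
    (iterHom φ (∏ j, p j)) (iterHom_injective hφ _) D hcomm hD T.free_sum (T.cocycle x₀)
    (T.cocycle_mul x₀) (fun g => T.finite_support_cocycle x₀ g (hfin g)) (Nat.lt_succ_self n) b hfix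
  refine hjg (hind v hv2 (fun j g hg => ?_) hrel j g)
  obtain ⟨k, hk, hkg⟩ := hper j g hg
  refine hLper g ((∏ j, p j) * k) (mul_ne_zero (Finset.prod_ne_zero_iff.mpr fun j _ => hp0 j) hk) ?_
  rw [Function.iterate_mul]
  have : (φ^[∏ j, p j]) = iterHom φ (∏ j, p j) := by
    funext x
    rw [iterHom_apply]
  rw [this, hkg]

end TreeAction

end FreeProductFix

namespace FreeProductFix

open Monoid.CoprodI

section BassSerre

variable {n : ℕ} {A : Fin n → Type*} [∀ i, Group (A i)]

open Classical in
/-- The index of the first syllable of an element of a free product. -/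
noncomputable def firstIdx (g : Monoid.CoprodI A) : Option (Fin n) := (Word.equiv g).fstIdx

lemma firstIdx_prod (w : Word A) : firstIdx w.prod = w.fstIdx := by
  classical
  have h : Word.equiv w.prod = w := Word.equiv.apply_symm_apply w
  rw [firstIdx]
  convert congrArg Word.fstIdx h

lemma firstIdx_of_mul {i : Fin n} {m : A i} (hm : m ≠ 1) {g : Monoid.CoprodI A}
    (hg : firstIdx g ≠ some i) : firstIdx (of m * g) = some i := by
  classical
  obtain ⟨w, rfl⟩ := Word.equiv.symm.surjective g
  change firstIdx w.prod ≠ _ at hg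
  change firstIdx (of m * w.prod) = _
  rw [firstIdx_prod] at hg
  rw [← Word.prod_cons i m w hm hg, firstIdx_prod, Word.fstIdx_cons]

lemma firstIdx_one : firstIdx (1 : Monoid.CoprodI A) = none := by
  rw [← Word.prod_empty, firstIdx_prod]
  rfl

lemma firstIdx_induction {motive : Monoid.CoprodI A → Prop} (one : motive 1)
    (step : ∀ i (m : A i) g, m ≠ 1 → firstIdx g ≠ some i → motive g → motive (of m * g))
    (g : Monoid.CoprodI A) : motive g := by
  classical
  obtain ⟨w, rfl⟩ := Word.equiv.symm.surjective g
  change motive w.prod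
  induction w using Word.consRecOn with
  | empty => rw [Word.prod_empty]; exact one
  | cons i m w h1 h2 ih =>
    rw [Word.prod_cons]
    exact step i m _ h2 (by rwa [firstIdx_prod]) ih

lemma firstIdx_of {i : Fin n} {m : A i} (hm : m ≠ 1) :
    firstIdx (of m : Monoid.CoprodI A) = some i := by
  have := firstIdx_of_mul hm (g := (1 : Monoid.CoprodI A)) (by rw [firstIdx_one]; simp)
  rwa [mul_one] at this

lemma firstIdx_mul_of {i j : Fin n} (a : A j) (g : Monoid.CoprodI A)
    (h : firstIdx (g * of a) = some i) : firstIdx g = some i ∨ (g = 1 ∧ j = i) := by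
  induction g using firstIdx_induction generalizing i with
  | one =>
    right
    rw [one_mul] at h
    rcases eq_or_ne a 1 with rfl | ha
    · rw [map_one, firstIdx_one] at h
      simp at h
    · rw [firstIdx_of ha] at h
      exact ⟨rfl, Option.some_injective _ h⟩
  | step k m g hm hg ih =>
    left
    rw [mul_assoc] at h
    rw [firstIdx_of_mul hm hg]
    by_cases hk : firstIdx (g * of a) = some k
    · obtain h1 | ⟨rfl, rfl⟩ := ih hk
      · exact absurd h1 hg
      · rw [one_mul, ← map_mul] at h
        rcases eq_or_ne (m * a) 1 with h2 | h2
        · rw [h2, map_one, firstIdx_one] at h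
          simp at h
        · rwa [firstIdx_of h2] at h
    · rwa [firstIdx_of_mul hm hk] at h

variable (A)

/-- The vertices of the Bass–Serre tree of a free product. -/
abbrev BSVertex : Type _ :=
  Monoid.CoprodI A ⊕ Σ i, Monoid.CoprodI A ⧸ (of : A i →* Monoid.CoprodI A).range

/-- The edges of the Bass–Serre tree of a free product. -/
abbrev BSEdge : Type _ := Σ _ : Fin n, Monoid.CoprodI A

variable {A}

/-- The far side of the edge joining `1` to the coset of the `i`-th factor. -/
def farSide (i : Fin n) : BSVertex A → Prop
  | .inl g => firstIdx g = some i
  | .inr c => ∃ y : Monoid.CoprodI A, (y : Monoid.CoprodI A ⧸ _) = c.2 ∧ firstIdx y = some i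

variable (A) in
open Classical in
/-- The Bass–Serre tree of a free product. -/
noncomputable def bassSerre [∀ i, Nontrivial (A i)] :
    TreeAction (Monoid.CoprodI A) (BSVertex A) (BSEdge A) where
  src e := .inl e.2
  tgt e := .inr ⟨e.1, (e.2 : Monoid.CoprodI A ⧸ _)⟩
  side e x := if farSide e.1 (e.2⁻¹ • x) then 1 else 0
  src_smul _ _ := rfl
  tgt_smul _ _ := rfl
  side_smul g e x := by
    have : (g • e).2⁻¹ • g • x = e.2⁻¹ • x := by
      rw [smul_smul]
      congr 1
      change (g * e.2)⁻¹ * g = _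
      group
    rw [this]
    rfl
  side_self := by
    rintro ⟨i, g⟩
    rw [if_pos, if_neg]
    · rfl
    · change ¬ (firstIdx (g⁻¹ * g) = some i)
      rw [inv_mul_cancel, firstIdx_one]
      simp
    · obtain ⟨a, ha⟩ := exists_ne (1 : A i)
      have h : ((of a : Monoid.CoprodI A) :
          Monoid.CoprodI A ⧸ (of : A i →* Monoid.CoprodI A).range) =
          (g⁻¹ * g : Monoid.CoprodI A) := by
        rw [inv_mul_cancel, QuotientGroup.eq]
        exact ⟨a⁻¹, by simp⟩
      exact ⟨of a, h, firstIdx_of ha⟩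
  side_ne := by
    rintro ⟨i, g⟩ ⟨j, h⟩ hne
    refine if_congr (Iff.intro ?_ fun hf => ⟨g⁻¹ * h, rfl, hf⟩) rfl rfl
    rintro ⟨y, hy, hyi⟩
    change ((y : Monoid.CoprodI A) : Monoid.CoprodI A ⧸ _) =
      ((g⁻¹ * h : Monoid.CoprodI A) : Monoid.CoprodI A ⧸ (of : A j →* Monoid.CoprodI A).range) at hy
    change firstIdx (g⁻¹ * h) = some i
    rw [eq_comm, QuotientGroup.eq] at hy
    obtain ⟨a, ha⟩ := hy
    have hy2 : y = g⁻¹ * h * of a := by rw [ha]; group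
    rw [hy2] at hyi
    obtain h1 | ⟨h1, rfl⟩ := firstIdx_mul_of a _ hyi
    · exact h1
    · exact absurd (by rw [inv_mul_eq_one.mp h1]) hne
  free := by
    rintro g ⟨i, h⟩ hg
    have : g * h = h := by
      have := congrArg Sigma.snd hg
      exact this
    exact mul_eq_right.mp this

lemma bassSerre_reach [∀ i, Nontrivial (A i)] (g : Monoid.CoprodI A) :
    (bassSerre A).Reach Set.univ (.inl 1) (.inl g) := by
  induction g using induction_on with
  | one => exact .refl
  | of i a =>
    refine .tail (.single (b := .inr ⟨i, ((1 : Monoid.CoprodI A) : Monoid.CoprodI A ⧸ _)⟩)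
      ⟨⟨i, 1⟩, trivial, Or.inl ⟨rfl, rfl⟩⟩) ⟨⟨i, of a⟩, trivial, Or.inr ⟨rfl, ?_⟩⟩
    have h : ((of a : Monoid.CoprodI A) : Monoid.CoprodI A ⧸ (of : A i →* Monoid.CoprodI A).range) =
        (1 : Monoid.CoprodI A) := by
      rw [QuotientGroup.eq]
      exact ⟨a⁻¹, by simp⟩
    exact congrArg (fun c => Sum.inr (Sigma.mk i c)) h
  | mul x y hx hy =>
    refine Relation.ReflTransGen.trans hx ?_
    have := hy.smul (g := x) fun _ _ => Set.mem_univ _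
    have h1 : x • (Sum.inl 1 : BSVertex A) = .inl x := by
      change Sum.inl (x * 1) = _
      rw [mul_one]
    rw [h1] at this
    exact this

lemma bassSerre_stabilizer (v : BSVertex A) (R : Subgroup (Monoid.CoprodI A))
    (hR : R ≤ MulAction.stabilizer _ v) :
    R = ⊥ ∨ ∃ i, ∃ f : A i →* Monoid.CoprodI A, Function.Injective f ∧ R ≤ f.range := by
  rcases v with g | ⟨i, c⟩
  · left
    rw [eq_bot_iff]
    intro h hh
    have h1 : h • (Sum.inl g : BSVertex A) = .inl g := hR hh
    have h2 : h * g = g := Sum.inl_injective h1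
    exact mul_eq_right.mp h2
  · right
    obtain ⟨g, rfl⟩ := QuotientGroup.mk_surjective c
    refine ⟨i, (MulAut.conj g).toMonoidHom.comp of, (MulAut.conj g).injective.comp (of_injective i),
      fun h hh => ?_⟩
    have h1 : h • (Sum.inr ⟨i, (g : Monoid.CoprodI A ⧸ _)⟩ : BSVertex A) = .inr ⟨i, _⟩ := hR hh
    have h2 := Sum.inr_injective h1
    have h3 : ((h * g : Monoid.CoprodI A) : Monoid.CoprodI A ⧸ (of : A i →* _).range) = g :=
      eq_of_heq (Sigma.mk.inj_iff.mp h2).2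
    rw [eq_comm, QuotientGroup.eq] at h3
    obtain ⟨a, ha⟩ := h3
    refine ⟨a, ?_⟩
    simp [ha]

end BassSerre

namespace TreeAction

variable {Q V E : Type*} [Group Q] [MulAction Q V] [MulAction Q E]

/-- The restriction of a tree action to a subgroup. -/
def restrict (T : TreeAction Q V E) (P : Subgroup Q) : TreeAction P V E where
  src := T.src
  tgt := T.tgt
  side := T.side
  src_smul g e := T.src_smul g e
  tgt_smul g e := T.tgt_smul g e
  side_smul g e x := T.side_smul g e x
  side_self := T.side_self
  side_ne := T.side_ne
  free g e h := Subtype.ext (T.free g e h)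

lemma Reach.restrict {T : TreeAction Q V E} {F : Set E} {x y : V} (h : T.Reach F x y)
    (P : Subgroup Q) : (T.restrict P).Reach F x y := h

end TreeAction

/-- A subgroup of a finite rank free abelian group of rank at most `T` is generated by
at most `T` elements. -/
lemma exists_finset_closure_eq {G : Type*} [Group G] {t T : ℕ} (hT : t ≤ T)
    (f : Multiplicative (Fin t → ℤ) →* G) (R : Subgroup G) (hR : R ≤ f.range) :
    ∃ s : Finset G, s.card ≤ T ∧ Subgroup.closure (s : Set G) = R := by
  classical
  let N : Submodule ℤ (Fin t → ℤ) := AddSubgroup.toIntSubmodule (Subgroup.toAddSubgroup' (R.comap f))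
  obtain ⟨k, ⟨b⟩⟩ := Submodule.nonempty_basis_of_pid (Pi.basisFun ℤ (Fin t)) N
  have hk : k ≤ t := by
    have h1 := Module.finrank_eq_card_basis b
    have h2 := Submodule.finrank_le N
    rw [h1] at h2
    simpa using h2
  refine ⟨Finset.univ.image fun j : Fin k => f (Multiplicative.ofAdd (b j : Fin t → ℤ)),
    Finset.card_image_le.trans (by simpa using hk.trans hT), le_antisymm ?_ ?_⟩
  · rw [Subgroup.closure_le]
    intro x hx
    simp only [Finset.coe_image, Finset.coe_univ, Set.image_univ, Set.mem_range] at hx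
    obtain ⟨j, rfl⟩ := hx
    exact (b j).2
  · intro x hx
    obtain ⟨a, rfl⟩ := hR hx
    have ha : a.toAdd ∈ N := hx
    have h := b.sum_repr ⟨a.toAdd, ha⟩
    have h2 : a.toAdd = ∑ j, b.repr ⟨a.toAdd, ha⟩ j • (b j : Fin t → ℤ) := by
      have := congrArg (Submodule.subtype N) h
      rw [map_sum] at this
      exact this.symm
    have h3 : a = ∏ j, Multiplicative.ofAdd (b j : Fin t → ℤ) ^ b.repr ⟨a.toAdd, ha⟩ j := by
      apply Multiplicative.toAdd.injective
      rw [toAdd_prod]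
      exact h2
    rw [← Subgroup.mem_comap, h3]
    refine Subgroup.prod_mem _ fun j _ => Subgroup.zpow_mem _ ?_ _
    exact Subgroup.subset_closure (by simp)

end FreeProductFix

namespace FreeProductFix

section Cuts

open Relation

variable {P : Type*}

/-- The edges of a graph with exactly one endpoint in a given set. -/
def edgeBoundary (r : P → P → Prop) (U : Set P) : Set (P × P) :=
  {e | r e.1 e.2 ∧ ¬ (e.1 ∈ U ↔ e.2 ∈ U)}

/-- A set of vertices spanning a connected subgraph. -/
def ConnIn (r : P → P → Prop) (U : Set P) : Prop :=
  ∀ a ∈ U, ∀ b ∈ U, ReflTransGen (fun x y => r x y ∧ x ∈ U ∧ y ∈ U) a b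

/-- The sets of vertices which are connected, have connected complement, and have at most `K`
boundary edges. -/
def cuts (r : P → P → Prop) (K : ℕ) : Set (Set P) :=
  {U | U.Nonempty ∧ Uᶜ.Nonempty ∧ ConnIn r U ∧ ConnIn r Uᶜ ∧
    (edgeBoundary r U).Finite ∧ (edgeBoundary r U).ncard ≤ K}

lemma edgeBoundary_compl (r : P → P → Prop) (U : Set P) :
    edgeBoundary r Uᶜ = edgeBoundary r U := by
  ext e
  simp only [edgeBoundary, Set.mem_ofPred_eq, Set.mem_compl_iff, not_iff_not]

lemma compl_mem_cuts {r : P → P → Prop} {K : ℕ} {U : Set P} (h : U ∈ cuts r K) :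
    Uᶜ ∈ cuts r K := by
  obtain ⟨h1, h2, h3, h4, h5, h6⟩ := h
  refine ⟨h2, by rwa [compl_compl], h4, by rwa [compl_compl], ?_⟩
  rw [edgeBoundary_compl]
  exact ⟨h5, h6⟩

lemma exists_crossing_edges {r : P → P → Prop} {x y : P} (h : ReflTransGen r x y) :
    ∃ F : Finset (P × P), ∀ U : Set P, x ∈ U → y ∉ U → ∃ e ∈ F, r e.1 e.2 ∧ e.1 ∈ U ∧ e.2 ∉ U := by
  classical
  induction h with
  | refl => exact ⟨∅, fun U h1 h2 => absurd h1 h2⟩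
  | @tail b c _ hbc ih =>
    obtain ⟨F, hF⟩ := ih
    refine ⟨insert (b, c) F, fun U hx hc => ?_⟩
    by_cases hb : b ∈ U
    · exact ⟨(b, c), Finset.mem_insert_self _ _, hbc, hb, hc⟩
    · obtain ⟨e, he, h⟩ := hF U hx hb
      exact ⟨e, Finset.mem_insert_of_mem he, h⟩

lemma finite_cuts_separating (r : P → P → Prop) (K : ℕ) (x y : P) :
    {U ∈ cuts r K | x ∈ U ∧ y ∉ U}.Finite := by
  induction K using Nat.strong_induction_on generalizing r with
  | _ K ih =>
  by_cases hxy : ReflTransGen r x y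
  · obtain ⟨F, hF⟩ := exists_crossing_edges hxy
    rcases Nat.eq_zero_or_pos K with rfl | hK
    · refine Set.Finite.subset Set.finite_empty ?_
      rintro U ⟨⟨_, _, _, _, h5, h6⟩, hx, hy⟩
      obtain ⟨e, _, he, he1, he2⟩ := hF U hx hy
      have h7 := (Set.ncard_eq_zero h5).mp (Nat.le_zero.mp h6)
      have h8 : e ∈ edgeBoundary r U := ⟨he, by simp [he1, he2]⟩
      rw [h7] at h8
      exact h8
    refine Set.Finite.subset (F.finite_toSet.biUnion fun e _ =>
      ih (K - 1) (by omega) (fun p q => r p q ∧ (p, q) ≠ e)) ?_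
    rintro U ⟨⟨h1, h2, h3, h4, h5, h6⟩, hx, hy⟩
    obtain ⟨e, heF, he, he1, he2⟩ := hF U hx hy
    refine Set.mem_biUnion heF ⟨⟨h1, h2, fun a ha b hb => ?_, fun a ha b hb => ?_, ?_⟩, hx, hy⟩
    · refine ReflTransGen.mono ?_ _ _ (h3 a ha b hb)
      rintro p q ⟨hr, hp, hq⟩
      refine ⟨⟨hr, ?_⟩, hp, hq⟩
      rintro rfl
      exact he2 hq
    · refine ReflTransGen.mono ?_ _ _ (h4 a ha b hb)
      rintro p q ⟨hr, hp, hq⟩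
      refine ⟨⟨hr, ?_⟩, hp, hq⟩
      rintro rfl
      exact hp he1
    · have hsub : edgeBoundary (fun p q => r p q ∧ (p, q) ≠ e) U ⊆ edgeBoundary r U \ {e} := by
        rintro f ⟨⟨hf1, hf2⟩, hf3⟩
        exact ⟨⟨hf1, hf3⟩, hf2⟩
      have hfin : (edgeBoundary r U \ {e}).Finite := h5.subset Set.sdiff_subset
      refine ⟨hfin.subset hsub, (Set.ncard_le_ncard hsub hfin).trans ?_⟩
      have he8 : e ∈ edgeBoundary r U := ⟨he, by simp [he1, he2]⟩
      rw [Set.ncard_sdiff_singleton_of_mem he8]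
      omega
  · refine Set.Finite.subset (Set.finite_singleton {z | ReflTransGen r x z}) ?_
    rintro U ⟨⟨h1, h2, h3, h4, h5, h6⟩, hx, hy⟩
    have hmono : ∀ (W : Set P) a b,
        ReflTransGen (fun x y => r x y ∧ x ∈ W ∧ y ∈ W) a b → ReflTransGen r a b :=
      fun W a b h => ReflTransGen.mono (fun _ _ h => h.1) _ _ h
    refine Set.mem_singleton_iff.mpr (Set.Subset.antisymm (fun z hz => hmono _ _ _ (h3 x hx z hz))
      fun z hz => ?_)
    by_contra hzU
    exact hxy (ReflTransGen.trans hz (hmono _ _ _ (h4 z hzU y hy)))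

/-- Two sets cross if they and their complements meet each other. -/
def Cross (U D : Set P) : Prop :=
  (U ∩ D).Nonempty ∧ (U ∩ Dᶜ).Nonempty ∧ (Uᶜ ∩ D).Nonempty ∧ (Uᶜ ∩ Dᶜ).Nonempty

lemma Cross.symm {U D : Set P} (h : Cross U D) : Cross D U := by
  obtain ⟨h1, h2, h3, h4⟩ := h
  rw [Set.inter_comm] at h1 h2 h3 h4
  exact ⟨h1, h3, h2, h4⟩

lemma Cross.compl_right {U D : Set P} (h : Cross U D) : Cross U Dᶜ := by
  obtain ⟨h1, h2, h3, h4⟩ := h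
  exact ⟨h2, by rwa [compl_compl], h4, by rwa [compl_compl]⟩

lemma Cross.compl_left {U D : Set P} (h : Cross U D) : Cross Uᶜ D :=
  h.symm.compl_right.symm

lemma finite_crossing (r : P → P → Prop) (K : ℕ) {U : Set P} (hU : (edgeBoundary r U).Finite) :
    {D ∈ cuts r K | Cross U D}.Finite := by
  have key : ∀ D : Set P, ConnIn r D → (U ∩ D).Nonempty → (Uᶜ ∩ D).Nonempty →
      ∃ e ∈ edgeBoundary r U, e.1 ∈ D := by
    rintro D hD ⟨a, haU, haD⟩ ⟨b, hbU, hbD⟩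
    obtain ⟨F, hF⟩ := exists_crossing_edges (hD a haD b hbD)
    obtain ⟨e, _, ⟨he, he1, _⟩, he2, he3⟩ := hF U haU hbU
    exact ⟨e, ⟨he, by simp [he2, he3]⟩, he1⟩
  refine Set.Finite.subset (hU.biUnion fun e _ => hU.biUnion fun f _ =>
    finite_cuts_separating r K e.1 f.1) ?_
  rintro D ⟨hD, hc1, hc2, hc3, hc4⟩
  obtain ⟨e, he, heD⟩ := key D hD.2.2.1 hc1 hc3
  obtain ⟨f, hf, hfD⟩ := key Dᶜ hD.2.2.2.1 hc2 hc4
  exact Set.mem_biUnion he (Set.mem_biUnion hf ⟨hD, heD, hfD⟩)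

lemma ncard_add_le {α : Type*} {X Y Z W : Set α} (hX : X.Finite) (hY : Y.Finite)
    (h1 : Z ⊆ X ∪ Y) (h2 : W ⊆ X ∪ Y) (h3 : Z ∩ W ⊆ X ∩ Y) :
    Z.ncard + W.ncard ≤ X.ncard + Y.ncard := by
  have hXY := hX.union hY
  rw [← Set.ncard_union_add_ncard_inter X Y hX hY,
    ← Set.ncard_union_add_ncard_inter Z W (hXY.subset h1) (hXY.subset h2)]
  exact Nat.add_le_add (Set.ncard_le_ncard (Set.union_subset h1 h2) hXY)
    (Set.ncard_le_ncard h3 (hX.inter_of_left _))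

lemma ncard_add_lt {α : Type*} {X Y Z W : Set α} (hX : X.Finite) (hY : Y.Finite)
    (h1 : Z ⊆ X ∪ Y) (h2 : W ⊆ X ∪ Y) (h3 : Z ∩ W ⊆ X ∩ Y) {a : α} (ha : a ∈ X) (haZ : a ∉ Z)
    (haW : a ∉ W) : Z.ncard + W.ncard < X.ncard + Y.ncard := by
  have hXY := hX.union hY
  rw [← Set.ncard_union_add_ncard_inter X Y hX hY,
    ← Set.ncard_union_add_ncard_inter Z W (hXY.subset h1) (hXY.subset h2)]
  refine Nat.add_lt_add_of_lt_of_le (Set.ncard_lt_ncard ⟨Set.union_subset h1 h2, fun h => ?_⟩ hXY)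
    (Set.ncard_le_ncard h3 (hX.inter_of_left _))
  exact (h (Or.inl ha)).elim haZ haW

/-- The number of small cuts crossing a given set. -/
noncomputable def crossNum (r : P → P → Prop) (K : ℕ) (U : Set P) : ℕ :=
  {D ∈ cuts r K | Cross U D}.ncard

lemma crossNum_compl (r : P → P → Prop) (K : ℕ) (U : Set P) :
    crossNum r K Uᶜ = crossNum r K U := by
  rw [crossNum, crossNum]
  congr 1
  ext D
  refine and_congr Iff.rfl ⟨fun h => ?_, Cross.compl_left⟩
  have := h.compl_left
  rwa [compl_compl] at this

lemma ncard_edgeBoundary_corners {r : P → P → Prop} {U D : Set P}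
    (hU : (edgeBoundary r U).Finite) (hD : (edgeBoundary r D).Finite) :
    (edgeBoundary r (U ∩ D)).ncard + (edgeBoundary r (Uᶜ ∩ Dᶜ)).ncard ≤
      (edgeBoundary r U).ncard + (edgeBoundary r D).ncard := by
  refine ncard_add_le hU hD ?_ ?_ ?_
  · rintro e ⟨he, h⟩
    simp only [edgeBoundary, Set.mem_union, Set.mem_ofPred_eq, Set.mem_inter_iff] at h ⊢
    tauto
  · rintro e ⟨he, h⟩
    simp only [edgeBoundary, Set.mem_union, Set.mem_ofPred_eq, Set.mem_inter_iff,
      Set.mem_compl_iff] at h ⊢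
    tauto
  · rintro e ⟨⟨he, h⟩, _, h2⟩
    simp only [edgeBoundary, Set.mem_ofPred_eq, Set.mem_inter_iff,
      Set.mem_compl_iff] at h h2 ⊢
    tauto

lemma finite_edgeBoundary_corner {r : P → P → Prop} {U D : Set P}
    (hU : (edgeBoundary r U).Finite) (hD : (edgeBoundary r D).Finite) :
    (edgeBoundary r (U ∩ D)).Finite := by
  refine (hU.union hD).subset ?_
  rintro e ⟨he, h⟩
  simp only [edgeBoundary, Set.mem_union, Set.mem_ofPred_eq, Set.mem_inter_iff] at h ⊢
  tauto

lemma cross_of_cross_corner {U D C : Set P} (hUD : Cross U D) (hC : Cross (U ∩ D) C) :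
    Cross U C ∨ Cross D C := by
  by_contra h
  rw [not_or] at h
  obtain ⟨hU, hD⟩ := h
  obtain ⟨⟨a, ⟨ha1, ha2⟩, ha3⟩, ⟨b, ⟨hb1, hb2⟩, hb3⟩, ⟨c, hc1, hc2⟩, ⟨d, hd1, hd2⟩⟩ := hC
  obtain ⟨_, _, _, ⟨z, hz1, hz2⟩⟩ := hUD
  have hU' : (∀ x, x ∉ U → x ∈ C) ∨ (∀ x, x ∉ U → x ∉ C) := by
    by_contra! h
    obtain ⟨⟨x, hx, hx2⟩, y, hy, hy2⟩ := h
    exact hU ⟨⟨a, ha1, ha3⟩, ⟨b, hb1, hb3⟩, ⟨y, hy, hy2⟩, ⟨x, hx, hx2⟩⟩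
  have hD' : (∀ x, x ∉ D → x ∈ C) ∨ (∀ x, x ∉ D → x ∉ C) := by
    by_contra! h
    obtain ⟨⟨x, hx, hx2⟩, y, hy, hy2⟩ := h
    exact hD ⟨⟨a, ha2, ha3⟩, ⟨b, hb2, hb3⟩, ⟨y, hy, hy2⟩, ⟨x, hx, hx2⟩⟩
  simp only [Set.mem_compl_iff, Set.mem_inter_iff] at *
  rcases hU' with h1 | h1 <;> rcases hD' with h2 | h2
  · have := h1 d; have := h2 d; tauto
  · have := h1 z; have := h2 z; tauto
  · have := h1 z; have := h2 z; tauto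
  · have := h1 c; have := h2 c; tauto

lemma crossNum_corners {r : P → P → Prop} {K : ℕ} {U D : Set P}
    (hU : (edgeBoundary r U).Finite) (hD : (edgeBoundary r D).Finite) (hDc : D ∈ cuts r K)
    (hUD : Cross U D) :
    crossNum r K (U ∩ D) + crossNum r K (Uᶜ ∩ Dᶜ) < crossNum r K U + crossNum r K D := by
  refine ncard_add_lt (a := D) (finite_crossing r K hU) (finite_crossing r K hD) ?_ ?_ ?_
    ⟨hDc, hUD⟩ ?_ ?_
  · rintro C ⟨hC, h⟩
    exact (cross_of_cross_corner hUD h).imp (fun h => ⟨hC, h⟩) fun h => ⟨hC, h⟩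
  · rintro C ⟨hC, h⟩
    have := cross_of_cross_corner hUD.compl_left.compl_right h
    refine this.imp (fun h => ⟨hC, ?_⟩) fun h => ⟨hC, ?_⟩ <;>
    simpa using h.compl_left
  · rintro C ⟨⟨hC, ⟨⟨a, ⟨ha1, ha2⟩, ha3⟩, ⟨b, ⟨hb1, hb2⟩, hb3⟩, _⟩⟩, _,
      ⟨⟨c, ⟨hc1, hc2⟩, hc3⟩, ⟨d, ⟨hd1, hd2⟩, hd3⟩, _⟩⟩
    exact ⟨⟨hC, ⟨a, ha1, ha3⟩, ⟨b, hb1, hb3⟩, ⟨c, hc1, hc3⟩, ⟨d, hd1, hd3⟩⟩,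
      ⟨hC, ⟨a, ha2, ha3⟩, ⟨b, hb2, hb3⟩, ⟨c, hc2, hc3⟩, ⟨d, hd2, hd3⟩⟩⟩
  · rintro ⟨_, _, ⟨x, ⟨_, hx1⟩, hx2⟩, _⟩
    exact hx2 hx1
  · rintro ⟨_, ⟨x, ⟨_, hx1⟩, hx2⟩, _⟩
    exact hx1 hx2

end Cuts

end FreeProductFix

namespace FreeProductFix

section Optimal

open Relation

variable {P : Type*}

/-- A set separating two ultrafilters. -/
def Separates (U : Set P) (ω ω' : Ultrafilter P) : Prop := ¬ (U ∈ ω ↔ U ∈ ω')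

/-- A set separating two ultrafilters with as few boundary edges as possible, and then crossing as
few small cuts as possible. -/
structure IsOptimal (r : P → P → Prop) (K : ℕ) (U : Set P) (ω ω' : Ultrafilter P) : Prop where
  sep : Separates U ω ω'
  fin : (edgeBoundary r U).Finite
  le : (edgeBoundary r U).ncard ≤ K
  min : ∀ W, Separates W ω ω' → (edgeBoundary r W).Finite →
    (edgeBoundary r U).ncard ≤ (edgeBoundary r W).ncard
  minCross : ∀ W, Separates W ω ω' → (edgeBoundary r W).Finite →
    (edgeBoundary r W).ncard = (edgeBoundary r U).ncard → crossNum r K U ≤ crossNum r K W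

/-- The sets which are optimal for some pair of ultrafilters. -/
def optimalCuts (r : P → P → Prop) (K : ℕ) : Set (Set P) :=
  {U | ∃ ω ω', IsOptimal r K U ω ω'}

variable {r : P → P → Prop} {K : ℕ} {U D : Set P} {ω ω' η η' : Ultrafilter P}

lemma separates_compl : Separates Uᶜ ω ω' ↔ Separates U ω ω' := by
  simp only [Separates, Ultrafilter.compl_mem_iff_notMem, not_iff_not]

lemma separates_inter : Separates (U ∩ D) ω ω' ↔ ¬ (U ∈ ω ∧ D ∈ ω ↔ U ∈ ω' ∧ D ∈ ω') := by
  simp only [Separates, ← Ultrafilter.mem_coe, Filter.inter_mem_iff]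

lemma IsOptimal.compl (h : IsOptimal r K U ω ω') : IsOptimal r K Uᶜ ω ω' where
  sep := separates_compl.mpr h.sep
  fin := by rw [edgeBoundary_compl]; exact h.fin
  le := by rw [edgeBoundary_compl]; exact h.le
  min := by rw [edgeBoundary_compl]; exact h.min
  minCross := by rw [edgeBoundary_compl, crossNum_compl]; exact h.minCross

lemma compl_mem_optimalCuts (h : U ∈ optimalCuts r K) : Uᶜ ∈ optimalCuts r K := by
  obtain ⟨ω, ω', h⟩ := h
  exact ⟨ω, ω', h.compl⟩

lemma exists_isOptimal (hU : Separates U ω ω') (hfin : (edgeBoundary r U).Finite)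
    (hK : (edgeBoundary r U).ncard ≤ K) : ∃ W, IsOptimal r K W ω ω' := by
  classical
  let S : Set (Set P) := {W | Separates W ω ω' ∧ (edgeBoundary r W).Finite}
  have hS : S.Nonempty := ⟨U, hU, hfin⟩
  obtain ⟨U₁, ⟨h1, h2⟩, h3⟩ : ∃ U₁ ∈ S, ∀ W ∈ S,
      (edgeBoundary r U₁).ncard ≤ (edgeBoundary r W).ncard := by
    obtain ⟨U₁, h1, h2⟩ := (measure fun W => (edgeBoundary r W).ncard).wf.has_min S hS
    exact ⟨U₁, h1, fun W hW => not_lt.mp (h2 W hW)⟩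
  let S' : Set (Set P) := {W ∈ S | (edgeBoundary r W).ncard = (edgeBoundary r U₁).ncard}
  have hS' : S'.Nonempty := ⟨U₁, ⟨h1, h2⟩, rfl⟩
  obtain ⟨U₂, ⟨⟨h4, h5⟩, h6⟩, h7⟩ : ∃ U₂ ∈ S', ∀ W ∈ S', crossNum r K U₂ ≤ crossNum r K W := by
    obtain ⟨U₁, h1, h2⟩ := (measure fun W => crossNum r K W).wf.has_min S' hS'
    exact ⟨U₁, h1, fun W hW => not_lt.mp (h2 W hW)⟩
  refine ⟨U₂, h4, h5, ?_, fun W h8 h9 => ?_, fun W h8 h9 h10 => ?_⟩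
  · rw [h6]
    exact (h3 U ⟨hU, hfin⟩).trans hK
  · rw [h6]
    exact h3 W ⟨h8, h9⟩
  · exact h7 W ⟨⟨h8, h9⟩, h10.trans h6⟩

lemma eq_empty_or_univ_of_edgeBoundary (hconn : ∀ x y, ReflTransGen r x y)
    (h : edgeBoundary r U = ∅) : U = ∅ ∨ U = Set.univ := by
  by_contra! hU
  obtain ⟨⟨x, hx⟩, hU2⟩ := hU
  obtain ⟨y, hy⟩ := (Set.ne_univ_iff_exists_notMem U).mp hU2
  obtain ⟨F, hF⟩ := exists_crossing_edges (hconn x y)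
  obtain ⟨e, _, he, he1, he2⟩ := hF U hx hy
  have : e ∈ edgeBoundary r U := ⟨he, by simp [he1, he2]⟩
  rw [h] at this
  exact this

lemma not_separates_univ : ¬ Separates Set.univ ω ω' := by
  have h : ∀ ω : Ultrafilter P, Set.univ ∈ ω := fun ω => Filter.univ_mem
  simp [Separates, h]

lemma IsOptimal.connIn (hsym : ∀ x y, r x y → r y x) (hconn : ∀ x y, ReflTransGen r x y)
    (h : IsOptimal r K U ω ω') : ConnIn r U := by
  intro a ha
  let A : Set P := {z | ReflTransGen (fun x y => r x y ∧ x ∈ U ∧ y ∈ U) a z}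
  have haA : a ∈ A := .refl
  have hAU : A ⊆ U := by
    intro z hz
    have hz' : ReflTransGen (fun x y => r x y ∧ x ∈ U ∧ y ∈ U) a z := hz
    rcases hz'.cases_tail with rfl | ⟨y, _, hy⟩
    exacts [ha, hy.2.2]
  have hstep : ∀ x y, r x y → x ∈ A → y ∈ U → y ∈ A := fun x y hxy hx hy =>
    ReflTransGen.tail hx ⟨hxy, hAU hx, hy⟩
  have hiff : ∀ x y, r x y → x ∈ U → y ∈ U → (x ∈ A ↔ y ∈ A) := fun x y hxy hx hy =>
    ⟨fun h => hstep x y hxy h hy, fun h => hstep y x (hsym x y hxy) h hx⟩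
  have hA : edgeBoundary r A ⊆ edgeBoundary r U := by
    rintro ⟨x, y⟩ ⟨he, h1⟩
    have h2 := hiff x y he
    have h3 := @hAU x
    have h4 := @hAU y
    refine ⟨he, fun h5 => ?_⟩
    simp only at h1 h5
    tauto
  have hB : edgeBoundary r (U \ A) ⊆ edgeBoundary r U := by
    rintro ⟨x, y⟩ ⟨he, h1⟩
    have h2 := hiff x y he
    refine ⟨he, fun h5 => ?_⟩
    simp only [Set.mem_sdiff] at h1 h5
    tauto
  have hAB : edgeBoundary r A ∩ edgeBoundary r (U \ A) = ∅ := by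
    rw [Set.eq_empty_iff_forall_notMem]
    rintro ⟨x, y⟩ ⟨⟨he, h1⟩, _, h6⟩
    have h2 := hiff x y he
    have h3 := @hAU x
    have h4 := @hAU y
    simp only [Set.mem_sdiff] at h1 h6
    tauto
  have hAf := h.fin.subset hA
  have hBf := h.fin.subset hB
  have hsum : (edgeBoundary r A).ncard + (edgeBoundary r (U \ A)).ncard ≤
      (edgeBoundary r U).ncard := by
    have := ncard_add_le (X := edgeBoundary r U) (Y := ∅) h.fin Set.finite_empty
      (by simpa using hA) (by simpa using hB) (by rw [hAB]; exact Set.empty_subset _)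
    simpa using this
  by_cases hsA : Separates A ω ω'
  · have h1 := h.min A hsA hAf
    have h2 : edgeBoundary r (U \ A) = ∅ := (Set.ncard_eq_zero hBf).mp (by omega)
    obtain h3 | h3 := eq_empty_or_univ_of_edgeBoundary hconn h2
    · intro b hb
      exact Set.sdiff_eq_empty.mp h3 hb
    · have : a ∈ U \ A := by rw [h3]; trivial
      exact absurd haA this.2
  · have hsB : Separates (U \ A) ω ω' := by
      have hs := h.sep
      have hU : U = (Aᶜ ∩ (U \ A)ᶜ)ᶜ := by
        ext x
        have := @hAU x
        simp only [Set.mem_compl_iff, Set.mem_inter_iff, Set.mem_sdiff]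
        tauto
      rw [hU, separates_compl, separates_inter] at hs
      simp only [Separates, Ultrafilter.compl_mem_iff_notMem] at hs hsA ⊢
      tauto
    have h1 := h.min _ hsB hBf
    have h2 : edgeBoundary r A = ∅ := (Set.ncard_eq_zero hAf).mp (by omega)
    obtain h3 | h3 := eq_empty_or_univ_of_edgeBoundary hconn h2
    · rw [h3] at haA
      exact absurd haA (Set.notMem_empty a)
    · rw [h3, Set.univ_subset_iff] at hAU
      exact absurd (hAU ▸ h.sep) not_separates_univ

lemma IsOptimal.nonempty (h : IsOptimal r K U ω ω') : U.Nonempty := by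
  rw [Set.nonempty_iff_ne_empty]
  rintro rfl
  have := h.compl.sep
  rw [Set.compl_empty] at this
  exact not_separates_univ this

lemma IsOptimal.mem_cuts (hsym : ∀ x y, r x y → r y x) (hconn : ∀ x y, ReflTransGen r x y)
    (h : IsOptimal r K U ω ω') : U ∈ cuts r K :=
  ⟨h.nonempty, h.compl.nonempty, h.connIn hsym hconn, h.compl.connIn hsym hconn, h.fin, h.le⟩

lemma IsOptimal.not_separates_corners (hDc : D ∈ cuts r K) (hU : IsOptimal r K U ω ω')
    (hD : IsOptimal r K D η η') (hUD : Cross U D) (h1 : Separates (U ∩ D) ω ω')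
    (h2 : Separates (Uᶜ ∩ Dᶜ) η η') : False := by
  have hf1 := finite_edgeBoundary_corner hU.fin hD.fin
  have hf2 := finite_edgeBoundary_corner hU.compl.fin hD.compl.fin
  have h3 := hU.min _ h1 hf1
  have h4 := hD.min _ h2 hf2
  have h5 := ncard_edgeBoundary_corners hU.fin hD.fin
  have h6 := crossNum_corners hU.fin hD.fin hDc hUD
  have h7 := hU.minCross _ h1 hf1 (by omega)
  have h8 := hD.minCross _ h2 hf2 (by omega)
  omega

lemma IsOptimal.not_separates_all_corners (hDc : D ∈ cuts r K) (hU : IsOptimal r K U ω ω')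
    (hD : IsOptimal r K D η η') (hUD : Cross U D) (h1 : Separates (U ∩ D) ω ω')
    (h2 : Separates (Uᶜ ∩ Dᶜ) ω ω') (h3 : Separates (Uᶜ ∩ D) η η')
    (h4 : Separates (U ∩ Dᶜ) η η') : False := by
  have hf1 := finite_edgeBoundary_corner hU.fin hD.fin
  have hf2 := finite_edgeBoundary_corner hU.compl.fin hD.compl.fin
  have hf3 := finite_edgeBoundary_corner hU.compl.fin hD.fin
  have hf4 := finite_edgeBoundary_corner hU.fin hD.compl.fin
  have h5 := ncard_edgeBoundary_corners hU.fin hD.fin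
  have h6 := ncard_edgeBoundary_corners hU.compl.fin hD.fin
  have h7 := crossNum_corners hU.fin hD.fin hDc hUD
  have h8 := crossNum_corners hU.compl.fin hD.fin hDc hUD.compl_left
  rw [compl_compl] at h6 h8
  rw [edgeBoundary_compl] at h6
  rw [crossNum_compl] at h8
  have h9 := hU.min _ h1 hf1
  have h10 := hU.min _ h2 hf2
  have h11 := hD.min _ h3 hf3
  have h12 := hD.min _ h4 hf4
  have h13 := hU.minCross _ h1 hf1 (by omega)
  have h14 := hU.minCross _ h2 hf2 (by omega)
  have h15 := hD.minCross _ h3 hf3 (by omega)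
  have h16 := hD.minCross _ h4 hf4 (by omega)
  omega

lemma IsOptimal.not_cross (hDc : D ∈ cuts r K) (hU : IsOptimal r K U ω ω')
    (hD : IsOptimal r K D η η') : ¬ Cross U D := by
  intro h
  have hDc2 := compl_mem_cuts hDc
  have c1 := hU.not_separates_corners hDc hD h
  have c2 := hU.compl.not_separates_corners hDc hD h.compl_left
  have c3 := hU.not_separates_corners hDc2 hD.compl h.compl_right
  have c4 := hU.compl.not_separates_corners hDc2 hD.compl h.compl_left.compl_right
  have c5 := hU.not_separates_all_corners hDc hD h
  have c6 := hU.not_separates_all_corners hDc2 hD.compl h.compl_right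
  have s1 := hU.sep
  have s2 := hD.sep
  simp only [separates_inter, compl_compl, Ultrafilter.compl_mem_iff_notMem] at c1 c2 c3 c4 c5 c6
  simp only [Separates] at s1 s2
  clear hDc hDc2 hU hD h
  generalize (U ∈ ω) = u at *
  generalize (U ∈ ω') = u' at *
  generalize (D ∈ ω) = d at *
  generalize (D ∈ ω') = d' at *
  generalize (U ∈ η) = x at *
  generalize (U ∈ η') = x' at *
  generalize (D ∈ η) = y at *
  generalize (D ∈ η') = y' at *
  by_cases h1 : u <;> by_cases h2 : u' <;> by_cases h3 : y <;> by_cases h4 : y' <;>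
    simp only [h1, h2, h3, h4, iff_self, not_true_eq_false] at s1 s2 <;>
    by_cases h5 : d <;> by_cases h6 : d' <;> by_cases h7 : x <;> by_cases h8 : x' <;>
    simp [h1, h2, h3, h4, h5, h6, h7, h8] at c1 c2 c3 c4 c5 c6

lemma optimalCuts_subset (hsym : ∀ x y, r x y → r y x) (hconn : ∀ x y, ReflTransGen r x y) :
    optimalCuts r K ⊆ cuts r K := by
  rintro U ⟨ω, ω', h⟩
  exact h.mem_cuts hsym hconn

lemma optimalCuts_nested (hsym : ∀ x y, r x y → r y x) (hconn : ∀ x y, ReflTransGen r x y)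
    (hU : U ∈ optimalCuts r K) (hD : D ∈ optimalCuts r K) :
    U ⊆ D ∨ U ⊆ Dᶜ ∨ Uᶜ ⊆ D ∨ Uᶜ ⊆ Dᶜ := by
  have hDc := optimalCuts_subset hsym hconn hD
  obtain ⟨ω, ω', hU⟩ := hU
  obtain ⟨η, η', hD⟩ := hD
  have h := hU.not_cross hDc hD
  contrapose! h
  obtain ⟨h1, h2, h3, h4⟩ := h
  rw [Set.not_subset] at h1 h2 h3 h4
  simp only [Set.mem_compl_iff, not_not] at h1 h2 h3 h4
  exact ⟨h2, h1, h4, h3⟩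

end Optimal

end FreeProductFix

namespace FreeProductFix

open scoped Pointwise

section StructureTree

variable {P : Type*} [Group P]

open Classical in
/-- The tree dual to a nested family of subsets of a group, subdivided so that the group acts
without inversions. -/
noncomputable def structureTree (O : SubMulAction P (Set P)) (hcompl : ∀ U ∈ O, Uᶜ.Nonempty)
    (hstab : ∀ U ∈ O, ∀ g : P, g • U = U → g = 1) : TreeAction P (Set (Set P)) O where
  src U := {W | W ∈ O ∧ (U.1 ⊂ W ∨ U.1ᶜ ⊂ W)}
  tgt U := {W | W ∈ O ∧ (U.1 ⊆ W ∨ U.1ᶜ ⊂ W)}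
  side U τ := if U.1 ∈ τ then 1 else 0
  src_smul g U := by
    ext W
    rw [Set.mem_smul_set_iff_inv_smul_mem]
    have hW : g⁻¹ • W ∈ O ↔ W ∈ O :=
      ⟨fun h => by simpa using O.smul_mem g h, fun h => O.smul_mem g⁻¹ h⟩
    simp only [Set.mem_ofPred_eq, hW, ssubset_iff_subset_ne,
      SubMulAction.val_smul, ← Set.smul_set_compl, ne_eq, eq_inv_smul_iff,
      Set.subset_smul_set_iff, inv_inv]
  tgt_smul g U := by
    ext W
    rw [Set.mem_smul_set_iff_inv_smul_mem]
    have hW : g⁻¹ • W ∈ O ↔ W ∈ O :=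
      ⟨fun h => by simpa using O.smul_mem g h, fun h => O.smul_mem g⁻¹ h⟩
    simp only [Set.mem_ofPred_eq, hW, ssubset_iff_subset_ne,
      SubMulAction.val_smul, ← Set.smul_set_compl, ne_eq, eq_inv_smul_iff,
      Set.subset_smul_set_iff, inv_inv]
  side_smul g U τ := by
    refine if_congr ?_ rfl rfl
    rw [SubMulAction.val_smul, Set.smul_mem_smul_set_iff]
  side_self U := by
    rw [if_pos ⟨U.2, Or.inl subset_rfl⟩, if_neg]
    · rfl
    · rintro ⟨_, h | h⟩
      · exact h.2 subset_rfl
      · obtain ⟨x, hx⟩ := hcompl U.1 U.2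
        exact hx (h.1 hx)
  side_ne U W h := by
    have : U.1 ∈ {D | D ∈ O ∧ (W.1 ⊆ D ∨ W.1ᶜ ⊂ D)} ↔ U.1 ∈ {D | D ∈ O ∧ (W.1 ⊂ D ∨ W.1ᶜ ⊂ D)} := by
      refine and_congr Iff.rfl (or_congr ?_ Iff.rfl)
      rw [ssubset_iff_subset_ne]
      exact ⟨fun h1 => ⟨h1, fun h2 => h (Subtype.ext h2.symm)⟩, fun h1 => h1.1⟩
    simp only [this]
    congr
  free g U h := hstab U.1 U.2 g (congrArg Subtype.val h)

/-- A choice of one side of each cut, compatible with inclusions. -/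
structure IsOrientation (O : Set (Set P)) (τ : Set (Set P)) : Prop where
  subset : τ ⊆ O
  mem_iff : ∀ U ∈ O, (U ∈ τ ↔ Uᶜ ∉ τ)
  up : ∀ U ∈ τ, ∀ W ∈ O, U ⊆ W → W ∈ τ

omit [Group P] in
lemma isOrientation_principal {O : Set (Set P)} (hO : ∀ U ∈ O, Uᶜ ∈ O) (x : P) :
    IsOrientation O {W | W ∈ O ∧ x ∈ W} where
  subset _ h := h.1
  mem_iff U hU := by
    simp only [Set.mem_ofPred_eq, hU, hO U hU, true_and, Set.mem_compl_iff, not_not]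
  up U hU W hW h := ⟨hW, h hU.2⟩

variable {O : SubMulAction P (Set P)} {hcompl : ∀ U ∈ O, Uᶜ.Nonempty}
  {hstab : ∀ U ∈ O, ∀ g : P, g • U = U → g = 1}

lemma reach_flip (hO : ∀ U ∈ O, Uᶜ ∈ O) {F : Set O} {U : Set P} (hU : U ∈ O)
    (h1 : (⟨U, hU⟩ : O) ∈ F) (h2 : (⟨Uᶜ, hO U hU⟩ : O) ∈ F) :
    (structureTree O hcompl hstab).Reach F ((structureTree O hcompl hstab).tgt ⟨U, hU⟩)
      ((structureTree O hcompl hstab).tgt ⟨Uᶜ, hO U hU⟩) := by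
  refine .tail (.single ⟨_, h1, Or.inr ⟨rfl, rfl⟩⟩) ⟨_, h2, Or.inl ⟨?_, rfl⟩⟩
  ext W
  change (W ∈ O ∧ (Uᶜ ⊂ W ∨ Uᶜᶜ ⊂ W)) ↔ (W ∈ O ∧ (U ⊂ W ∨ Uᶜ ⊂ W))
  rw [compl_compl, or_comm]

lemma eq_tgt_of_minimal (hO : ∀ U ∈ O, Uᶜ ∈ O)
    (hnest : ∀ U ∈ O, ∀ D ∈ O, U ⊆ D ∨ U ⊆ Dᶜ ∨ Uᶜ ⊆ D ∨ Uᶜ ⊆ Dᶜ) {τ : Set (Set P)}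
    (hτ : IsOrientation (O : Set (Set P)) τ) {U : Set P} (hU : U ∈ τ)
    (hmin : ∀ W ∈ τ, W ⊆ U → W = U) :
    τ = (structureTree O hcompl hstab).tgt ⟨U, hτ.subset hU⟩ := by
  have hUO : U ∈ O := hτ.subset hU
  have hUc := (hτ.mem_iff U hUO).mp hU
  ext W
  change W ∈ τ ↔ W ∈ O ∧ (U ⊆ W ∨ Uᶜ ⊂ W)
  constructor
  · intro hW
    have hWO : W ∈ O := hτ.subset hW
    refine ⟨hWO, ?_⟩
    rcases hnest U hUO W hWO with h | h | h | h
    · exact Or.inl h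
    · exact absurd (hτ.up U hU Wᶜ (hO W hWO) h) ((hτ.mem_iff W hWO).mp hW)
    · refine Or.inr (ssubset_iff_subset_ne.mpr ⟨h, ?_⟩)
      rintro rfl
      exact hUc hW
    · exact Or.inl (hmin W hW (Set.compl_subset_compl.mp h)).ge
  · rintro ⟨hWO, h | h⟩
    · exact hτ.up U hU W hWO h
    · rw [hτ.mem_iff W hWO]
      intro hWc
      have h1 := hmin _ hWc (Set.compl_subset_comm.mp h.1)
      refine h.2 ?_
      rw [← h1, compl_compl]

lemma reach_of_finite_sdiff (hO : ∀ U ∈ O, Uᶜ ∈ O)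
    (hnest : ∀ U ∈ O, ∀ D ∈ O, U ⊆ D ∨ U ⊆ Dᶜ ∨ Uᶜ ⊆ D ∨ Uᶜ ⊆ Dᶜ) {τ σ : Set (Set P)}
    (hτ : IsOrientation (O : Set (Set P)) τ) (hσ : IsOrientation (O : Set (Set P)) σ)
    (hfin : (τ \ σ).Finite) {F : Set O}
    (hF : ∀ U (hU : U ∈ O), U ∈ τ \ σ → (⟨U, hU⟩ : O) ∈ F ∧ (⟨Uᶜ, hO U hU⟩ : O) ∈ F) :
    (structureTree O hcompl hstab).Reach F τ σ := by
  obtain ⟨k, hk⟩ : ∃ k, (τ \ σ).ncard = k := ⟨_, rfl⟩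
  induction k generalizing τ with
  | zero =>
    rw [Set.ncard_eq_zero hfin, Set.sdiff_eq_empty] at hk
    have : τ = σ := by
      refine Set.Subset.antisymm hk fun U hU => ?_
      have hUO := hσ.subset hU
      rw [hτ.mem_iff U hUO]
      exact fun h => (hσ.mem_iff U hUO).mp hU (hk h)
    rw [this]
    exact .refl
  | succ k ih =>
    have hnonempty : (τ \ σ).Nonempty := by
      rw [← Set.ncard_pos hfin]
      omega
    obtain ⟨U, hU⟩ := hfin.exists_minimal hnonempty
    obtain ⟨⟨hUτ, hUσ⟩, hUm⟩ := hU
    have hmin : ∀ W ∈ τ, W ⊆ U → W = U := by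
      intro W hW hWU
      refine Set.Subset.antisymm hWU (hUm ⟨hW, fun h => ?_⟩ hWU)
      exact hUσ (hσ.up W h U (hτ.subset hUτ) hWU)
    have hUO : U ∈ O := hτ.subset hUτ
    have hUcτ := (hτ.mem_iff U hUO).mp hUτ
    have hUcσ : Uᶜ ∈ σ := by
      by_contra h
      exact hUσ ((hσ.mem_iff U hUO).mpr h)
    have h1 := eq_tgt_of_minimal (hcompl := hcompl) (hstab := hstab) hO hnest hτ hUτ hmin
    have h2 := reach_flip (hcompl := hcompl) (hstab := hstab) hO hUO (hF U hUO ⟨hUτ, hUσ⟩).1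
      (hF U hUO ⟨hUτ, hUσ⟩).2
    rw [← h1] at h2
    have hUne : U ≠ Uᶜ := fun h => hUcτ (h ▸ hUτ)
    have hmem : ∀ W, W ∈ (structureTree O hcompl hstab).tgt ⟨Uᶜ, hO U hUO⟩ ↔
        W = Uᶜ ∨ (W ∈ τ ∧ W ≠ U) := by
      intro W
      have h3 : W ∈ τ ↔ W ∈ O ∧ (U ⊆ W ∨ Uᶜ ⊂ W) := by
        rw [h1]
        rfl
      rw [h3]
      change W ∈ O ∧ (Uᶜ ⊆ W ∨ Uᶜᶜ ⊂ W) ↔ _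
      rw [compl_compl]
      have h4 : ¬ Uᶜ ⊆ U := by
        intro h
        obtain ⟨x, hx⟩ := hcompl U hUO
        exact hx (h hx)
      constructor
      · rintro ⟨h5, h6 | h6⟩
        · rcases eq_or_ne W Uᶜ with h7 | h7
          · exact Or.inl h7
          · refine Or.inr ⟨⟨h5, Or.inr (ssubset_iff_subset_ne.mpr ⟨h6, h7.symm⟩)⟩, ?_⟩
            rintro rfl
            exact h4 h6
        · exact Or.inr ⟨⟨h5, Or.inl h6.1⟩, h6.ne.symm⟩
      · rintro (rfl | ⟨⟨h5, h6 | h6⟩, h7⟩)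
        · exact ⟨hO U hUO, Or.inl subset_rfl⟩
        · exact ⟨h5, Or.inr (ssubset_iff_subset_ne.mpr ⟨h6, h7.symm⟩)⟩
        · exact ⟨h5, Or.inl h6.1⟩
    have hsd : (structureTree O hcompl hstab).tgt ⟨Uᶜ, hO U hUO⟩ \ σ = (τ \ σ) \ {U} := by
      ext W
      simp only [Set.mem_sdiff, hmem, Set.mem_singleton_iff]
      constructor
      · rintro ⟨rfl | h, h3⟩
        · exact absurd hUcσ h3
        · exact ⟨⟨h.1, h3⟩, h.2⟩
      · rintro ⟨⟨h3, h4⟩, h5⟩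
        exact ⟨Or.inr ⟨h3, h5⟩, h4⟩
    have hor : IsOrientation (O : Set (Set P)) ((structureTree O hcompl hstab).tgt ⟨Uᶜ, hO U hUO⟩) := by
      refine ⟨fun W hW => hW.1, fun W hW => ?_, fun V hV W hW hVW => ?_⟩
      · rw [hmem, hmem]
        have h3 := hτ.mem_iff W hW
        have h4 : Wᶜ = Uᶜ ↔ W = U := compl_inj_iff
        have h5 : Wᶜ = U ↔ W = Uᶜ := compl_eq_comm.trans eq_comm
        rw [h4, ne_eq, ne_eq, h5]
        by_cases h6 : W = U
        · subst h6
          simp [hUne]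
        · by_cases h7 : W = Uᶜ
          · simp [h7, hUne.symm]
          · simp [h6, h7, h3]
      · rw [hmem] at hV ⊢
        rcases hV with rfl | ⟨hV, hVU⟩
        · by_cases h3 : W = Uᶜ
          · exact Or.inl h3
          right
          constructor
          · rw [hτ.mem_iff W hW]
            intro h4
            have h5 := hmin _ h4 (Set.compl_subset_comm.mp hVW)
            exact h3 (by rw [← h5, compl_compl])
          · rintro rfl
            obtain ⟨x, hx⟩ := hcompl W hUO
            exact hx (hVW hx)
        · refine Or.inr ⟨hτ.up V hV W hW hVW, ?_⟩
          rintro rfl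
          exact hVU (hmin V hV hVW)
    refine Relation.ReflTransGen.trans h2 (ih hor ?_ ?_ ?_)
    · rw [hsd]
      exact hfin.subset Set.sdiff_subset
    · intro W hW hWm
      rw [hsd] at hWm
      exact hF W hW hWm.1
    · rw [hsd, Set.ncard_sdiff_singleton_of_mem (show U ∈ τ \ σ from ⟨hUτ, hUσ⟩)]
      omega

lemma not_mem_or_compl_not_mem_of_reach (hne : ∀ U ∈ O, U.Nonempty)
    {F : Set O} {x : P} {w : Set (Set P)}
    (h : (structureTree O hcompl hstab).Reach F {W | W ∈ O ∧ x ∈ W} w) {U : Set P} :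
    U ∉ w ∨ Uᶜ ∉ w := by
  have key : ∀ V : O, ¬ (U ∈ (structureTree O hcompl hstab).tgt V ∧
      Uᶜ ∈ (structureTree O hcompl hstab).tgt V) := by
    rintro ⟨V, hV⟩ ⟨⟨h1, h2⟩, h3, h4⟩
    change V ⊆ U ∨ Vᶜ ⊂ U at h2
    change V ⊆ Uᶜ ∨ Vᶜ ⊂ Uᶜ at h4
    obtain ⟨x, hx⟩ := hne V hV
    obtain ⟨y, hy⟩ := hcompl V hV
    rcases h2 with h2 | h2 <;> rcases h4 with h4 | h4
    · exact h4 hx (h2 hx)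
    · exact h4.2 (Set.compl_subset_compl.mpr h2)
    · refine h2.2 ?_
      rw [← compl_compl U]
      exact Set.compl_subset_compl.mpr h4
    · exact h4.1 hy (h2.1 hy)
  by_contra! hw
  rcases h.cases_tail with rfl | ⟨v, _, V, _, ⟨_, rfl⟩ | ⟨rfl, _⟩⟩
  · exact hw.2.2 hw.1.2
  · exact key V hw
  · obtain ⟨⟨h1, h2⟩, h3, h4⟩ := hw
    exact key V ⟨⟨h1, h2.imp_left fun h => h.1⟩, ⟨h3, h4.imp_left fun h => h.1⟩⟩

end StructureTree

end FreeProductFix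

namespace FreeProductFix

open scoped Pointwise
open Relation

section Invariance

variable {P : Type*} {r : P → P → Prop} {K : ℕ} {U : Set P} (f : P ≃ P)
  (hf : ∀ x y, r (f x) (f y) ↔ r x y)

include hf

lemma edgeBoundary_preimage : edgeBoundary r (f ⁻¹' U) = f.prodCongr f ⁻¹' edgeBoundary r U := by
  ext ⟨x, y⟩
  simp [edgeBoundary, hf]

lemma finite_edgeBoundary_preimage (h : (edgeBoundary r U).Finite) :
    (edgeBoundary r (f ⁻¹' U)).Finite := by
  rw [edgeBoundary_preimage f hf]
  exact h.preimage (Equiv.injective _).injOn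

lemma ncard_edgeBoundary_preimage :
    (edgeBoundary r (f ⁻¹' U)).ncard = (edgeBoundary r U).ncard := by
  rw [edgeBoundary_preimage f hf]
  exact Set.ncard_preimage_of_injective_subset_range (Equiv.injective _) (by simp)

lemma ConnIn.preimage (h : ConnIn r U) : ConnIn r (f ⁻¹' U) := by
  intro a ha b hb
  have h1 := h (f a) ha (f b) hb
  have h2 : ReflTransGen (fun x y => r x y ∧ x ∈ f ⁻¹' U ∧ y ∈ f ⁻¹' U) (f.symm (f a))
      (f.symm (f b)) := by
    refine ReflTransGen.lift f.symm ?_ _ _ h1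
    rintro x y ⟨h3, h4, h5⟩
    refine ⟨?_, by simpa using h4, by simpa using h5⟩
    rw [← hf]
    simpa using h3
  simpa using h2

lemma preimage_mem_cuts (h : U ∈ cuts r K) : f ⁻¹' U ∈ cuts r K := by
  obtain ⟨h1, h2, h3, h4, h5, h6⟩ := h
  refine ⟨h1.preimage f.surjective, ?_, h3.preimage f hf, ?_,
    finite_edgeBoundary_preimage f hf h5, ?_⟩
  · rw [← Set.preimage_compl]
    exact h2.preimage f.surjective
  · rw [← Set.preimage_compl]
    exact h4.preimage f hf
  · rwa [ncard_edgeBoundary_preimage f hf]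

lemma symm_preserves : ∀ x y, r (f.symm x) (f.symm y) ↔ r x y := by
  intro x y
  rw [← hf]
  simp

omit hf in
lemma Cross.preimage {D : Set P} (h : Cross U D) : Cross (f ⁻¹' U) (f ⁻¹' D) := by
  obtain ⟨h1, h2, h3, h4⟩ := h
  exact ⟨h1.preimage f.surjective, h2.preimage f.surjective, h3.preimage f.surjective,
    h4.preimage f.surjective⟩

omit hf in
lemma preimage_symm_preimage' : f.symm ⁻¹' (f ⁻¹' U) = U := by
  ext x
  simp

omit hf in
lemma preimage_preimage_symm' : f ⁻¹' (f.symm ⁻¹' U) = U := by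
  ext x
  simp

lemma crossNum_preimage : crossNum r K (f ⁻¹' U) = crossNum r K U := by
  have : {D ∈ cuts r K | Cross (f ⁻¹' U) D} =
      (fun D => f ⁻¹' D) '' {D ∈ cuts r K | Cross U D} := by
    ext D
    constructor
    · rintro ⟨hD, h⟩
      refine ⟨f.symm ⁻¹' D, ⟨preimage_mem_cuts _ (symm_preserves f hf) hD, ?_⟩,
        preimage_preimage_symm' f⟩
      have := h.preimage f.symm
      rwa [preimage_symm_preimage'] at this
    · rintro ⟨D, ⟨hD, h⟩, rfl⟩
      exact ⟨preimage_mem_cuts f hf hD, h.preimage f⟩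
  rw [crossNum, this, Set.ncard_image_of_injective _ (Set.preimage_injective.mpr f.surjective)]
  rfl

lemma preimage_mem_optimalCuts (h : U ∈ optimalCuts r K) : f ⁻¹' U ∈ optimalCuts r K := by
  obtain ⟨ω, ω', h⟩ := h
  have hs := symm_preserves f hf
  have hsep : ∀ W, Separates W (ω.map f.symm) (ω'.map f.symm) ↔ Separates (f.symm ⁻¹' W) ω ω' :=
    fun W => by simp only [Separates, Ultrafilter.mem_map]
  refine ⟨ω.map f.symm, ω'.map f.symm, ?_, finite_edgeBoundary_preimage f hf h.fin, ?_,
    fun W h1 h2 => ?_, fun W h1 h2 h3 => ?_⟩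
  · rw [hsep, preimage_symm_preimage']
    exact h.sep
  · rw [ncard_edgeBoundary_preimage f hf]
    exact h.le
  · have := h.min _ ((hsep W).mp h1) (finite_edgeBoundary_preimage _ hs h2)
    rwa [ncard_edgeBoundary_preimage _ hs, ← ncard_edgeBoundary_preimage f hf] at this
  · rw [ncard_edgeBoundary_preimage f hf] at h3
    have := h.minCross _ ((hsep W).mp h1) (finite_edgeBoundary_preimage _ hs h2)
      ((ncard_edgeBoundary_preimage _ hs).trans h3)
    rwa [crossNum_preimage _ hs, ← crossNum_preimage f hf] at this

end Invariance

section Cayley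

variable {P : Type*} [Group P]

/-- Adjacency in the Cayley graph. -/
def cayley (S : Set P) (x y : P) : Prop := x⁻¹ * y ∈ S

variable {S : Set P}

lemma cayley_symm (hS : ∀ s ∈ S, s⁻¹ ∈ S) (x y : P) (h : cayley S x y) : cayley S y x := by
  have := hS _ h
  rwa [mul_inv_rev, inv_inv] at this

lemma reflTransGen_symm {α : Type*} {r : α → α → Prop} (hr : ∀ x y, r x y → r y x) {x y : α}
    (h : ReflTransGen r x y) : ReflTransGen r y x := by
  induction h with
  | refl => exact .refl
  | tail _ h ih => exact ih.head (hr _ _ h)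

lemma cayley_connected (hS : ∀ s ∈ S, s⁻¹ ∈ S) (hgen : Subgroup.closure S = ⊤) (x y : P) :
    ReflTransGen (cayley S) x y := by
  have key : ∀ g : P, ∀ x, ReflTransGen (cayley S) x (x * g) := by
    intro g
    have hg : g ∈ Subgroup.closure S := by rw [hgen]; trivial
    induction hg using Subgroup.closure_induction with
    | mem g hg => exact fun x => .single (by simpa [cayley] using hg)
    | one => exact fun x => by rw [mul_one]
    | mul g h _ _ h1 h2 => exact fun x => by rw [← mul_assoc]; exact (h1 x).trans (h2 _)
    | inv g _ h1 =>
      intro x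
      have := h1 (x * g⁻¹)
      rw [inv_mul_cancel_right] at this
      exact reflTransGen_symm (cayley_symm hS) this
  have := key (x⁻¹ * y) x
  rwa [mul_inv_cancel_left] at this

lemma smul_mem_optimalCuts {K : ℕ} (g : P) {U : Set P} (hU : U ∈ optimalCuts (cayley S) K) :
    g • U ∈ optimalCuts (cayley S) K := by
  have h := preimage_mem_optimalCuts (Equiv.mulLeft g⁻¹) (fun x y => by simp [cayley, mul_assoc]) hU
  convert h
  ext x
  rw [Set.mem_smul_set_iff_inv_smul_mem]
  rfl

lemma stabilizer_cut_eq_one (htf : ∀ g : P, ∀ k : ℕ, k ≠ 0 → g ^ k = 1 → g = 1) {K : ℕ}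
    (hconn : ∀ x y, ReflTransGen (cayley S) x y) {U : Set P} (hU : U ∈ cuts (cayley S) K) (g : P)
    (hg : g • U = U) : g = 1 := by
  obtain ⟨h1, h2, _, _, h5, _⟩ := hU
  obtain ⟨e, he⟩ : (edgeBoundary (cayley S) U).Nonempty := by
    rw [Set.nonempty_iff_ne_empty]
    intro h
    obtain h | h := eq_empty_or_univ_of_edgeBoundary hconn h
    · exact h1.ne_empty h
    · rw [h, Set.compl_univ] at h2
      exact h2.ne_empty rfl
  have hmem : ∀ x, g * x ∈ U ↔ x ∈ U := by
    intro x
    nth_rewrite 1 [← hg]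
    exact Set.smul_mem_smul_set_iff
  have hpow : ∀ (k : ℕ) x, g ^ k * x ∈ U ↔ x ∈ U := by
    intro k
    induction k with
    | zero => simp
    | succ k ih => intro x; rw [pow_succ, mul_assoc, ih, hmem]
  have hrange : ∀ k : ℕ, (g ^ k * e.1, g ^ k * e.2) ∈ edgeBoundary (cayley S) U := by
    intro k
    refine ⟨?_, ?_⟩
    · change (g ^ k * e.1)⁻¹ * (g ^ k * e.2) ∈ S
      have : (g ^ k * e.1)⁻¹ * (g ^ k * e.2) = e.1⁻¹ * e.2 := by group
      rw [this]
      exact he.1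
    · rw [hpow, hpow]
      exact he.2
  by_contra hg1
  refine Set.infinite_range_of_injective (f := fun k : ℕ => (g ^ k * e.1, g ^ k * e.2)) ?_
    (h5.subset (Set.range_subset_iff.mpr hrange))
  intro i j hij
  have h3 : g ^ i = g ^ j := mul_right_cancel (congrArg Prod.fst hij)
  by_contra hne
  rcases lt_or_gt_of_ne hne with h | h
  · refine hg1 (htf g (j - i) (by omega) ?_)
    rw [pow_sub g h.le, h3, mul_inv_cancel]
  · refine hg1 (htf g (i - j) (by omega) ?_)
    rw [pow_sub g h.le, h3, mul_inv_cancel]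

/-- The optimal cuts of a Cayley graph, with the translation action. -/
def optimalCutsAction (S : Set P) (K : ℕ) : SubMulAction P (Set P) where
  carrier := optimalCuts (cayley S) K
  smul_mem' g _ hU := smul_mem_optimalCuts g hU

lemma preimage_eq_of_nested {O : Set (Set P)}
    (hnest : ∀ U ∈ O, ∀ D ∈ O, U ⊆ D ∨ U ⊆ Dᶜ ∨ Uᶜ ⊆ D ∨ Uᶜ ⊆ Dᶜ) (α : P →* P) {m : ℕ}
    (hm : m ≠ 0) (hα : ∀ g, α^[m] g = g) (hOα : ∀ U ∈ O, α ⁻¹' U ∈ O) {h : P} (hh : α h = h)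
    {U : Set P} (hU : U ∈ O) (h1 : 1 ∈ U) (h2 : h ∉ U) : α ⁻¹' U = U := by
  obtain ⟨k, rfl⟩ := Nat.exists_eq_succ_of_ne_zero hm
  have hα' : ∀ g, α^[k] (α g) = g := fun g => by rw [← Function.iterate_succ_apply]; exact hα g
  have h3 : (1 : P) ∈ α ⁻¹' U := by simpa using h1
  have h4 : h ∉ α ⁻¹' U := by simpa [hh] using h2
  have hcases : U ⊆ α ⁻¹' U ∨ α ⁻¹' U ⊆ U := by
    rcases hnest U hU _ (hOα U hU) with h | h | h | h'
    · exact Or.inl h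
    · exact absurd h3 (h h1)
    · exact absurd (h h2) h4
    · exact Or.inr (Set.compl_subset_compl.mp h')
  rcases hcases with hc | hc
  · refine Set.Subset.antisymm (fun x hx => ?_) hc
    have key : ∀ j : ℕ, ∀ y ∈ U, α^[j] y ∈ U := by
      intro j
      induction j with
      | zero => exact fun y hy => hy
      | succ j ih => exact fun y hy => ih _ (hc hy)
    have := key k _ hx
    rwa [hα'] at this
  · refine Set.Subset.antisymm hc fun x hx => ?_
    have key : ∀ j : ℕ, ∀ y, α^[j] y ∈ U → y ∈ U := by
      intro j
      induction j with
      | zero => exact fun y hy => hy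
      | succ j ih => exact fun y hy => hc (ih _ hy)
    refine key k _ ?_
    rwa [hα']

end Cayley

end FreeProductFix

namespace FreeProductFix

open scoped Pointwise
open Relation

section FiniteOrder

variable {P : Type*} [Group P]

lemma smul_principal {O : SubMulAction P (Set P)} (g x : P) :
    g • {W : Set P | W ∈ O ∧ x ∈ W} = {W : Set P | W ∈ O ∧ g * x ∈ W} := by
  ext W
  rw [Set.mem_smul_set_iff_inv_smul_mem]
  have hW : g⁻¹ • W ∈ O ↔ W ∈ O :=
    ⟨fun h => by simpa using O.smul_mem g h, fun h => O.smul_mem g⁻¹ h⟩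
  simp only [Set.mem_ofPred_eq, hW, Set.mem_inv_smul_set_iff, smul_eq_mul]

/-- The fixed subgroup of an automorphism of finite order is generated by cyclic subgroups and by
subgroups which are not cut into two infinite pieces by an optimal cut. -/
theorem exists_uncut_pieces [Countable P]
    (htf : ∀ g : P, ∀ k : ℕ, k ≠ 0 → g ^ k = 1 → g = 1) (α : P →* P) {m : ℕ} (hm : m ≠ 0)
    (hα : ∀ g, α^[m] g = g) {n : ℕ} (D : Fin n → Subgroup P)
    (hcomm : ∀ i, ∀ a ∈ D i, ∀ b ∈ D i, a * b = b * a) (hD : ⨆ i, D i = ⊤)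
    {S : Set P} (hS : ∀ s ∈ S, s⁻¹ ∈ S) (hαS : ∀ s, α s ∈ S ↔ s ∈ S)
    (hgen : Subgroup.closure S = ⊤) (K : ℕ) :
    ∃ D : Fin n → Subgroup P, fixedSubgroup α = ⨆ i, D i ∧
      ∀ i, (∀ U ∈ optimalCuts (cayley S) K, ((D i : Set P) ∩ U).Finite ∨
        ((D i : Set P) ∩ Uᶜ).Finite) ∨ ∃ g, D i = Subgroup.zpowers g := by
  have hsym := cayley_symm hS
  have hconn := cayley_connected hS hgen
  have hcuts := optimalCuts_subset (K := K) hsym hconn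
  have hnest : ∀ U ∈ optimalCutsAction S K, ∀ D ∈ optimalCutsAction S K,
      U ⊆ D ∨ U ⊆ Dᶜ ∨ Uᶜ ⊆ D ∨ Uᶜ ⊆ Dᶜ :=
    fun U hU D hD => optimalCuts_nested hsym hconn hU hD
  have hO : ∀ U ∈ optimalCutsAction S K, Uᶜ ∈ optimalCutsAction S K :=
    fun U hU => compl_mem_optimalCuts hU
  have hcompl : ∀ U ∈ optimalCutsAction S K, Uᶜ.Nonempty := fun U hU => (hcuts hU).2.1
  have hne : ∀ U ∈ optimalCutsAction S K, U.Nonempty := fun U hU => (hcuts hU).1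
  have hstab : ∀ U ∈ optimalCutsAction S K, ∀ g : P, g • U = U → g = 1 :=
    fun U hU => stabilizer_cut_eq_one htf hconn (hcuts hU)
  obtain ⟨k, rfl⟩ := Nat.exists_eq_succ_of_ne_zero hm
  have hαinj : Function.Injective α := by
    intro x y hxy
    rw [← hα x, ← hα y, Function.iterate_succ_apply, Function.iterate_succ_apply, hxy]
  have hαsurj : Function.Surjective α := fun x =>
    ⟨α^[k] x, by rw [← Function.iterate_succ_apply' (α : P → P)]; exact hα x⟩
  have hOα : ∀ U ∈ optimalCutsAction S K, α ⁻¹' U ∈ optimalCutsAction S K := fun U hU =>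
    preimage_mem_optimalCuts (Equiv.ofBijective α ⟨hαinj, hαsurj⟩)
      (fun x y => by
        change (α x)⁻¹ * α y ∈ S ↔ x⁻¹ * y ∈ S
        rw [← map_inv, ← map_mul, hαS]) hU
  let T := structureTree (optimalCutsAction S K) hcompl hstab
  let x₀ : Set (Set P) := {W | W ∈ optimalCutsAction S K ∧ 1 ∈ W}
  have hx₀ : ∀ g : P, g • x₀ = {W | W ∈ optimalCutsAction S K ∧ g ∈ W} := fun g => by
    rw [smul_principal, mul_one]
  have hfin : ∀ g : P, (x₀ \ (g • x₀)).Finite := by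
    intro g
    rw [hx₀]
    refine (finite_cuts_separating (cayley S) K 1 g).subset ?_
    rintro U ⟨⟨h1, h2⟩, h3⟩
    exact ⟨hcuts h1, h2, fun h => h3 ⟨h1, h⟩⟩
  have hor : ∀ g : P, IsOrientation (optimalCutsAction S K : Set (Set P)) (g • x₀) := by
    intro g
    rw [hx₀]
    exact isOrientation_principal hO g
  have hor1 : IsOrientation (optimalCutsAction S K : Set (Set P)) x₀ :=
    isOrientation_principal hO 1
  obtain ⟨D', h1, h2⟩ := T.exists_generating_pieces x₀ htf (MonoidHom.id P)
    Function.injective_id D hcomm hD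
    (fun g => TreeAction.Reach.finite_side_ne (F := Set.univ) (TreeAction.Reach.symm
      (reach_of_finite_sdiff hO hnest hor1 (hor g) (hfin g) fun _ _ _ => ⟨trivial, trivial⟩)))
    (H := fixedSubgroup α) (L := ⊤) le_top (EH := {U | α ⁻¹' U.1 = U.1})
    (fun h hh U hU => by
      ext x
      change α x ∈ h • U.1 ↔ x ∈ h • U.1
      rw [Set.mem_smul_set_iff_inv_smul_mem, Set.mem_smul_set_iff_inv_smul_mem]
      nth_rewrite 2 [← show α ⁻¹' U.1 = U.1 from hU]
      rw [Set.mem_preimage, smul_eq_mul, smul_eq_mul, map_mul, map_inv, show α h = h from hh])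
    (fun U hU g _ hg => by
      have h3 : (g⁻¹ * α g) • U.1 = U.1 := by
        ext y
        obtain ⟨x, hx⟩ := hαsurj (g * y)
        have h4 : α x ∈ g • U.1 ↔ x ∈ g • U.1 := Set.ext_iff.mp (show α ⁻¹' (g • U.1) = _ from hg) x
        have h5 : α (g⁻¹ * x) ∈ U.1 ↔ g⁻¹ * x ∈ U.1 :=
          Set.ext_iff.mp (show α ⁻¹' U.1 = U.1 from hU) _
        rw [hx, Set.mem_smul_set_iff_inv_smul_mem, Set.mem_smul_set_iff_inv_smul_mem, smul_eq_mul,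
          smul_eq_mul, inv_mul_cancel_left] at h4
        rw [h4, ← h5, map_mul, map_inv, hx, Set.mem_smul_set_iff_inv_smul_mem, smul_eq_mul,
          mul_inv_rev, inv_inv, mul_assoc]
      have := hstab U.1 U.2 _ h3
      exact (inv_mul_eq_one.mp this).symm)
    (fun h hh => by
      refine reach_of_finite_sdiff hO hnest hor1 (hor h) (hfin h) fun U hU hUm => ?_
      rw [hx₀] at hUm
      have h3 := preimage_eq_of_nested hnest α hm (hα) hOα (show α h = h from hh) hU hUm.1.2
        fun h => hUm.2 ⟨hU, h⟩
      exact ⟨h3, by change α ⁻¹' Uᶜ = Uᶜ; rw [Set.preimage_compl, h3]⟩)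
    (fun h _ => ⟨1, one_ne_zero, rfl⟩) (fun _ _ _ _ => trivial)
  refine ⟨D', h1, fun i => ?_⟩
  obtain ⟨w, hw, hDw⟩ | ⟨g, _, hg⟩ := h2 i
  swap
  · exact Or.inr ⟨g, hg⟩
  left
  have key : ∀ U ∈ optimalCutsAction S K, U ∉ w → ((D' i : Set P) ∩ U).Finite := by
    intro U hU hUw
    have hfin := (TreeAction.Reach.finite_side_ne hw).image Subtype.val
    refine Set.Finite.of_finite_image (f := fun g : P => g⁻¹ • U) (hfin.subset ?_) ?_
    · rintro _ ⟨g, ⟨hg, hgU⟩, rfl⟩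
      have hgU' : g⁻¹ • U ∈ optimalCutsAction S K := SubMulAction.smul_mem _ _ hU
      refine ⟨⟨g⁻¹ • U, hgU'⟩, ?_, rfl⟩
      have h3 : g⁻¹ • U ∈ x₀ := ⟨hgU', by
        rw [Set.mem_inv_smul_set_iff, smul_eq_mul, mul_one]
        exact hgU⟩
      have h4 : g⁻¹ • U ∉ w := by
        rw [SetLike.mem_coe, hDw] at hg
        rw [← show g⁻¹ • w = w from (MulAction.stabilizer P w).inv_mem hg.2, Set.smul_mem_smul_set_iff]
        exact hUw
      simp [T, structureTree, h3, h4]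
    · intro g _ h _ hgh
      have h3 : (h * g⁻¹) • U = U := by
        rw [mul_smul]
        exact (congrArg (h • ·) hgh).trans (smul_inv_smul h U)
      exact (mul_inv_eq_one.mp (hstab U hU _ h3)).symm
  intro U hU
  obtain h | h := not_mem_or_compl_not_mem_of_reach hne hw (U := U)
  · exact Or.inl (key U hU h)
  · exact Or.inr (key _ (hO U hU) h)

end FiniteOrder

end FreeProductFix

namespace FreeProductFix

section FixedVertex

namespace TreeAction

variable {P V E : Type*} [Group P] [MulAction P V] [MulAction P E] (T : TreeAction P V E)

lemma side_eq_or (hT : ∀ x y, T.Reach Set.univ x y) (e : E) (z : V) :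
    T.side e z = T.side e (T.src e) ∨ T.side e z = T.side e (T.tgt e) := by
  induction hT (T.src e) z with
  | refl => exact Or.inl rfl
  | @tail y z _ h ih =>
    obtain ⟨f, _, h⟩ := h
    by_cases hf : e = f
    · subst hf
      rcases h with ⟨_, rfl⟩ | ⟨rfl, _⟩
      exacts [Or.inr rfl, Or.inl rfl]
    · have h1 := T.side_ne e f hf
      rcases h with ⟨rfl, rfl⟩ | ⟨rfl, rfl⟩
      · rwa [h1]
      · rwa [← h1]

lemma side_eq_or_of_ne (hT : ∀ x y, T.Reach Set.univ x y) {e : E} {x y : V}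
    (h : T.side e x ≠ T.side e y) (z : V) : T.side e z = T.side e x ∨ T.side e z = T.side e y := by
  rcases T.side_eq_or hT e x with h1 | h1 <;> rcases T.side_eq_or hT e y with h2 | h2 <;>
    rcases T.side_eq_or hT e z with h3 | h3 <;> simp_all

lemma exists_side_ne (hT : ∀ x y, T.Reach Set.univ x y) {x y : V} (h : x ≠ y) :
    ∃ e, T.side e x ≠ T.side e y := by
  classical
  by_contra! h1
  have := finsum_side_sub_mul (hT x y) (fun z => if z = x then 1 else 0)
  simp [h1, h.symm] at this

lemma exists_endpoint_side_ne (e : E) (x : V) : ∃ y, T.side e y ≠ T.side e x ∧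
    ∀ f, f ≠ e → T.side f (T.src e) = T.side f y ∧ T.side f (T.tgt e) = T.side f y := by
  have h1 := T.side_self e
  by_cases h : T.side e (T.src e) = T.side e x
  · exact ⟨T.tgt e, by omega, fun f hf => ⟨(T.side_ne f e hf).symm, rfl⟩⟩
  · exact ⟨T.src e, h, fun f hf => ⟨rfl, T.side_ne f e hf⟩⟩

lemma side_eq_or_side_eq (hT : ∀ x y, T.Reach Set.univ x y) {e f : E} (hef : f ≠ e) {x y : V}
    (hy : T.side e y ≠ T.side e x)
    (hf : T.side f (T.src e) = T.side f y ∧ T.side f (T.tgt e) = T.side f y)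
    (hxy : T.side f x ≠ T.side f y) (z : V) :
    T.side f z = T.side f y ∨ T.side e z = T.side e x := by
  have h1 := T.side_ne e f hef.symm
  have hc : T.side e (T.src f) = T.side e x := by
    by_contra hc
    have key : ∀ z, T.Reach Set.univ x z → T.side e z = T.side e x ∧ T.side f z ≠ T.side f y := by
      intro z hz
      induction hz with
      | refl => exact ⟨rfl, hxy⟩
      | @tail u v _ h ih =>
        obtain ⟨d, _, h⟩ := h
        by_cases hde : d = e
        · subst hde
          rcases h with ⟨rfl, rfl⟩ | ⟨rfl, rfl⟩
          · exact absurd hf.1 ih.2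
          · exact absurd hf.2 ih.2
        by_cases hdf : d = f
        · subst hdf
          rcases h with ⟨rfl, rfl⟩ | ⟨rfl, rfl⟩
          · exact absurd ih.1 hc
          · exact absurd (h1.symm.trans ih.1) hc
        have h2 := T.side_ne e d (Ne.symm hde)
        have h3 := T.side_ne f d (Ne.symm hdf)
        rcases h with ⟨rfl, rfl⟩ | ⟨rfl, rfl⟩
        · rwa [h2, h3]
        · rwa [← h2, ← h3]
    exact hy (key y (hT x y)).1
  induction hT x z with
  | refl => exact Or.inr rfl
  | @tail u v _ h ih =>
    obtain ⟨d, _, h⟩ := h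
    by_cases hde : d = e
    · subst hde
      rcases h with ⟨rfl, rfl⟩ | ⟨rfl, rfl⟩
      · exact Or.inl hf.2
      · exact Or.inl hf.1
    by_cases hdf : d = f
    · subst hdf
      rcases h with ⟨rfl, rfl⟩ | ⟨rfl, rfl⟩
      · exact Or.inr (h1.trans hc)
      · exact Or.inr hc
    have h2 := T.side_ne e d (Ne.symm hde)
    have h3 := T.side_ne f d (Ne.symm hdf)
    rcases h with ⟨rfl, rfl⟩ | ⟨rfl, rfl⟩
    · rwa [h2, h3]
    · rwa [← h2, ← h3]

/-- A subgroup whose orbit is not cut into two infinite pieces by an edge fixes a vertex. -/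
theorem exists_le_stabilizer (hT : ∀ x y, T.Reach Set.univ x y)
    (htf : ∀ g : P, ∀ k : ℕ, k ≠ 0 → g ^ k = 1 → g = 1) (R : Subgroup P) (y₀ : V)
    (hR : ∀ e x y, T.side e x ≠ T.side e y →
      {g | g ∈ R ∧ T.side e (g • y₀) = T.side e x}.Finite ∨
      {g | g ∈ R ∧ T.side e (g • y₀) = T.side e y}.Finite) :
    ∃ x : V, R ≤ MulAction.stabilizer P x := by
  by_cases hbot : R = ⊥
  · exact ⟨y₀, by rw [hbot]; exact bot_le⟩
  obtain ⟨h, hhR, hh1⟩ := R.bot_or_exists_ne_one.resolve_left hbot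
  have hinj : Function.Injective fun k : ℕ => (h : P) ^ k := by
    refine injective_pow_iff_not_isOfFinOrder.mpr fun hfo => ?_
    obtain ⟨k, hk, hk1⟩ := isOfFinOrder_iff_pow_eq_one.mp hfo
    exact hh1 (htf _ k hk.ne' hk1)
  have hinf : (R : Set P).Infinite :=
    (Set.infinite_range_of_injective hinj).mono (Set.range_subset_iff.mpr fun k => R.pow_mem hhR k)
  let cls : E → ℤ → Set P := fun e c => {g | g ∈ R ∧ T.side e (g • y₀) = c}
  let M : V → Set E := fun x => {e | (cls e (T.side e x)).Finite}
  have hequiv : ∀ g ∈ R, ∀ e x, e ∈ M x → g • e ∈ M (g • x) := by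
    intro g hg e x he
    refine (he.image (g * ·)).subset ?_
    rintro k ⟨hk, hk1⟩
    refine ⟨g⁻¹ * k, ⟨R.mul_mem (R.inv_mem hg) hk, ?_⟩, mul_inv_cancel_left g k⟩
    rw [mul_smul, ← side_smul_left, hk1, T.side_smul]
  have hnot : ∀ e x y, T.side e x ≠ T.side e y → e ∈ M x → e ∉ M y := by
    intro e x y hxy hx hy
    refine hinf ((hx.union hy).subset fun g hg => ?_)
    exact (T.side_eq_or_of_ne hT hxy (g • y₀)).imp (fun h => ⟨hg, h⟩) (fun h => ⟨hg, h⟩)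
  have hM0 : (M y₀).Finite := by
    have hF0 : {f | T.side f y₀ ≠ T.side f ((h : P) • y₀)}.Finite :=
      Reach.finite_side_ne (hT _ _)
    have hg : ∀ f, {g | g ∈ R ∧ f ∈ M (g • y₀)}.Finite := by
      intro f
      have hc : ∀ c, {g | g ∈ R ∧ f ∈ M (g • y₀) ∧ T.side f (g • y₀) = c}.Finite := by
        intro c
        by_cases hc : (cls f c).Finite
        · exact hc.subset fun g hg => ⟨hg.1, hg.2.2⟩
        · convert Set.finite_empty
          refine Set.eq_empty_of_forall_notMem ?_
          rintro g ⟨_, h2, rfl⟩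
          exact hc h2
      refine ((hc (T.side f (T.src f))).union (hc (T.side f (T.tgt f)))).subset ?_
      rintro g ⟨h1, h2⟩
      exact (T.side_eq_or hT f (g • y₀)).imp (fun h => ⟨h1, h2, h⟩) (fun h => ⟨h1, h2, h⟩)
    refine (hF0.biUnion fun f _ => (hg f).image fun g => g⁻¹ • f).subset fun e he => ?_
    have hex : ∃ k : ℕ, T.side e ((h : P) ^ k • y₀) ≠ T.side e y₀ := by
      by_contra! hall
      exact Set.infinite_range_of_injective hinj
        (he.subset (Set.range_subset_iff.mpr fun k => ⟨R.pow_mem hhR k, hall k⟩))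
    classical
    obtain ⟨k, hk⟩ : ∃ k, Nat.find hex = k + 1 := by
      refine Nat.exists_eq_succ_of_ne_zero fun h0 => ?_
      have := Nat.find_spec hex
      rw [h0, pow_zero, one_smul] at this
      exact this rfl
    have h1 := Nat.find_spec hex
    have h2 := not_not.mp (Nat.find_min hex (m := k) (by omega))
    rw [hk] at h1
    have hk' : ((h : P) ^ k)⁻¹ ∈ R := R.inv_mem (R.pow_mem hhR k)
    refine Set.mem_biUnion (x := ((h : P) ^ k)⁻¹ • e) ?_ ⟨((h : P) ^ k)⁻¹,
      ⟨hk', hequiv _ hk' _ _ he⟩, inv_smul_smul _ _⟩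
    change T.side _ y₀ ≠ T.side _ _
    rw [side_smul_left, side_smul_left, inv_inv, h2, ← mul_smul, ← pow_succ]
    exact h1.symm
  have hM : ∀ x, (M x).Finite := by
    intro x
    refine (hM0.union (Reach.finite_side_ne (hT x y₀))).subset fun e he => ?_
    by_cases h1 : T.side e x = T.side e y₀
    · left
      change (cls e _).Finite
      rw [← h1]
      exact he
    · exact Or.inr h1
  obtain ⟨x, -, hx⟩ := (measure fun x => (M x).ncard).wf.has_min Set.univ ⟨y₀, trivial⟩
  have hempty : ∀ e, e ∉ M x := by
    intro e he
    obtain ⟨y, hy, hf⟩ := T.exists_endpoint_side_ne e x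
    refine hx y trivial (Set.ncard_lt_ncard ⟨fun f hfy => ?_, fun hsub => ?_⟩ (hM x))
    · have hfe : f ≠ e := by
        rintro rfl
        exact hnot _ _ _ hy.symm he hfy
      by_cases hfx : T.side f x = T.side f y
      · change (cls f _).Finite
        rw [hfx]
        exact hfy
      · exfalso
        refine hinf ((Set.Finite.union hfy he).subset fun g hg => ?_)
        exact (T.side_eq_or_side_eq hT hfe hy (hf f hfe) hfx (g • y₀)).imp
          (fun h => ⟨hg, h⟩) (fun h => ⟨hg, h⟩)
    · exact hnot _ _ _ hy.symm he (hsub he)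
  refine ⟨x, fun g hg => ?_⟩
  by_contra hgx
  obtain ⟨e, he⟩ := T.exists_side_ne hT (show g • x ≠ x from hgx)
  rcases hR e _ _ he with h1 | h1
  · have := hequiv _ (R.inv_mem hg) _ _ (show e ∈ M (g • x) from h1)
    rw [inv_smul_smul] at this
    exact hempty _ this
  · exact hempty e h1

end TreeAction

end FixedVertex

end FreeProductFix

namespace FreeProductFix

section UncutSubgroups

variable {P : Type*}

lemma exists_ultrafilter_of_infinite {A : Set P} (hA : A.Infinite) :
    ∃ ω : Ultrafilter P, A ∈ ω ∧ ∀ B ∈ ω, B.Infinite := by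
  have := hA.cofinite_inf_principal_neBot
  refine ⟨Ultrafilter.of (Filter.cofinite ⊓ Filter.principal A), ?_, fun B hB hfin => ?_⟩
  · exact Ultrafilter.of_le _ (Filter.mem_inf_of_right (Filter.mem_principal_self A))
  · have h1 : Bᶜ ∈ Ultrafilter.of (Filter.cofinite ⊓ Filter.principal A) :=
      Ultrafilter.of_le _ (Filter.mem_inf_of_left hfin.compl_mem_cofinite)
    exact Ultrafilter.compl_mem_iff_notMem.mp h1 hB

lemma finite_inter_or_finite_inter_compl {r : P → P → Prop} {K : ℕ} {R : Set P}
    (hR : ∀ W ∈ optimalCuts r K, (R ∩ W).Finite ∨ (R ∩ Wᶜ).Finite) {U : Set P}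
    (hfin : (edgeBoundary r U).Finite) (hK : (edgeBoundary r U).ncard ≤ K) :
    (R ∩ U).Finite ∨ (R ∩ Uᶜ).Finite := by
  by_contra! h
  obtain ⟨ω, h1, h2⟩ := exists_ultrafilter_of_infinite h.1
  obtain ⟨ω', h3, h4⟩ := exists_ultrafilter_of_infinite h.2
  have hRω : R ∈ ω := Filter.mem_of_superset h1 Set.inter_subset_left
  have hRω' : R ∈ ω' := Filter.mem_of_superset h3 Set.inter_subset_left
  have hU : U ∈ ω := Filter.mem_of_superset h1 Set.inter_subset_right
  have hU' : U ∉ ω' := Ultrafilter.compl_mem_iff_notMem.mp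
    (Filter.mem_of_superset h3 Set.inter_subset_right)
  obtain ⟨W, hW⟩ := exists_isOptimal (ω := ω) (ω' := ω') (fun h => hU' (h.mp hU)) hfin hK
  have hWR := hR W ⟨ω, ω', hW⟩
  by_cases hWω : W ∈ ω
  · have hWω' : Wᶜ ∈ ω' := Ultrafilter.compl_mem_iff_notMem.mpr
      fun h => hW.sep ⟨fun _ => h, fun _ => hWω⟩
    exact hWR.elim (h2 _ (Filter.inter_mem hRω hWω)) (h4 _ (Filter.inter_mem hRω' hWω'))
  · have hWω' : W ∈ ω' := by
      by_contra h
      exact hW.sep ⟨fun h => absurd h hWω, fun h' => absurd h' h⟩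
    exact hWR.elim (h4 _ (Filter.inter_mem hRω' hWω'))
      (h2 _ (Filter.inter_mem hRω (Ultrafilter.compl_mem_iff_notMem.mpr hWω)))

end UncutSubgroups

section FiniteOrder

variable {P : Type*} [Group P]

lemma exists_invariant_generators (hfg : Group.FG P) (α : P →* P) {m : ℕ} (hm : m ≠ 0)
    (hα : ∀ g, α^[m] g = g) :
    ∃ S : Set P, S.Finite ∧ (∀ s ∈ S, s⁻¹ ∈ S) ∧ (∀ s, α s ∈ S ↔ s ∈ S) ∧
      Subgroup.closure S = ⊤ := by
  obtain ⟨S₀, hS₀, hfin⟩ := Group.fg_iff.mp hfg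
  refine ⟨{s | ∃ k, α^[k] s ∈ S₀ ∨ (α^[k] s)⁻¹ ∈ S₀}, ?_, ?_, fun s => ⟨?_, ?_⟩, ?_⟩
  · refine ((Set.finite_Iic m).biUnion fun j _ => (hfin.union hfin.inv).image α^[j]).subset ?_
    rintro s ⟨k, hk⟩
    have h1 : Function.IsPeriodicPt α m s := hα s
    have hlt := Nat.mod_lt k (Nat.pos_of_ne_zero hm)
    refine Set.mem_biUnion (x := m - k % m) (Nat.sub_le _ _) ⟨α^[k % m] s, ?_, ?_⟩
    · rwa [h1.iterate_mod_apply]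
    · rw [← Function.iterate_add_apply, Nat.sub_add_cancel hlt.le]
      exact hα s
  · rintro s ⟨k, hk⟩
    refine ⟨k, ?_⟩
    rw [← iterHom_apply, map_inv, iterHom_apply, inv_inv]
    exact hk.symm
  · rintro ⟨k, hk⟩
    exact ⟨k + 1, hk⟩
  · rintro ⟨k, hk⟩
    refine ⟨k + (m - 1), ?_⟩
    rw [← Function.iterate_succ_apply, Nat.succ_eq_add_one,
      show k + (m - 1) + 1 = k + m by omega, Function.iterate_add_apply, hα]
    exact hk
  · rw [← top_le_iff, ← hS₀]
    exact Subgroup.closure_mono fun s hs => ⟨0, Or.inl hs⟩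

/-- The fixed subgroup of an automorphism of finite order is generated by cyclic subgroups and by
subgroups which fix a vertex of a given tree. -/
theorem TreeAction.exists_elliptic_pieces [Countable P] (hfg : Group.FG P)
    (htf : ∀ g : P, ∀ k : ℕ, k ≠ 0 → g ^ k = 1 → g = 1) (α : P →* P) {m : ℕ} (hm : m ≠ 0)
    (hα : ∀ g, α^[m] g = g) {n : ℕ} (D : Fin n → Subgroup P)
    (hcomm : ∀ i, ∀ a ∈ D i, ∀ b ∈ D i, a * b = b * a) (hD : ⨆ i, D i = ⊤)
    {V E : Type*} [MulAction P V] [MulAction P E] (T : TreeAction P V E)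
    (hT : ∀ x y, T.Reach Set.univ x y) (y₀ : V) :
    ∃ D : Fin n → Subgroup P, fixedSubgroup α = ⨆ i, D i ∧
      ∀ i, (∃ x : V, D i ≤ MulAction.stabilizer P x) ∨ ∃ g, D i = Subgroup.zpowers g := by
  obtain ⟨S, hSfin, hSinv, hαS, hgen⟩ := exists_invariant_generators hfg α hm hα
  let Z : Set (P × E) := {p | p.1 ∈ S ∧ T.side p.2 y₀ ≠ T.side p.2 (p.1 • y₀)}
  have hZ : Z.Finite := by
    refine (hSfin.biUnion fun s _ =>
      (Reach.finite_side_ne (hT y₀ (s • y₀))).image (Prod.mk s)).subset ?_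
    rintro ⟨s, e⟩ ⟨hs, he⟩
    exact Set.mem_biUnion hs ⟨e, he, rfl⟩
  obtain ⟨D', h1, h2⟩ := exists_uncut_pieces htf α hm hα D hcomm hD hSinv hαS hgen Z.ncard
  refine ⟨D', h1, fun i => (h2 i).imp_left fun hi => ?_⟩
  refine T.exists_le_stabilizer hT htf _ y₀ fun e x y hxy => ?_
  let U : Set P := {g | T.side e (g • y₀) = T.side e x}
  let f : P × P → P × E := fun p => (p.1⁻¹ * p.2, p.1⁻¹ • e)
  have hf : Set.MapsTo f (edgeBoundary (cayley S) U) Z := by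
    rintro ⟨a, b⟩ ⟨hab, hU⟩
    refine ⟨hab, fun h3 => hU ?_⟩
    simp only [f, side_smul_left, inv_inv, mul_smul, smul_inv_smul] at h3
    simp only [U, Set.mem_ofPred_eq, h3]
  have hinj : Function.Injective f := by
    rintro ⟨a, b⟩ ⟨c, d⟩ h
    obtain ⟨h3, h4⟩ := Prod.ext_iff.mp h
    simp only [f] at h3 h4
    have h5 : (c * a⁻¹) • e = e := by rw [mul_smul, h4, smul_inv_smul]
    have h6 := mul_inv_eq_one.mp (T.free _ _ h5)
    subst h6
    rw [mul_right_inj] at h3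
    rw [h3]
  have hfin : (edgeBoundary (cayley S) U).Finite := hZ.of_injOn hf hinj.injOn
  have hcard := Set.ncard_le_ncard_of_injOn f hf hinj.injOn hZ
  refine (finite_inter_or_finite_inter_compl hi hfin hcard).imp (fun h => h) fun h => ?_
  refine h.subset ?_
  rintro g ⟨hg, hgy⟩
  exact ⟨hg, fun h3 => hxy (h3.symm.trans hgy)⟩

end FiniteOrder

end FreeProductFix

namespace FreeProductFix

section Few

variable {G H : Type*} [Group G] [Group H]

/-- The subgroups generated by at most `N` elements. -/
def GeneratedBy (N : ℕ) (R : Subgroup G) : Prop :=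
  ∃ s : Finset G, s.card ≤ N ∧ Subgroup.closure (s : Set G) = R

lemma generatedBy_zpowers {N : ℕ} (hN : 1 ≤ N) (g : G) : GeneratedBy N (Subgroup.zpowers g) :=
  ⟨{g}, by simpa using hN, by rw [Finset.coe_singleton, Subgroup.zpowers_eq_closure]⟩

lemma GeneratedBy.map {N : ℕ} {R : Subgroup G} (h : GeneratedBy N R) (f : G →* H) :
    GeneratedBy N (R.map f) := by
  classical
  obtain ⟨s, hs, rfl⟩ := h
  exact ⟨s.image f, Finset.card_image_le.trans hs, by
    rw [Finset.coe_image, MonoidHom.map_closure]⟩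

lemma GeneratedBy.of_map {N : ℕ} {R : Subgroup G} {f : G →* H} (hf : Function.Injective f)
    (h : GeneratedBy N (R.map f)) : GeneratedBy N R := by
  classical
  obtain ⟨s, hs, hR⟩ := h
  refine ⟨s.preimage f hf.injOn, (Finset.card_le_card_of_injOn f (by simp [Set.MapsTo]) hf.injOn).trans hs, ?_⟩
  apply Subgroup.map_injective hf
  rw [MonoidHom.map_closure, ← hR, Finset.coe_preimage, Set.image_preimage_eq_of_subset]
  intro x hx
  have : x ∈ R.map f := hR ▸ Subgroup.subset_closure hx
  obtain ⟨y, _, rfl⟩ := this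
  exact ⟨y, rfl⟩

lemma GeneratedBy.iSup {N n : ℕ} {D : Fin n → Subgroup G} (h : ∀ i, GeneratedBy N (D i)) :
    GeneratedBy (n * N) (⨆ i, D i) := by
  classical
  choose s hs hD using h
  refine ⟨Finset.univ.biUnion s, ?_, ?_⟩
  · refine Finset.card_biUnion_le.trans ((Finset.sum_le_sum fun i _ => hs i).trans ?_)
    simp
  · rw [Finset.coe_biUnion]
    simp only [Finset.coe_univ, Set.mem_univ, Set.iUnion_true, Subgroup.closure_iUnion, hD]

end Few

section Periodic

variable {Q : Type*} [Group Q]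

/-- The subgroup of periodic points of an endomorphism. -/
def periodicSubgroup (φ : Q →* Q) : Subgroup Q where
  carrier := {g | ∃ p, p ≠ 0 ∧ φ^[p] g = g}
  one_mem' := ⟨1, one_ne_zero, map_one φ⟩
  mul_mem' := by
    rintro a b ⟨p, hp, ha⟩ ⟨q, hq, hb⟩
    refine ⟨p * q, mul_ne_zero hp hq, ?_⟩
    rw [← iterHom_apply, map_mul, iterHom_apply, iterHom_apply,
      show φ^[p * q] a = a from Function.IsPeriodicPt.mul_const ha q,
      show φ^[p * q] b = b from Function.IsPeriodicPt.const_mul hb p]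
  inv_mem' := by
    rintro a ⟨p, hp, ha⟩
    refine ⟨p, hp, ?_⟩
    rw [← iterHom_apply, map_inv, iterHom_apply, ha]

lemma exists_common_period (φ : Q →* Q) {s : Finset Q}
    (hs : Subgroup.closure (s : Set Q) = periodicSubgroup φ) :
    ∃ m, m ≠ 0 ∧ ∀ g ∈ periodicSubgroup φ, φ^[m] g = g := by
  have h1 : ∀ g : s, ∃ p, p ≠ 0 ∧ φ^[p] (g : Q) = g := fun g =>
    show (g : Q) ∈ periodicSubgroup φ from hs ▸ Subgroup.subset_closure g.2
  choose p hp hpg using h1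
  refine ⟨∏ g, p g, Finset.prod_ne_zero_iff.mpr fun g _ => hp g, fun g hg => ?_⟩
  have h2 : Subgroup.closure (s : Set Q) ≤
      (iterHom φ (∏ g, p g)).eqLocus (MonoidHom.id Q) := by
    rw [Subgroup.closure_le]
    intro a ha
    change iterHom φ _ a = a
    rw [iterHom_apply]
    exact Function.IsPeriodicPt.trans_dvd (hpg (⟨a, ha⟩ : s))
      (Finset.dvd_prod_of_mem p (Finset.mem_univ (⟨a, ha⟩ : s)))
  have h3 := h2 (hs ▸ hg)
  change iterHom φ _ g = g at h3
  rwa [iterHom_apply] at h3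

theorem TreeAction.generatedBy_fixedSubgroup [Countable Q]
    {V E : Type*} [MulAction Q V] [MulAction Q E] (T : TreeAction Q V E)
    (hT : ∀ x y, T.Reach Set.univ x y) (y₀ : V)
    (htf : ∀ g : Q, ∀ k : ℕ, k ≠ 0 → g ^ k = 1 → g = 1) {N : ℕ} (hN : 1 ≤ N)
    (hell : ∀ (x : V) (R : Subgroup Q), R ≤ MulAction.stabilizer Q x →
      GeneratedBy N R ∧ ∀ a ∈ R, ∀ b ∈ R, a * b = b * a)
    (φ : Q →* Q) (hφ : Function.Injective φ) {n : ℕ} (D : Fin n → Subgroup Q)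
    (hcomm : ∀ i, ∀ a ∈ D i, ∀ b ∈ D i, a * b = b * a) (hD : ⨆ i, D i = ⊤) :
    GeneratedBy (n * N) (fixedSubgroup φ) := by
  obtain ⟨D₁, hD₁, h₁⟩ := T.exists_generating_pieces y₀ htf φ hφ D hcomm hD
    (fun g => Reach.finite_side_ne (hT _ _)) (le_refl (periodicSubgroup φ)) (EH := Set.univ)
    (fun _ _ _ _ => trivial) (fun _ _ _ h _ => h) (fun _ _ => hT _ _)
    (fun _ h => h) (fun g p hp hg => ⟨p, hp, hg⟩)
  have h₂ : ∀ i, GeneratedBy N (D₁ i) ∧ ∀ a ∈ D₁ i, ∀ b ∈ D₁ i, a * b = b * a := by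
    intro i
    obtain ⟨w, _, hw⟩ | ⟨g, _, hg⟩ := h₁ i
    · rw [hw]
      exact hell w _ inf_le_right
    · rw [hg]
      refine ⟨generatedBy_zpowers hN g, fun a ha b hb => ?_⟩
      obtain ⟨k, rfl⟩ := Subgroup.mem_zpowers_iff.mp ha
      obtain ⟨l, rfl⟩ := Subgroup.mem_zpowers_iff.mp hb
      exact (Commute.refl g).zpow_zpow k l
  obtain ⟨s, -, hs⟩ := GeneratedBy.iSup fun i => (h₂ i).1
  rw [← hD₁] at hs
  obtain ⟨m, hm, hper⟩ := exists_common_period φ hs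
  let P := periodicSubgroup φ
  have hfg : Group.FG P := (Group.fg_iff_subgroup_fg P).mpr ⟨s, hs⟩
  have hmaps : ∀ g ∈ P, φ g ∈ P := by
    rintro g ⟨p, hp, hg⟩
    exact ⟨p, hp, by rw [← Function.iterate_succ_apply, Function.iterate_succ_apply', hg]⟩
  let α : P →* P := (φ.comp P.subtype).codRestrict P fun g => hmaps g g.2
  have hα : ∀ (k : ℕ) (g : P), ((α^[k] g : P) : Q) = φ^[k] g := by
    intro k
    induction k with
    | zero => exact fun g => rfl
    | succ k ih => exact fun g => ih (α g)
  have hle : ∀ i, D₁ i ≤ P := fun i => (le_iSup D₁ i).trans hD₁.ge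
  obtain ⟨D₃, hD₃, h₃⟩ := (T.restrict P).exists_elliptic_pieces hfg
    (fun g k hk hg => Subtype.ext (htf g k hk (congrArg Subtype.val hg))) α hm
    (fun g => Subtype.ext ((hα m g).trans (hper g g.2))) (fun i => (D₁ i).subgroupOf P)
    (fun i a ha b hb => Subtype.ext ((h₂ i).2 a ha b hb))
    (by
      apply Subgroup.map_injective P.subtype_injective
      rw [Subgroup.map_iSup, ← MonoidHom.range_eq_map, Subgroup.range_subtype]
      simp only [Subgroup.subgroupOf_map_subtype, inf_of_le_left (hle _)]
      exact hD₁.symm)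
    (fun x y => (hT x y).restrict P) y₀
  have hfix : fixedSubgroup φ = ⨆ i, (D₃ i).map P.subtype := by
    rw [← Subgroup.map_iSup, ← hD₃]
    ext g
    constructor
    · intro hg
      exact ⟨⟨g, 1, one_ne_zero, hg⟩, Subtype.ext hg, rfl⟩
    · rintro ⟨g, hg, rfl⟩
      exact congrArg Subtype.val (show α g = g from hg)
  rw [hfix]
  refine GeneratedBy.iSup fun i => ?_
  obtain ⟨x, hx⟩ | ⟨g, hg⟩ := h₃ i
  · refine (hell x _ ?_).1
    rintro _ ⟨g, hg, rfl⟩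
    exact hx hg
  · rw [hg, MonoidHom.map_zpowers]
    exact generatedBy_zpowers hN _

end Periodic

end FreeProductFix

namespace FreeProductFix

section FreeProduct

open Monoid

lemma countable_coprodI {n : ℕ} {M : Fin n → Type*} [∀ i, Group (M i)] [∀ i, Countable (M i)] :
    Countable (CoprodI M) := by
  classical
  have : Function.Injective fun w : CoprodI.Word M => w.toList := fun w v h => CoprodI.Word.ext h
  have h1 : Countable (CoprodI.Word M) := this.countable
  exact CoprodI.Word.equiv.injective.countable

variable {n : ℕ} {t : Fin n → ℕ}

/-- An embedding of a free abelian group of finite rank into the additive group `ℤ[X]`. -/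
noncomputable def polyEmbedding (k : ℕ) :
    Multiplicative (Fin k → ℤ) →* Multiplicative (Polynomial ℤ) :=
  AddMonoidHom.toMultiplicative
    { toFun := fun v => ∑ j : Fin k, Polynomial.monomial (j : ℕ) (v j)
      map_zero' := by simp
      map_add' := fun v w => by simp [Finset.sum_add_distrib] }

lemma polyEmbedding_injective (k : ℕ) : Function.Injective (polyEmbedding k) := by
  intro v w h
  have h1 : ∑ j : Fin k, Polynomial.monomial (j : ℕ) (v.toAdd j) =
      ∑ j : Fin k, Polynomial.monomial (j : ℕ) (w.toAdd j) := h
  refine Multiplicative.toAdd.injective (funext fun i => ?_)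
  have h2 := congrArg (fun p => Polynomial.coeff p (i : ℕ)) h1
  simpa [Polynomial.finsetSum_coeff, Polynomial.coeff_monomial, Fin.val_inj] using h2

lemma bassSerre_connected {A : Fin n → Type*} [∀ i, Group (A i)] [∀ i, Nontrivial (A i)]
    (x y : BSVertex A) : (bassSerre A).Reach Set.univ x y := by
  have key : ∀ x, (bassSerre A).Reach Set.univ (.inl 1) x := by
    rintro (g | ⟨i, c⟩)
    · exact bassSerre_reach g
    · obtain ⟨g, rfl⟩ := QuotientGroup.mk_surjective c
      exact (bassSerre_reach g).tail ⟨⟨i, g⟩, trivial, Or.inl ⟨rfl, rfl⟩⟩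
  exact (key x).symm.trans (key y)

theorem generatedBy_fixedSubgroup (ht : ∀ i, 1 ≤ t i) {N : ℕ} (hN : 1 ≤ N) (htN : ∀ i, t i ≤ N)
    (φ : CoprodI (fun i => Multiplicative (Fin (t i) → ℤ)) →*
      CoprodI (fun i => Multiplicative (Fin (t i) → ℤ))) :
    GeneratedBy (n * N) (fixedSubgroup φ) := by
  let A : Fin n → Type := fun i => Multiplicative (Fin (t i) → ℤ)
  let G := CoprodI A
  have hcountA : ∀ i, Countable (A i) := fun i => inferInstanceAs (Countable (Fin (t i) → ℤ))
  have hcount : Countable G := countable_coprodI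
  have hnontriv : ∀ i, Nontrivial (A i) := fun i => by
    have : Nonempty (Fin (t i)) := ⟨⟨0, ht i⟩⟩
    exact inferInstanceAs (Nontrivial (Fin (t i) → ℤ))
  have htop : ⨆ i, (CoprodI.of : A i →* G).range = ⊤ := by
    rw [← CoprodI.range_eq_iSup, CoprodI.lift_of']
    exact MonoidHom.range_eq_top.mpr Function.surjective_id
  have hfg : Group.FG G := by
    obtain ⟨s, -, hs⟩ := GeneratedBy.iSup fun i =>
      exists_finset_closure_eq (htN i) (CoprodI.of : A i →* G) _ le_rfl
    exact ⟨⟨s, hs.trans htop⟩⟩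
  have hθ : ∀ i, Function.Injective (polyEmbedding (t i)) := fun i => polyEmbedding_injective _
  have hinj : Function.Injective (polyRep (M := A) fun i => polyEmbedding (t i)) :=
    (injective_iff_map_eq_one _).mpr (polyRep_injective _ hθ)
  have htf : ∀ g : G, ∀ k : ℕ, k ≠ 0 → g ^ k = 1 → g = 1 := fun g k hk hg =>
    coprodI_torsionFree (M := A) _ hθ g hk hg
  obtain ⟨K, hK⟩ := exists_ker_iterate_stable _ hinj φ
  let Q : Subgroup G := (iterHom φ K).range
  have hmem : ∀ g, φ^[K] g ∈ Q := fun g => ⟨g, iterHom_apply φ K g⟩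
  have hmaps : ∀ g ∈ Q, φ g ∈ Q := by
    rintro _ ⟨g, rfl⟩
    rw [iterHom_apply, ← Function.iterate_succ_apply' φ, Function.iterate_succ_apply]
    exact hmem _
  let ψ : Q →* Q := (φ.comp Q.subtype).codRestrict Q fun g => hmaps g g.2
  have hψ : Function.Injective ψ := by
    rw [injective_iff_map_eq_one]
    rintro ⟨_, g, rfl⟩ h
    have h1 : φ (iterHom φ K g) = 1 := congrArg Subtype.val h
    rw [iterHom_apply, ← Function.iterate_succ_apply' φ] at h1
    refine Subtype.ext ?_
    change iterHom φ K g = 1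
    rw [iterHom_apply]
    exact hK g h1
  have hfix : fixedSubgroup φ = (fixedSubgroup ψ).map Q.subtype := by
    ext g
    constructor
    · intro hg
      have hgK : φ^[K] g = g := Function.iterate_fixed hg K
      exact ⟨⟨g, hgK ▸ hmem g⟩, Subtype.ext hg, rfl⟩
    · rintro ⟨g, hg, rfl⟩
      exact congrArg Subtype.val (show ψ g = g from hg)
  rw [hfix]
  refine GeneratedBy.map ?_ _
  have hstab : ∀ (x : BSVertex A) (R : Subgroup Q), R ≤ MulAction.stabilizer Q x →
      GeneratedBy N R ∧ ∀ a ∈ R, ∀ b ∈ R, a * b = b * a := by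
    intro x R hR
    have hR' : R.map Q.subtype ≤ MulAction.stabilizer G x := by
      rintro _ ⟨g, hg, rfl⟩
      exact hR hg
    obtain h | ⟨i, f, -, h⟩ := bassSerre_stabilizer x _ hR'
    · rw [(Subgroup.map_eq_bot_iff_of_injective R Q.subtype_injective).mp h]
      refine ⟨⟨∅, by simp, by simp⟩, ?_⟩
      rintro a ha b hb
      rw [Subgroup.mem_bot.mp ha, Subgroup.mem_bot.mp hb]
    · refine ⟨GeneratedBy.of_map Q.subtype_injective
        (exists_finset_closure_eq (htN i) f _ h), fun a ha b hb => Subtype.ext ?_⟩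
      obtain ⟨a', ha'⟩ := h ⟨a, ha, rfl⟩
      obtain ⟨b', hb'⟩ := h ⟨b, hb, rfl⟩
      change Q.subtype a * Q.subtype b = Q.subtype b * Q.subtype a
      rw [← ha', ← hb', ← map_mul, ← map_mul, mul_comm]
  refine ((bassSerre A).restrict Q).generatedBy_fixedSubgroup
    (fun x y => (bassSerre_connected x y).restrict Q) (.inl 1)
    (fun g k hk hg => Subtype.ext (htf g k hk (congrArg Subtype.val hg))) hN hstab ψ hψ
    (fun i => ((iterHom φ K).rangeRestrict.comp (CoprodI.of (M := A) (i := i))).range) ?_ ?_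
  · rintro i _ ⟨a, rfl⟩ _ ⟨b, rfl⟩
    rw [← map_mul, ← map_mul, mul_comm]
  · simp only [MonoidHom.range_comp, ← Subgroup.map_iSup, htop]
    rw [← MonoidHom.range_eq_map, MonoidHom.range_eq_top]
    exact (iterHom φ K).rangeRestrict_surjective

lemma exists_fg_and_rank_le {G : Type*} [Group G] {N : ℕ} {R : Subgroup G}
    (h : GeneratedBy N R) : ∃ _ : Group.FG R, Group.rank R ≤ N := by
  have h1 : GeneratedBy N (⊤ : Subgroup R) := by
    refine GeneratedBy.of_map R.subtype_injective ?_
    rwa [← MonoidHom.range_eq_map, Subgroup.range_subtype]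
  obtain ⟨s, hs, hR⟩ := h1
  have hfg : Group.FG R := ⟨⟨s, hR⟩⟩
  exact ⟨hfg, (Group.rank_le hR).trans hs⟩

end FreeProduct

end FreeProductFix

/-- For a free product `G = ℤ^{t₁} ∗ ⋯ ∗ ℤ^{t_n}` of free abelian groups (each `tᵢ ≥ 1`),
every endomorphism `φ` of `G` has finitely generated fixed subgroup with
`rk(Fix(φ)) ≤ n·(rk(G) − n + 1)`, where `rk(G) = t₁ + ⋯ + t_n`; in particular if all the
`tᵢ` are equal then `rk(Fix(φ)) ≤ rk(G)`. -/
theorem fixedSubgroup_of_freeProduct_of_freeAbelianGroups (n : ℕ) (t : Fin n → ℕ)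
    (ht : ∀ i, 1 ≤ t i)
    (φ : Monoid.CoprodI (fun i => Multiplicative (Fin (t i) → ℤ)) →*
         Monoid.CoprodI (fun i => Multiplicative (Fin (t i) → ℤ))) :
    ∃ hfg : Group.FG ↥(fixedSubgroup φ),
      @Group.rank _ _ hfg ≤ n * ((∑ i, t i) - n + 1) ∧
      ((∀ i j, t i = t j) → @Group.rank _ _ hfg ≤ ∑ i, t i) := by
  have hle : ∀ i, t i ≤ (∑ i, t i) - n + 1 := by
    intro i
    have h1 : ∑ j ∈ Finset.univ.erase i, 1 ≤ ∑ j ∈ Finset.univ.erase i, t j :=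
      Finset.sum_le_sum fun j _ => ht j
    rw [Finset.sum_const, Finset.card_erase_of_mem (Finset.mem_univ i), Finset.card_univ,
      Fintype.card_fin, smul_eq_mul, mul_one] at h1
    have h2 := Finset.sum_erase_add Finset.univ t (Finset.mem_univ i)
    omega
  obtain ⟨hfg, hrank⟩ := FreeProductFix.exists_fg_and_rank_le
    (FreeProductFix.generatedBy_fixedSubgroup ht (Nat.le_add_left 1 _) hle φ)
  refine ⟨hfg, hrank, fun heq => ?_⟩
  rcases Nat.eq_zero_or_pos n with rfl | hn
  · simpa using hrank
  · obtain ⟨_, h⟩ := FreeProductFix.exists_fg_and_rank_le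
      (FreeProductFix.generatedBy_fixedSubgroup ht (ht ⟨0, hn⟩) (fun i => (heq i ⟨0, hn⟩).le) φ)
    have hsum : ∑ i, t i = n * t ⟨0, hn⟩ := by
      rw [Finset.sum_congr rfl fun i _ => heq i ⟨0, hn⟩]
      simp
    rw [hsum]
    exact h
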